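/- arXiv:0704.2713 — 2 statements merged into one kernel-verified Lean document; each statement's English description precedes it below -/
import Mathlib

section
/- Let q > 2 be a prime power, d ≥ 1, N = (d+1)(q−1), and l < q−1. Then the star K_{1,l} (one center vertex joined to l other vertices) is a constraint graph in σ^N: every continuous map f : ‖σ^N‖ → ℝ^d has a Tverberg partition in which the partition class containing the center vertex contains none of the l leaf vertices. -/
/-- The geometric realization of the face of the standard simplex spanned by
the vertex set `F`: points of the standard simplex supported on `F`. -/
def faceRealization {ι : Type*} [Fintype ι] (F : Finset ι) :
    Set (stdSimplex ℝ ι) :=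
  {w | ∀ j : ι, w.1 j ≠ 0 → j ∈ F}

namespace ListChain

variable {k : Type*} [Field k] {V W : Type*}

/-- Prepending a vertex to every list of a chain. -/
noncomputable def cons (v : V) : (List V →₀ k) →ₗ[k] (List V →₀ k) :=
  Finsupp.lmapDomain k k (List.cons v)

/-- The boundary of an ordered simplex, in the augmented complex of ordered chains. -/
noncomputable def listBoundary (k : Type*) [Field k] {V : Type*} : List V → (List V →₀ k)
  | [] => 0
  | v :: l => Finsupp.single l 1 - cons v (listBoundary k l)

/-- The boundary operator of the augmented complex of ordered chains. -/
noncomputable def boundary : (List V →₀ k) →ₗ[k] (List V →₀ k) :=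
  Finsupp.linearCombination k (listBoundary k)

/-- The map of ordered chains induced by a map of vertices. -/
noncomputable def map (f : V → W) : (List V →₀ k) →ₗ[k] (List W →₀ k) :=
  Finsupp.lmapDomain k k (List.map f)

@[simp] lemma cons_single (v : V) (l : List V) (a : k) :
    cons v (Finsupp.single l a) = Finsupp.single (v :: l) a := by
  simp [cons, Finsupp.mapDomain_single]

@[simp] lemma map_single (f : V → W) (l : List V) (a : k) :
    map f (Finsupp.single l a) = Finsupp.single (l.map f) a := by
  simp [map, Finsupp.mapDomain_single]

@[simp] lemma boundary_single (l : List V) :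
    boundary (Finsupp.single l (1 : k)) = listBoundary k l := by
  simp [boundary]

@[simp] lemma listBoundary_nil : listBoundary k ([] : List V) = 0 := rfl

lemma listBoundary_cons (v : V) (l : List V) :
    listBoundary k (v :: l) = Finsupp.single l 1 - cons v (listBoundary k l) := rfl

lemma linearMap_ext {M : Type*} [AddCommGroup M] [Module k M] {φ ψ : (List V →₀ k) →ₗ[k] M}
    (h : ∀ l, φ (Finsupp.single l 1) = ψ (Finsupp.single l 1)) : φ = ψ := by
  ext l
  simpa using h l

lemma map_cons (f : V → W) (v : V) (x : List V →₀ k) :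
    map f (cons v x) = cons (f v) (map f x) := by
  have : (map f).comp (cons v) = (cons (f v)).comp (map (k := k) f) :=
    linearMap_ext fun l => by simp
  exact LinearMap.congr_fun this x

lemma boundary_cons (v : V) (x : List V →₀ k) :
    boundary (cons v x) = x - cons v (boundary x) := by
  have : boundary.comp (cons v) = LinearMap.id - (cons v).comp (boundary (k := k)) :=
    linearMap_ext fun l => by simp [listBoundary_cons]
  exact LinearMap.congr_fun this x

lemma boundary_listBoundary (l : List V) : boundary (listBoundary k l) = 0 := by
  induction l with
  | nil => simp
  | cons v l ih => simp [listBoundary_cons, boundary_cons, ih]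

lemma boundary_boundary (x : List V →₀ k) : boundary (boundary x) = 0 := by
  have : boundary.comp boundary = (0 : (List V →₀ k) →ₗ[k] (List V →₀ k)) :=
    linearMap_ext fun l => by simp [boundary_listBoundary]
  exact LinearMap.congr_fun this x

lemma map_listBoundary (f : V → W) (l : List V) :
    map f (listBoundary k l) = listBoundary k (l.map f) := by
  induction l with
  | nil => simp
  | cons v l ih => simp [listBoundary_cons, map_cons, ih]

lemma boundary_map (f : V → W) (x : List V →₀ k) :
    boundary (map f x) = map f (boundary x) := by
  have : boundary.comp (map f) = (map f).comp (boundary (k := k)) :=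
    linearMap_ext fun l => by simp [map_listBoundary]
  exact LinearMap.congr_fun this x

/-- To place the image of a chain in a submodule it suffices to do so for its simplices. -/
lemma mem_of_supported {M : Type*} [AddCommGroup M] [Module k M] {S : Set (List V)}
    {φ : (List V →₀ k) →ₗ[k] M} {P : Submodule k M}
    (h : ∀ l ∈ S, φ (Finsupp.single l 1) ∈ P) {x : List V →₀ k}
    (hx : x ∈ Finsupp.supported k k S) : φ x ∈ P := by
  rw [Finsupp.supported_eq_span_single] at hx
  have : Submodule.span k ((fun l => Finsupp.single l (1 : k)) '' S) ≤ P.comap φ := by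
    rw [Submodule.span_le]
    rintro _ ⟨l, hl, rfl⟩
    exact h l hl
  exact this hx

/-- Two linear maps agreeing on the simplices of a chain agree on the chain. -/
lemma eq_of_supported {M : Type*} [AddCommGroup M] [Module k M] {S : Set (List V)}
    {φ ψ : (List V →₀ k) →ₗ[k] M}
    (h : ∀ l ∈ S, φ (Finsupp.single l 1) = ψ (Finsupp.single l 1)) {x : List V →₀ k}
    (hx : x ∈ Finsupp.supported k k S) : φ x = ψ x := by
  have := mem_of_supported (φ := φ - ψ) (P := ⊥) (fun l hl => by simp [h l hl]) hx
  simpa [sub_eq_zero] using this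

lemma single_mem_supported {S : Set (List V)} {l : List V} (h : l ∈ S) :
    Finsupp.single l (1 : k) ∈ Finsupp.supported k k S :=
  Finsupp.single_mem_supported k 1 h

lemma cons_mem_supported {S T : Set (List V)} {v : V} (h : ∀ l ∈ S, v :: l ∈ T)
    {x : List V →₀ k} (hx : x ∈ Finsupp.supported k k S) :
    cons v x ∈ Finsupp.supported k k T :=
  mem_of_supported (fun l hl => by simpa using single_mem_supported (h l hl)) hx

lemma map_mem_supported {S : Set (List V)} {T : Set (List W)} {f : V → W}
    (h : ∀ l ∈ S, l.map f ∈ T) {x : List V →₀ k} (hx : x ∈ Finsupp.supported k k S) :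
    map f x ∈ Finsupp.supported k k T :=
  mem_of_supported (fun l hl => by simpa using single_mem_supported (h l hl)) hx

lemma listBoundary_mem (l : List V) :
    listBoundary k l ∈ Finsupp.supported k k {m | m.Sublist l ∧ m.length + 1 = l.length} := by
  induction l with
  | nil => simp
  | cons v l ih =>
    rw [listBoundary_cons]
    refine Submodule.sub_mem _ (single_mem_supported ⟨List.sublist_cons_self v l, rfl⟩) ?_
    refine cons_mem_supported (S := {m | m.Sublist l ∧ m.length + 1 = l.length})
      (fun m hm => ?_) ih
    exact ⟨hm.1.cons_cons v, by simpa using hm.2⟩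

lemma boundary_mem_supported {S T : Set (List V)}
    (h : ∀ l ∈ S, ∀ m : List V, m.Sublist l → m.length + 1 = l.length → m ∈ T)
    {x : List V →₀ k} (hx : x ∈ Finsupp.supported k k S) :
    boundary x ∈ Finsupp.supported k k T :=
  mem_of_supported (fun l hl => by
    rw [boundary_single]
    exact Finsupp.supported_mono (fun m hm => h l hl m hm.1 hm.2) (listBoundary_mem l)) hx

end ListChain

namespace ListChain

variable {k : Type*} [Field k] {V : Type*}

/-- The ordered simplices of length `n` in the clique complex of `R` restricted to `W`. -/
def cliqueLists (R : V → V → Prop) (W : Set V) (n : ℕ) : Set (List V) :=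
  {l | l.length = n ∧ (∀ x ∈ l, x ∈ W) ∧ ∀ x ∈ l, ∀ y ∈ l, R x y}

/-- Every cycle of ordered simplices with fewer than `m` vertices is a boundary. -/
def Acyclic (k : Type*) [Field k] (R : V → V → Prop) (W : Set V) (m : ℕ) : Prop :=
  ∀ n < m, ∀ z ∈ Finsupp.supported k k (cliqueLists R W n), boundary z = 0 →
    ∃ w ∈ Finsupp.supported k k (cliqueLists R W (n + 1)), boundary w = z

variable {R : V → V → Prop}

lemma acyclic_of_cone (hR : ∀ x y, R x y → R y x) {W : Set V} {v : V} (hv : v ∈ W)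
    (hvR : ∀ w ∈ W, R v w) (m : ℕ) : Acyclic k R W m := by
  intro n _ z hz hdz
  refine ⟨cons v z, cons_mem_supported (fun l hl => ?_) hz, by simp [boundary_cons, hdz]⟩
  obtain ⟨h1, h2, h3⟩ := hl
  refine ⟨by simp [h1], by simpa [hv] using h2, ?_⟩
  intro x hx y hy
  rcases List.mem_cons.1 hx with rfl | hx' <;> rcases List.mem_cons.1 hy with rfl | hy'
  · exact hvR _ hv
  · exact hvR _ (h2 y hy')
  · exact hR _ _ (hvR _ (h2 x hx'))
  · exact h3 x hx' y hy'

/-- Mayer–Vietoris for attaching one vertex along its link. -/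
lemma Acyclic.insert (hR : ∀ x y, R x y → R y x) {W : Set V} {v : V} (hvW : v ∉ W)
    (hvv : R v v) {m : ℕ} (h : Acyclic k R W (m + 1))
    (hl : Acyclic k R {w ∈ W | R v w} m) : Acyclic k R (insert v W) (m + 1) := by
  classical
  intro n hn z hz hdz
  set b := z.filter (fun l => v ∉ l) with hb
  set s := z.filter (fun l => ¬ v ∉ l) with hs
  have hbs : b + s = z := Finsupp.filter_add_filter_not z _
  have hbm : b ∈ Finsupp.supported k k (cliqueLists R W n) := by
    intro l hlb
    rw [Finset.mem_coe, hb, Finsupp.support_filter, Finset.mem_filter] at hlb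
    obtain ⟨h1, h2, h3⟩ := hz hlb.1
    refine ⟨h1, fun x hx => ?_, h3⟩
    rcases h2 x hx with rfl | h
    · exact absurd hx hlb.2
    · exact h
  let St (n : ℕ) : Set (List V) := cliqueLists R {w ∈ Insert.insert v W | R v w} n
  have hsm : s ∈ Finsupp.supported k k (St n) := by
    intro l hls
    rw [Finset.mem_coe, hs, Finsupp.support_filter, Finset.mem_filter, not_not] at hls
    obtain ⟨h1, h2, h3⟩ := hz hls.1
    exact ⟨h1, fun x hx => ⟨h2 x hx, h3 v hls.2 x hx⟩, h3⟩
  have hstar : Acyclic k R {w ∈ Insert.insert v W | R v w} (n + 1) :=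
    acyclic_of_cone hR (v := v) (by simp [hvv]) (fun w hw => hw.2) _
  have mono : ∀ {A B : Set V} (hAB : A ⊆ B) (n : ℕ), Finsupp.supported k k (cliqueLists R A n) ≤
      Finsupp.supported k k (cliqueLists R B n) := fun hAB n =>
    Finsupp.supported_mono fun l hl => ⟨hl.1, fun x hx => hAB (hl.2.1 x hx), hl.2.2⟩
  have hW : W ⊆ Insert.insert v W := Set.subset_insert v W
  have hSt : {w ∈ Insert.insert v W | R v w} ⊆ Insert.insert v W := fun w hw => hw.1
  have hlinkW : {w ∈ W | R v w} ⊆ W := fun w hw => hw.1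
  have hlinkS : {w ∈ W | R v w} ⊆ {w ∈ Insert.insert v W | R v w} :=
    fun w hw => ⟨Or.inr hw.1, hw.2⟩
  -- it suffices to find a chain in the link separating the two parts
  suffices ∃ a ∈ Finsupp.supported k k (cliqueLists R {w ∈ W | R v w} n),
      boundary a = boundary b by
    obtain ⟨a, ha, hab⟩ := this
    obtain ⟨w₁, hw₁, hdw₁⟩ := h n hn (b - a) (Submodule.sub_mem _ hbm (mono hlinkW n ha))
      (by simp [hab])
    obtain ⟨w₂, hw₂, hdw₂⟩ := hstar n (Nat.lt_succ_self n) (s + a)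
      (Submodule.add_mem _ hsm (mono hlinkS n ha))
      (by rw [map_add, hab, add_comm, ← map_add, hbs, hdz])
    exact ⟨w₁ + w₂, Submodule.add_mem _ (mono hW _ hw₁) (mono hSt _ hw₂), by
      rw [map_add, hdw₁, hdw₂, ← hbs]; abel⟩
  rcases n with _ | n
  · refine ⟨0, Submodule.zero_mem _, ?_⟩
    have : boundary b = (0 : (List V →₀ k) →ₗ[k] (List V →₀ k)) b := by
      refine eq_of_supported (fun l hl => ?_) hbm
      rw [List.length_eq_zero_iff.1 hl.1]
      simp
    simp [this]
  · have face : ∀ (A : Set V) (x : List V →₀ k),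
        x ∈ Finsupp.supported k k (cliqueLists R A (n + 1)) →
        boundary x ∈ Finsupp.supported k k (cliqueLists R A n) := fun A x hx =>
      boundary_mem_supported (S := cliqueLists R A (n + 1)) (T := cliqueLists R A n)
        (fun l hl m hm hlen => ⟨by have := hl.1; omega,
          fun x hx => hl.2.1 x (hm.subset hx),
          fun x hx y hy => hl.2.2 x (hm.subset hx) y (hm.subset hy)⟩) hx
    have h1 := face _ _ hbm
    have h2 : boundary b ∈ Finsupp.supported k k (St n) := by
      have : boundary b = - boundary s := by
        rw [eq_neg_iff_add_eq_zero, ← map_add, hbs, hdz]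
      rw [this]
      exact Submodule.neg_mem _ (face _ _ hsm)
    refine hl n (by omega) (boundary b) ?_ (boundary_boundary b)
    intro l hlb
    obtain ⟨h3, h4, h5⟩ := h1 hlb
    exact ⟨h3, fun x hx => ⟨h4 x hx, ((h2 hlb).2.1 x hx).2⟩, h5⟩

/-- Attaching finitely many pairwise non-adjacent vertices along their links. -/
lemma Acyclic.union (hR : ∀ x y, R x y → R y x) {W : Set V} (C : Finset V)
    (hCW : ∀ v ∈ C, v ∉ W) (hrefl : ∀ v ∈ C, R v v)
    (hC : ∀ v ∈ C, ∀ w ∈ C, v ≠ w → ¬ R v w) {m : ℕ} (h : Acyclic k R W (m + 1))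
    (hl : ∀ v ∈ C, Acyclic k R {w ∈ W | R v w} m) : Acyclic k R (W ∪ C) (m + 1) := by
  classical
  induction C using Finset.induction_on with
  | empty => simpa using h
  | insert v C hv ih =>
    have ih' := ih (fun x hx => hCW x (by simp [hx])) (fun x hx => hrefl x (by simp [hx]))
      (fun x hx y hy => hC x (by simp [hx]) y (by simp [hy])) (fun x hx => hl x (by simp [hx]))
    rw [Finset.coe_insert, Set.union_insert]
    refine Acyclic.insert hR ?_ (hrefl v (by simp)) ih' ?_
    · simp [hv, hCW v (by simp)]
    · convert hl v (by simp) using 2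
      ext w
      simp only [Set.mem_union, Finset.mem_coe, and_congr_left_iff, or_iff_left_iff_imp]
      intro hvw hw
      exact absurd hvw (hC v (by simp) w (by simp [hw]) (by rintro rfl; exact hv hw))

end ListChain

namespace ListChain

variable {k : Type*} [Field k] {ι F : Type*}

/-- Compatibility of coloured vertices: a vertex has one colour, and no leaf in `L` shares the
colour of the center `c`. -/
def starRel (c : ι) (L : Finset ι) (x y : ι × F) : Prop :=
  (x.1 = y.1 → x.2 = y.2) ∧ (x.1 = c → y.1 ∈ L → x.2 ≠ y.2) ∧ (y.1 = c → x.1 ∈ L → x.2 ≠ y.2)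

lemma starRel_symm (c : ι) (L : Finset ι) (x y : ι × F) (h : starRel c L x y) :
    starRel c L y x :=
  ⟨fun e => (h.1 e.symm).symm, fun e e' => (h.2.2 e e').symm, fun e e' => (h.2.1 e e').symm⟩

lemma starRel_refl {c : ι} {L : Finset ι} (hc : c ∉ L) (x : ι × F) : starRel c L x x :=
  ⟨fun _ => rfl, fun e e' => absurd (e ▸ e') hc, fun e e' => absurd (e ▸ e') hc⟩

lemma not_starRel_of_fst_eq (c : ι) (L : Finset ι) (x y : ι × F) (h : x.1 = y.1) (hne : x ≠ y) :
    ¬ starRel c L x y :=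
  fun hxy => hne (Prod.ext h (hxy.1 h))

/-- The vertices with center colours in `S`, and all colours at the leaves in `J` and at the
vertices in `O`. -/
def starVertices (c : ι) (S : Set F) (J O : Finset ι) : Set (ι × F) :=
  {x | (x.1 = c ∧ x.2 ∈ S) ∨ x.1 ∈ J ∨ x.1 ∈ O}

lemma mem_starVertices {c : ι} {S : Set F} {J O : Finset ι} {x : ι × F} :
    x ∈ starVertices c S J O ↔ (x.1 = c ∧ x.2 ∈ S) ∨ x.1 ∈ J ∨ x.1 ∈ O := Iff.rfl

variable [Finite F]

/-- A join of nonempty discrete columns. -/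
lemma acyclic_join {R : ι × F → ι × F → Prop} (hR : ∀ x y, R x y → R y x) (hrefl : ∀ x, R x x)
    (hcol : ∀ x y, x.1 = y.1 → x ≠ y → ¬ R x y) (S : ι → Set F) (I : Finset ι)
    (hne : ∀ i ∈ I, (S i).Nonempty)
    (hcomp : ∀ x y : ι × F, x.1 ∈ I → y.1 ∈ I → x.2 ∈ S x.1 → y.2 ∈ S y.1 → x.1 ≠ y.1 → R x y) :
    Acyclic k R {x : ι × F | x.1 ∈ I ∧ x.2 ∈ S x.1} I.card := by
  classical
  induction I using Finset.induction_on with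
  | empty => intro n hn; simp at hn
  | insert i I hi ih =>
    have ih' := ih (fun j hj => hne j (by simp [hj]))
      (fun x y hx hy => hcomp x y (by simp [hx]) (by simp [hy]))
    obtain ⟨a, ha⟩ := hne i (by simp)
    rw [Finset.card_insert_of_notMem hi]
    set W : Set (ι × F) := {x : ι × F | x.1 ∈ I ∧ x.2 ∈ S x.1} with hW
    have hcone : Acyclic k R (insert (i, a) W) (I.card + 1) := by
      refine acyclic_of_cone hR (Set.mem_insert _ _) (fun w hw => ?_) _
      rcases hw with rfl | hw
      · exact hrefl _
      · exact hcomp _ _ (by simp) (by simp [hw.1]) ha hw.2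
          (fun e => hi ((show i = w.1 from e) ▸ hw.1))
    have hfin : ({x : ι × F | x.1 = i ∧ x.2 ∈ S i ∧ x.2 ≠ a}).Finite :=
      (Set.toFinite (Prod.mk i '' (Set.univ : Set F))).subset (by
        rintro ⟨j, b⟩ ⟨h, -⟩; exact ⟨b, trivial, by simp_all⟩)
    have key := Acyclic.union (k := k) hR (W := insert (i, a) W) hfin.toFinset
      (by
        rintro ⟨j, b⟩ hx
        simp only [Set.Finite.mem_toFinset] at hx
        obtain ⟨rfl, -, hb⟩ := hx
        rintro (h | h)
        · exact hb (by simpa using h)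
        · exact hi h.1)
      (fun x _ => hrefl x)
      (fun x hx y hy hxy => hcol x y (by
        rw [Set.Finite.mem_toFinset] at hx hy
        exact hx.1.trans hy.1.symm) hxy)
      (m := I.card) hcone ?_
    · convert key using 1
      ext ⟨j, b⟩
      simp only [Set.Finite.coe_toFinset, hW]
      constructor
      · rintro ⟨h1, h2⟩
        rcases Finset.mem_insert.1 h1 with h | h
        · obtain rfl : j = i := h
          by_cases hb : b = a
          · left; left; simp [hb]
          · right; exact ⟨rfl, h2, hb⟩
        · left; right; exact ⟨h, h2⟩
      · rintro ((h | h) | h)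
        · obtain ⟨rfl, rfl⟩ := Prod.mk.inj h
          exact ⟨by simp, ha⟩
        · exact ⟨by simp [h.1], h.2⟩
        · obtain ⟨h1, h2, -⟩ := h
          obtain rfl : j = i := h1
          exact ⟨by simp, h2⟩
    · rintro ⟨j, b⟩ hx
      rw [Set.Finite.mem_toFinset] at hx
      obtain ⟨h1, h2, h3⟩ := hx
      obtain rfl : j = i := h1
      convert ih' using 1
      ext w
      constructor
      · rintro ⟨rfl | h, hw⟩
        · exact absurd hw (hcol _ _ rfl (by simpa using h3))
        · exact h
      · intro h
        exact ⟨Or.inr h, hcomp _ _ (by simp) (by simp [h.1]) h2 h.2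
          (fun e => hi ((show j = w.1 from e) ▸ h.1))⟩

/-- The column of a leaf, except for the colours in `T`. -/
lemma finite_column (j : ι) (T : Set F) : ({x : ι × F | x.1 = j ∧ x.2 ∉ T}).Finite :=
  (Set.toFinite (Prod.mk j '' (Set.univ : Set F))).subset (by
    rintro ⟨i, b⟩ ⟨h, -⟩
    exact ⟨b, trivial, by simp_all⟩)

lemma acyclic_starVertices_empty {c : ι} {L : Finset ι} (hc : c ∉ L) (S : Set F)
    (hS : S.Nonempty) (O : Finset ι) (hcO : c ∉ O) (hO : Disjoint O L) :
    Acyclic k (starRel c L) (starVertices c S ∅ O) (1 + O.card) := by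
  classical
  have hO' : ∀ i ∈ O, i ∉ L := fun i hi hiL => Finset.disjoint_left.1 hO hi hiL
  have := acyclic_join (k := k) (R := starRel c L) (starRel_symm c L) (starRel_refl hc)
    (not_starRel_of_fst_eq c L) (fun i => if i = c then S else Set.univ) (insert c O)
    (by
      intro i hi
      by_cases h : i = c
      · simpa [h] using hS
      · obtain ⟨s, hs⟩ := hS
        exact ⟨s, by simp [h]⟩)
    (by
      intro x y hx hy _ _ hxy
      rw [Finset.mem_insert] at hx hy
      refine ⟨fun h => absurd h hxy, fun h h' => ?_, fun h h' => ?_⟩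
      · rcases hy with hy | hy
        · exact absurd (h.trans hy.symm) hxy
        · exact absurd h' (hO' _ hy)
      · rcases hx with hx | hx
        · exact absurd (hx.trans h.symm) hxy
        · exact absurd h' (hO' _ hx))
  rw [Finset.card_insert_of_notMem hcO, add_comm] at this
  convert this using 1
  ext x
  by_cases h : x.1 = c <;> simp [starVertices, h, hcO]

lemma acyclic_starVertices_of_notMem {c : ι} {L : Finset ι} (hc : c ∉ L) (O : Finset ι)
    (hcO : c ∉ O) (hO : Disjoint O L) (a : F) (J : Finset ι) (hJ : J ⊆ L) :
    ∀ S : Set F, a ∉ S → J.card + 1 ≤ S.ncard →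
    Acyclic k (starRel c L) (starVertices c S J O) (J.card + 1 + O.card) := by
  classical
  have hO' : ∀ i ∈ O, i ∉ L := fun i hi hiL => Finset.disjoint_left.1 hO hi hiL
  induction J using Finset.induction_on with
  | empty =>
    intro S ha hS
    have : S.Nonempty := Set.nonempty_of_ncard_ne_zero (by simp at hS; omega)
    simpa using acyclic_starVertices_empty hc S this O hcO hO
  | insert j J hj ih =>
    intro S ha hS
    rw [Finset.card_insert_of_notMem hj] at hS ⊢
    have hjL : j ∈ L := hJ (by simp)
    have hjc : j ≠ c := by rintro rfl; exact hc hjL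
    have hjO : j ∉ O := fun h => hO' j h hjL
    have hJL : ∀ i ∈ J, i ∈ L := fun i hi => hJ (by simp [hi])
    have hcone : Acyclic k (starRel c L) (insert (j, a) (starVertices c S J O))
        (J.card + 1 + O.card + 1) := by
      refine acyclic_of_cone (starRel_symm c L) (Set.mem_insert _ _) (fun w hw => ?_) _
      rcases hw with rfl | hw
      · exact starRel_refl hc _
      · simp only [starVertices] at hw
        refine ⟨fun h => ?_, fun h => absurd h hjc, fun h _ => ?_⟩
        · simp only at h
          rcases hw with ⟨hw, -⟩ | hw | hw
          · exact absurd (h.trans hw) hjc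
          · exact absurd (h ▸ hw) hj
          · exact absurd (h ▸ hw) hjO
        · rcases hw with ⟨-, hw⟩ | hw | hw
          · rintro rfl; exact ha hw
          · exact absurd (hJL _ hw) (h ▸ hc)
          · exact absurd hw (h ▸ hcO)
    have key := Acyclic.union (k := k) (starRel_symm c L) (finite_column j {a}).toFinset
      (by
        rintro ⟨i, b⟩ hx
        rw [Set.Finite.mem_toFinset] at hx
        obtain ⟨rfl, hb⟩ := hx
        rintro (h | h)
        · exact hb (by simpa using h)
        · simp [starVertices, hjc, hj, hjO] at h)
      (fun x _ => starRel_refl hc x)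
      (fun x hx y hy hxy => not_starRel_of_fst_eq c L x y (by
        rw [Set.Finite.mem_toFinset] at hx hy
        exact hx.1.trans hy.1.symm) hxy) hcone ?_
    · convert key using 1
      · ext ⟨i, b⟩
        simp only [Set.Finite.coe_toFinset, starVertices]
        by_cases hij : i = j <;> by_cases hb : b = a <;> simp [hij, hb, hjc]
      · ring
    · rintro ⟨i, b⟩ hx
      rw [Set.Finite.mem_toFinset] at hx
      obtain ⟨h1, h3⟩ := hx
      obtain rfl : i = j := h1
      have hcard : J.card + 1 ≤ (S \ {b}).ncard := by
        have := Set.pred_ncard_le_ncard_sdiff_singleton S b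
        omega
      convert ih (fun x hx => hJ (by simp [hx])) (S \ {b}) (fun h => ha h.1) hcard using 1
      ext w
      constructor
      · rintro ⟨rfl | h, hw⟩
        · exact absurd hw (not_starRel_of_fst_eq _ _ _ _ rfl (by simpa using h3))
        · rcases h with h | h
          · exact Or.inl ⟨h.1, h.2, fun e => hw.2.2 h.1 hjL e.symm⟩
          · exact Or.inr h
      · intro h
        refine ⟨Or.inr ?_, ?_⟩
        · rcases h with h | h
          · exact Or.inl ⟨h.1, h.2.1⟩
          · exact Or.inr h
        · refine ⟨fun e => ?_, fun e => absurd e hjc, fun e _ => ?_⟩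
          · simp only at e
            rcases h with ⟨hw, -⟩ | hw | hw
            · exact absurd (e.trans hw) hjc
            · exact absurd (e ▸ hw) hj
            · exact absurd (e ▸ hw) hjO
          · rcases h with ⟨-, hw⟩ | hw | hw
            · rintro rfl; exact hw.2 rfl
            · exact absurd (hJL _ hw) (e ▸ hc)
            · exact absurd hw (e ▸ hcO)

/-- The star complex is acyclic below its dimension when there are enough colours. -/
lemma acyclic_starVertices_univ {c : ι} {L : Finset ι} (hc : c ∉ L) (O : Finset ι)
    (hcO : c ∉ O) (hO : Disjoint O L) (hL : L.card + 2 ≤ Nat.card F) :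
    Acyclic k (starRel c L) (starVertices c (Set.univ : Set F) L O) (L.card + 1 + O.card) := by
  classical
  have hO' : ∀ i ∈ O, i ∉ L := fun i hi hiL => Finset.disjoint_left.1 hO hi hiL
  have hF : (Set.univ : Set F).ncard = Nat.card F := Set.ncard_univ F
  have hnt : Nontrivial F := Finite.one_lt_card_iff_nontrivial.1 (by omega)
  obtain ⟨a₁, a₂, ha⟩ := exists_pair_ne F
  rcases L.eq_empty_or_nonempty with rfl | ⟨j, hjL⟩
  · simpa using acyclic_starVertices_empty (k := k) hc (Set.univ : Set F) ⟨a₁, trivial⟩ O hcO hO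
  obtain ⟨J, hjJ, hLJ⟩ : ∃ J, j ∉ J ∧ L = insert j J :=
    ⟨L.erase j, by simp, (Finset.insert_erase hjL).symm⟩
  have hJL : J ⊆ L := by rw [hLJ]; exact Finset.subset_insert _ _
  have hcard : L.card = J.card + 1 := by rw [hLJ, Finset.card_insert_of_notMem hjJ]
  have hjc : j ≠ c := by rintro rfl; exact hc hjL
  have hjO : j ∉ O := fun h => hO' j h hjL
  have hcJ : c ∉ J := fun h => hc (hJL h)
  have hcone : Acyclic k (starRel c L) (insert (j, a₁) (starVertices c {a₁}ᶜ J O))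
      (J.card + 1 + O.card + 1) := by
    refine acyclic_of_cone (starRel_symm c L) (Set.mem_insert _ _) (fun w hw => ?_) _
    rcases hw with rfl | hw
    · exact starRel_refl hc _
    · grind [starRel, starVertices]
  have h₂ : Acyclic k (starRel c L) (insert (j, a₂) (insert (j, a₁) (starVertices c {a₁}ᶜ J O)))
      (J.card + 1 + O.card + 1) := by
    refine Acyclic.insert (starRel_symm c L) ?_ (starRel_refl hc _) hcone ?_
    · grind [mem_starVertices]
    · have hn : J.card + 1 ≤ ({a₁, a₂}ᶜ : Set F).ncard := by
        have := Set.ncard_add_ncard_compl ({a₁, a₂} : Set F)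
        rw [Set.ncard_pair ha] at this
        omega
      convert acyclic_starVertices_of_notMem hc O hcO hO a₁ J hJL _ (by simp) hn using 1
      ext ⟨i', b'⟩
      simp only [Set.mem_ofPred_eq, Set.mem_insert_iff, mem_starVertices, starRel,
        Prod.mk.injEq, Set.mem_compl_iff, Set.mem_singleton_iff]
      grind
  have h₃ : Acyclic k (starRel c L)
      (insert (c, a₁) (insert (j, a₂) (insert (j, a₁) (starVertices c {a₁}ᶜ J O))))
      (J.card + 1 + O.card + 1) := by
    refine Acyclic.insert (starRel_symm c L) ?_ (starRel_refl hc _) h₂ ?_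
    · grind [mem_starVertices]
    · have := acyclic_join (k := k) (R := starRel c L) (starRel_symm c L) (starRel_refl hc)
        (not_starRel_of_fst_eq c L)
        (fun i => if i = j then {a₂} else if i ∈ J then {a₁}ᶜ else Set.univ)
        (insert j (J ∪ O)) (by
          intro i hi
          split_ifs
          · exact ⟨a₂, rfl⟩
          · exact ⟨a₂, ha.symm⟩
          · exact ⟨a₂, trivial⟩) (by
          grind [starRel])
      rw [Finset.card_insert_of_notMem (by simp [hjJ, hjO]), Finset.card_union_of_disjoint
        (Finset.disjoint_left.2 fun i hi hiO => hO' i hiO (hJL hi))] at this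
      convert this using 1
      · ext ⟨i', b'⟩
        simp only [Set.mem_ofPred_eq, Set.mem_insert_iff, mem_starVertices, starRel,
          Prod.mk.injEq, Set.mem_compl_iff, Set.mem_singleton_iff, Finset.mem_insert,
          Finset.mem_union]
        grind
      · ring
  have key := Acyclic.union (k := k) (starRel_symm c L) (finite_column j {a₁, a₂}).toFinset
    (by
      rintro ⟨i, b⟩ hx
      rw [Set.Finite.mem_toFinset] at hx
      grind [mem_starVertices])
    (fun x _ => starRel_refl hc x)
    (fun x hx y hy hxy => not_starRel_of_fst_eq c L x y (by
      rw [Set.Finite.mem_toFinset] at hx hy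
      exact hx.1.trans hy.1.symm) hxy) h₃ ?_
  · convert key using 1
    · ext ⟨i, b⟩
      rw [Set.Finite.coe_toFinset]
      grind [mem_starVertices]
    · rw [hcard]; ring
  · rintro ⟨i, b⟩ hx
    rw [Set.Finite.mem_toFinset] at hx
    obtain ⟨h1, h3⟩ := hx
    obtain rfl : i = j := h1
    have hn : J.card + 1 ≤ ({b}ᶜ : Set F).ncard := by
      have := Set.ncard_add_ncard_compl ({b} : Set F)
      rw [Set.ncard_singleton] at this
      omega
    convert acyclic_starVertices_of_notMem hc O hcO hO b J hJL _ (by simp) hn using 1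
    ext ⟨i', b'⟩
    simp only [Set.mem_ofPred_eq, Set.mem_insert_iff, mem_starVertices, starRel,
      Prod.mk.injEq, Set.mem_compl_iff, Set.mem_singleton_iff]
    grind

lemma acyclic_starRel [Fintype ι] {c : ι} {L : Finset ι} (hc : c ∉ L)
    (hL : L.card + 2 ≤ Nat.card F) :
    Acyclic k (starRel c L) (Set.univ : Set (ι × F)) (Fintype.card ι) := by
  classical
  have h := acyclic_starVertices_univ (k := k) (F := F) hc (insert c L)ᶜ (by simp)
    (Finset.disjoint_left.2 fun i hi hiL => by simp [hiL] at hi) hL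
  have hcard := Finset.card_add_card_compl (insert c L)
  rw [Finset.card_insert_of_notMem hc] at hcard
  rw [hcard] at h
  convert h using 1
  ext x
  simp only [mem_starVertices, Finset.mem_compl, Finset.mem_insert, Set.mem_univ]
  tauto

end ListChain

namespace ListChain

variable {k : Type*} [Field k] {E : Type*} [NormedAddCommGroup E] [NormedSpace ℝ E]

/-- The barycenter of a list of points. -/
noncomputable def barycenter (l : List E) : E := (l.length : ℝ)⁻¹ • l.sum

/-- Barycentric subdivision of ordered chains with `n` vertices. -/
noncomputable def subdivision (k : Type*) [Field k] {E : Type*} [NormedAddCommGroup E]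
    [NormedSpace ℝ E] : ℕ → (List E →₀ k) →ₗ[k] (List E →₀ k)
  | 0 => LinearMap.id
  | n + 1 => Finsupp.linearCombination k fun l =>
      cons (barycenter l) (subdivision k n (listBoundary k l))

@[simp] lemma subdivision_zero (x : List E →₀ k) : subdivision k 0 x = x := rfl

lemma subdivision_succ_single (n : ℕ) (l : List E) :
    subdivision k (n + 1) (Finsupp.single l 1) =
      cons (barycenter l) (subdivision k n (listBoundary k l)) := by
  simp [subdivision]

lemma boundary_subdivision (n : ℕ) (x : List E →₀ k) :
    boundary (subdivision k (n + 1) x) = subdivision k n (boundary x) := by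
  induction n generalizing x with
  | zero =>
    have : boundary.comp (subdivision k 1) = (subdivision k 0).comp (boundary (V := E)) :=
      linearMap_ext fun l => by
        simp [subdivision_succ_single, boundary_cons, boundary_listBoundary]
    exact LinearMap.congr_fun this x
  | succ n ih =>
    have : boundary.comp (subdivision k (n + 2)) =
        (subdivision k (n + 1)).comp (boundary (V := E)) :=
      linearMap_ext fun l => by
        simp [subdivision_succ_single _ l, boundary_cons, boundary_listBoundary, ih]
    exact LinearMap.congr_fun this x

lemma boundary_subdivision_pow (n j : ℕ) (x : List E →₀ k) :
    boundary ((subdivision k (n + 1) ^ j) x) = (subdivision k n ^ j) (boundary x) := by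
  induction j generalizing x with
  | zero => simp
  | succ j ih => simp [pow_succ, ih, boundary_subdivision]

lemma map_subdivision (g : E →ₗ[ℝ] E) (n : ℕ) (x : List E →₀ k) :
    map g (subdivision k n x) = subdivision k n (map g x) := by
  induction n generalizing x with
  | zero => simp
  | succ n ih =>
    have hb : ∀ l : List E, g (barycenter l) = barycenter (l.map g) := fun l => by
      simp [barycenter, map_list_sum]
    have : (map g).comp (subdivision k (n + 1)) =
        (subdivision k (n + 1)).comp (map (k := k) g) :=
      linearMap_ext fun l => by
        simp [subdivision_succ_single, map_cons, ih, map_listBoundary, hb]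
    exact LinearMap.congr_fun this x

lemma map_subdivision_pow (g : E →ₗ[ℝ] E) (n j : ℕ) (x : List E →₀ k) :
    map g ((subdivision k n ^ j) x) = (subdivision k n ^ j) (map g x) := by
  induction j generalizing x with
  | zero => simp
  | succ j ih => simp [pow_succ, ih, map_subdivision]

/-- Lists of `n` points of `A` at mutual distance at most `δ`. -/
def smallLists (A : Set E) (n : ℕ) (δ : ℝ) : Set (List E) :=
  {l | l.length = n ∧ (∀ x ∈ l, x ∈ A) ∧ ∀ x ∈ l, ∀ y ∈ l, dist x y ≤ δ}

lemma norm_sum_sub_le {δ : ℝ} (y : E) (l : List E) (h : ∀ x ∈ l, dist x y ≤ δ) :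
    ‖l.sum - (l.length : ℝ) • y‖ ≤ l.length * δ := by
  induction l with
  | nil => simp
  | cons x l ih =>
    have h1 := ih fun z hz => h z (by simp [hz])
    have h2 := h x (by simp)
    rw [dist_eq_norm] at h2
    have : (x :: l).sum - ((x :: l).length : ℝ) • y =
        (x - y) + (l.sum - (l.length : ℝ) • y) := by
      simp only [List.sum_cons, List.length_cons]; push_cast; module
    rw [this]
    refine (norm_add_le _ _).trans ?_
    push_cast [List.length_cons]
    linarith

lemma norm_sum_sub_le_of_mem {δ : ℝ} {y : E} {l : List E} (hy : y ∈ l)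
    (h : ∀ x ∈ l, dist x y ≤ δ) :
    ‖l.sum - (l.length : ℝ) • y‖ ≤ (l.length - 1) * δ := by
  induction l with
  | nil => simp at hy
  | cons x l ih =>
    have hsum : (x :: l).sum - ((x :: l).length : ℝ) • y =
        (x - y) + (l.sum - (l.length : ℝ) • y) := by
      simp only [List.sum_cons, List.length_cons]; push_cast; module
    rw [hsum]
    refine (norm_add_le _ _).trans ?_
    push_cast [List.length_cons]
    rcases List.mem_cons.1 hy with rfl | hy'
    · have := norm_sum_sub_le y l fun z hz => h z (by simp [hz])
      simpa using this
    · have h1 := ih hy' fun z hz => h z (by simp [hz])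
      have h2 := h x (by simp)
      rw [dist_eq_norm] at h2
      linarith

lemma barycenter_mem {l : List E} (hl : l ≠ []) {A : Set E} (hA : Convex ℝ A)
    (h : ∀ x ∈ l, x ∈ A) : barycenter l ∈ A := by
  have hpos : 0 < (l.length : ℝ) := by exact_mod_cast List.length_pos_iff.2 hl
  have : barycenter l = ∑ i : Fin l.length, (l.length : ℝ)⁻¹ • l.get i := by
    rw [← Finset.smul_sum, barycenter, ← List.sum_ofFn, List.ofFn_get]
  rw [this]
  exact hA.sum_mem (fun _ _ => by positivity) (by simp [hpos.ne']) fun i _ => h _ (List.get_mem _ _)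

lemma dist_barycenter_le {δ κ : ℝ} {M : ℕ} (hκ : κ = M / (M + 1)) {l : List E}
    (hl : l.length ≤ M + 1) (h : ∀ x ∈ l, ∀ y ∈ l, dist x y ≤ δ) {y : E}
    (hy : y ∈ convexHull ℝ {x | x ∈ l}) : dist (barycenter l) y ≤ κ * δ := by
  have key : {x | x ∈ l} ⊆ Metric.closedBall (barycenter l) (κ * δ) := by
    intro z hz
    have hz' : z ∈ l := hz
    have hδ : 0 ≤ δ := dist_nonneg.trans (h z hz' z hz')
    have hlen : 0 < (l.length : ℝ) := by exact_mod_cast List.length_pos_of_mem hz'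
    have hb : barycenter l - z = (l.length : ℝ)⁻¹ • (l.sum - (l.length : ℝ) • z) := by
      rw [smul_sub, smul_smul, inv_mul_cancel₀ hlen.ne', one_smul, barycenter]
    rw [Metric.mem_closedBall, dist_comm, dist_eq_norm, hb, norm_smul, norm_inv,
      Real.norm_of_nonneg hlen.le]
    have h1 := norm_sum_sub_le_of_mem hz' fun x hx => h x hx z hz'
    have h2 : (l.length : ℝ)⁻¹ * ‖l.sum - (l.length : ℝ) • z‖ ≤
        (l.length : ℝ)⁻¹ * ((l.length - 1) * δ) := by gcongr
    refine h2.trans ?_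
    rw [← mul_assoc]
    refine mul_le_mul_of_nonneg_right ?_ hδ
    have hl' : (l.length : ℝ) ≤ M + 1 := by exact_mod_cast hl
    rw [hκ, inv_mul_eq_div, div_le_div_iff₀ hlen (by positivity)]
    nlinarith
  have := convexHull_min key (convex_closedBall _ _) hy
  rwa [Metric.mem_closedBall, dist_comm] at this

lemma subdivision_single_mem {δ κ : ℝ} {M : ℕ} (hκ : κ = M / (M + 1)) (n : ℕ) (hn : n ≤ M + 1)
    (l : List E) (hl : l.length = n) (h : ∀ x ∈ l, ∀ y ∈ l, dist x y ≤ δ) :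
    subdivision k n (Finsupp.single l 1) ∈
      Finsupp.supported k k (smallLists (convexHull ℝ {x | x ∈ l}) n (κ * δ)) := by
  induction n generalizing l with
  | zero =>
    rw [List.length_eq_zero_iff] at hl
    subst hl
    exact single_mem_supported (S := smallLists _ _ _) ⟨rfl, by simp, by simp⟩
  | succ n ih =>
    rw [subdivision_succ_single]
    have hne : l ≠ [] := by rintro rfl; simp at hl
    have hbm : barycenter l ∈ convexHull ℝ {x | x ∈ l} :=
      barycenter_mem hne (convex_convexHull _ _) fun x hx => subset_convexHull ℝ _ hx
    refine cons_mem_supported (S := smallLists (convexHull ℝ {x | x ∈ l}) n (κ * δ)) ?_ ?_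
    · rintro m ⟨h1, h2, h3⟩
      have hκδ : 0 ≤ κ * δ := dist_nonneg.trans (dist_barycenter_le hκ (by omega) h hbm)
      have hb : ∀ y ∈ m, dist (barycenter l) y ≤ κ * δ := fun y hy =>
        dist_barycenter_le hκ (by omega) h (h2 y hy)
      refine ⟨by simp [h1], ?_, ?_⟩
      · intro x hx
        rcases List.mem_cons.1 hx with rfl | hx
        exacts [hbm, h2 x hx]
      · intro x hx y hy
        rcases List.mem_cons.1 hx with rfl | hx <;> rcases List.mem_cons.1 hy with rfl | hy
        · simpa using hκδ
        · exact hb y hy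
        · rw [dist_comm]; exact hb x hx
        · exact h3 x hx y hy
    · refine mem_of_supported (fun m hm => ?_) (listBoundary_mem l)
      have := ih (by omega) m (by have := hm.2; omega)
        fun x hx y hy => h x (hm.1.subset hx) y (hm.1.subset hy)
      refine Finsupp.supported_mono ?_ this
      rintro m' ⟨h1, h2, h3⟩
      exact ⟨h1, fun x hx => convexHull_mono (fun z hz => hm.1.subset hz) (h2 x hx), h3⟩

lemma subdivision_pow_mem {A : Set E} (hA : Convex ℝ A) {δ κ : ℝ} {M : ℕ}
    (hκ : κ = M / (M + 1)) {n : ℕ} (hn : n ≤ M + 1) (j : ℕ) {x : List E →₀ k}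
    (hx : x ∈ Finsupp.supported k k (smallLists A n δ)) :
    (subdivision k n ^ j) x ∈ Finsupp.supported k k (smallLists A n (κ ^ j * δ)) := by
  induction j with
  | zero => simpa using hx
  | succ j ih =>
    rw [pow_succ' (subdivision k n), Module.End.mul_apply]
    refine mem_of_supported (fun l hl => ?_) ih
    refine Finsupp.supported_mono ?_ (subdivision_single_mem hκ n hn l hl.1 hl.2.2)
    rintro m ⟨h1, h2, h3⟩
    refine ⟨h1, fun x hx => convexHull_min (fun z hz => hl.2.1 z hz) hA (h2 x hx), ?_⟩
    rwa [pow_succ', mul_assoc]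

end ListChain

namespace ListChain

variable {k : Type*} [Field k] {Q : Type*} {rank : Q → ℕ}

/-- Signed insertion of a vertex into a list with strictly increasing ranks. -/
noncomputable def listInsert (k : Type*) [Field k] {Q : Type*} (rank : Q → ℕ) (v : Q) :
    List Q → (List Q →₀ k)
  | [] => Finsupp.single [v] 1
  | w :: l =>
    if rank v < rank w then Finsupp.single (v :: w :: l) 1
    else if rank v = rank w then 0
    else - cons w (listInsert k rank v l)

/-- The linear extension of signed insertion. -/
noncomputable def chainInsert (rank : Q → ℕ) (v : Q) : (List Q →₀ k) →ₗ[k] (List Q →₀ k) :=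
  Finsupp.linearCombination k (listInsert k rank v)

/-- The signed sorting of a list by rank; it vanishes on repeated ranks. -/
noncomputable def listSort (k : Type*) [Field k] {Q : Type*} (rank : Q → ℕ) :
    List Q → (List Q →₀ k)
  | [] => Finsupp.single [] 1
  | v :: l => chainInsert rank v (listSort k rank l)

/-- The linear extension of signed sorting. -/
noncomputable def chainSort (rank : Q → ℕ) : (List Q →₀ k) →ₗ[k] (List Q →₀ k) :=
  Finsupp.linearCombination k (listSort k rank)

@[simp] lemma chainInsert_single (v : Q) (l : List Q) :
    chainInsert rank v (Finsupp.single l (1 : k)) = listInsert k rank v l := by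
  simp [chainInsert]

@[simp] lemma chainSort_single (l : List Q) :
    chainSort rank (Finsupp.single l (1 : k)) = listSort k rank l := by
  simp [chainSort]

lemma chainSort_cons (v : Q) (x : List Q →₀ k) :
    chainSort rank (cons v x) = chainInsert rank v (chainSort rank x) := by
  have : (chainSort rank).comp (cons v) = (chainInsert rank v).comp (chainSort (k := k) rank) :=
    linearMap_ext fun l => by simp [listSort]
  exact LinearMap.congr_fun this x

lemma listInsert_of_lt {v : Q} {l : List Q} (h : ∀ w ∈ l, rank v < rank w) :
    listInsert k rank v l = Finsupp.single (v :: l) 1 := by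
  cases l with
  | nil => rfl
  | cons w l => rw [listInsert, if_pos (h w (by simp))]

lemma chainInsert_cons_of_lt {v w : Q} (h : rank w < rank v) (x : List Q →₀ k) :
    chainInsert rank v (cons w x) = - cons w (chainInsert rank v x) := by
  have : (chainInsert rank v).comp (cons w) = - (cons w).comp (chainInsert (k := k) rank v) :=
    linearMap_ext fun l => by simp [listInsert, h.not_gt, h.ne']
  exact LinearMap.congr_fun this x

lemma chainInsert_cons_self (v : Q) (x : List Q →₀ k) :
    chainInsert rank v (cons v x) = 0 := by
  have : (chainInsert rank v).comp (cons v) = (0 : (List Q →₀ k) →ₗ[k] (List Q →₀ k)) :=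
    linearMap_ext fun l => by simp [listInsert]
  exact LinearMap.congr_fun this x

lemma listInsert_mem (v : Q) (l : List Q) (hl : l.Pairwise fun x y => rank x < rank y) :
    listInsert k rank v l ∈ Finsupp.supported k k
      {m | (m.Pairwise fun x y => rank x < rank y) ∧ m.length = l.length + 1 ∧
        ∀ x ∈ m, x = v ∨ x ∈ l} := by
  induction l with
  | nil => exact single_mem_supported (by simp)
  | cons w l ih =>
    rw [List.pairwise_cons] at hl
    rw [listInsert]
    split_ifs with h1 h2
    · refine single_mem_supported ⟨?_, by simp, by simp⟩
      simp only [List.pairwise_cons, List.mem_cons]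
      refine ⟨?_, hl⟩
      rintro x (rfl | hx)
      exacts [h1, h1.trans (hl.1 x hx)]
    · exact Submodule.zero_mem _
    · refine Submodule.neg_mem _ (cons_mem_supported ?_ (ih hl.2))
      rintro m ⟨hm1, hm2, hm3⟩
      refine ⟨List.pairwise_cons.2 ⟨fun x hx => ?_, hm1⟩, by simp [hm2], ?_⟩
      · rcases hm3 x hx with rfl | hx
        exacts [by omega, hl.1 x hx]
      · intro x hx
        rcases List.mem_cons.1 hx with rfl | hx
        · simp
        · rcases hm3 x hx with h | h <;> simp [h]

lemma boundary_listInsert (v : Q) (l : List Q) (hl : l.Pairwise fun x y => rank x < rank y)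
    (hv : ∀ x ∈ l, rank v = rank x → v = x) :
    boundary (listInsert k rank v l) =
      Finsupp.single l 1 - chainInsert rank v (listBoundary k l) := by
  induction l with
  | nil => simp [listInsert, listBoundary]
  | cons w l ih =>
    rw [List.pairwise_cons] at hl
    have ih' := ih hl.2 fun x hx => hv x (by simp [hx])
    rcases lt_trichotomy (rank v) (rank w) with h | h | h
    · rw [listInsert, if_pos h, boundary_single, listBoundary_cons v]
      congr 1
      refine eq_of_supported (fun m hm => ?_) (listBoundary_mem (w :: l))
      rw [chainInsert_single, cons_single, listInsert_of_lt]
      intro x hx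
      rcases List.mem_cons.1 (hm.1.subset hx) with rfl | hx
      exacts [h, h.trans (hl.1 x hx)]
    · obtain rfl := hv w (by simp) h
      rw [listInsert, if_neg (lt_irrefl _), if_pos rfl, listBoundary_cons, map_sub,
        chainInsert_cons_self, chainInsert_single, listInsert_of_lt hl.1]
      simp
    · rw [listInsert, if_neg h.not_gt, if_neg h.ne', listBoundary_cons, map_sub, map_neg,
        boundary_cons, ih', chainInsert_cons_of_lt h, chainInsert_single, map_sub, cons_single]
      abel

lemma listSort_mem (l : List Q) :
    listSort k rank l ∈ Finsupp.supported k k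
      {m | (m.Pairwise fun x y => rank x < rank y) ∧ m.length = l.length ∧ ∀ x ∈ m, x ∈ l} := by
  induction l with
  | nil => exact single_mem_supported (by simp)
  | cons v l ih =>
    refine mem_of_supported (fun m hm => ?_) ih
    rw [chainInsert_single]
    refine Finsupp.supported_mono ?_ (listInsert_mem v m hm.1)
    rintro m' ⟨h1, h2, h3⟩
    refine ⟨h1, by simp [h2, hm.2.1], fun x hx => ?_⟩
    rcases h3 x hx with rfl | h
    · simp
    · simp [hm.2.2 x h]

lemma boundary_listSort (l : List Q) (hl : ∀ x ∈ l, ∀ y ∈ l, rank x = rank y → x = y) :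
    boundary (listSort k rank l) = chainSort rank (listBoundary k l) := by
  induction l with
  | nil => simp [listSort, boundary_single]
  | cons v l ih =>
    have ih' := ih fun x hx y hy => hl x (by simp [hx]) y (by simp [hy])
    have h : (boundary.comp (chainInsert rank v)) (listSort k rank l) =
        (LinearMap.id - (chainInsert (k := k) rank v).comp boundary :
          (List Q →₀ k) →ₗ[k] (List Q →₀ k)) (listSort k rank l) := by
      refine eq_of_supported (fun m hm => ?_) (listSort_mem l)
      simpa using boundary_listInsert v m hm.1
        fun x hx => hl v (by simp) x (by simp [hm.2.2 x hx])
    simp only [LinearMap.comp_apply, LinearMap.sub_apply, LinearMap.id_apply] at h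
    rw [listSort, h, ih', listBoundary_cons, map_sub, chainSort_single, chainSort_cons]

lemma boundary_chainSort {x : List Q →₀ k} (hx : x ∈ Finsupp.supported k k
    {l : List Q | ∀ x ∈ l, ∀ y ∈ l, rank x = rank y → x = y}) :
    boundary (chainSort rank x) = chainSort rank (boundary x) := by
  have : (boundary.comp (chainSort rank)) x = ((chainSort rank).comp boundary) x :=
    eq_of_supported (fun l hl => by simpa using boundary_listSort l hl) hx
  exact this

lemma map_listInsert (g : Q → Q) (hg : ∀ x, rank (g x) = rank x) (v : Q) (l : List Q) :
    map g (listInsert k rank v l) = listInsert k rank (g v) (l.map g) := by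
  induction l with
  | nil => simp [listInsert]
  | cons w l ih =>
    rw [List.map_cons, listInsert, listInsert, hg, hg]
    split_ifs <;> simp [map_cons, ih]

lemma map_chainSort (g : Q → Q) (hg : ∀ x, rank (g x) = rank x) (x : List Q →₀ k) :
    map g (chainSort rank x) = chainSort rank (map g x) := by
  have hins : ∀ v (x : List Q →₀ k),
      map g (chainInsert rank v x) = chainInsert rank (g v) (map g x) := fun v x => by
    have : (map g).comp (chainInsert rank v) =
        (chainInsert rank (g v)).comp (map (k := k) g) :=
      linearMap_ext fun l => by simp [map_listInsert g hg]
    exact LinearMap.congr_fun this x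
  have hlist : ∀ l, map g (listSort k rank l) = listSort k rank (l.map g) := fun l => by
    induction l with
    | nil => simp [listSort]
    | cons v l ih => simp [listSort, hins, ih]
  have : (map g).comp (chainSort rank) = (chainSort rank).comp (map (k := k) g) :=
    linearMap_ext fun l => by simp [hlist]
  exact LinearMap.congr_fun this x

end ListChain

/-! ### Exactness of the modular complex attached to an elementary abelian group -/

namespace ModularExact

section Abstract

variable {k M : Type*} [Field k] [AddCommGroup M] [Module k M] {p : ℕ} [CharP k p]
  {T s : Module.End k M} {P : Submodule k M}

lemma commutator_pow (hTP : ∀ x ∈ P, T x ∈ P) (hs : ∀ x ∈ P, s (T x) - T (s x) = x) (m : ℕ) :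
    ∀ x ∈ P, s ((T ^ (m + 1)) x) = (T ^ (m + 1)) (s x) + (m + 1 : k) • (T ^ m) x := by
  induction m with
  | zero => intro x hx; simpa [add_comm] using sub_eq_iff_eq_add.1 (hs x hx)
  | succ m ih =>
    intro x hx
    rw [pow_succ T (m + 1), Module.End.mul_apply, ih _ (hTP x hx),
      sub_eq_iff_eq_add.1 (hs x hx), map_add, Module.End.mul_apply, ← Module.End.mul_apply _ T x,
      ← pow_succ]
    push_cast
    module

lemma exists_eq_of_pow_eq_zero (hTP : ∀ x ∈ P, T x ∈ P) (hsP : ∀ x ∈ P, s x ∈ P)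
    (hs : ∀ x ∈ P, s (T x) - T (s x) = x) (m : ℕ) (hm : m < p) :
    ∀ x ∈ P, (T ^ m) x = 0 → ∃ y ∈ P, x = T y := by
  induction m with
  | zero => intro x _ h0; exact ⟨0, P.zero_mem, by simpa using h0⟩
  | succ m ih =>
    intro x hx h0
    have hm0 : (m + 1 : k) ≠ 0 := by
      have : ((m + 1 : ℕ) : k) ≠ 0 := by
        rw [Ne, CharP.cast_eq_zero_iff k p]
        exact fun h => absurd (Nat.le_of_dvd (Nat.succ_pos m) h) (by omega)
      exact_mod_cast this
    have h := commutator_pow hTP hs m x hx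
    rw [h0, map_zero, pow_succ, Module.End.mul_apply, ← map_smul, ← map_add] at h
    obtain ⟨y, hy, hxy⟩ := ih (by omega) _
      (P.add_mem (hTP _ (hsP x hx)) (P.smul_mem (m + 1 : k) hx)) h.symm
    refine ⟨(m + 1 : k)⁻¹ • (y - s x), P.smul_mem _ (P.sub_mem hy (hsP x hx)), ?_⟩
    rw [map_smul, map_sub, ← hxy, add_sub_cancel_left, smul_smul, inv_mul_cancel₀ hm0, one_smul]

lemma exists_eq_pow_of_eq_zero (hTP : ∀ x ∈ P, T x ∈ P) (hsP : ∀ x ∈ P, s x ∈ P)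
    (hs : ∀ x ∈ P, s (T x) - T (s x) = x) (j : ℕ) (hj : j < p) :
    ∀ x ∈ P, T x = 0 → ∃ y ∈ P, x = (T ^ j) y := by
  induction j with
  | zero => intro x hx _; exact ⟨x, hx, by simp⟩
  | succ j ih =>
    intro x hx h0
    obtain ⟨y, hy, rfl⟩ := ih (by omega) x hx h0
    rw [← Module.End.mul_apply, ← pow_succ'] at h0
    obtain ⟨z, hz, rfl⟩ := exists_eq_of_pow_eq_zero hTP hsP hs (j + 1) hj y hy h0
    exact ⟨z, hz, by rw [pow_succ, Module.End.mul_apply]⟩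

end Abstract

variable {F : Type*} [Field F] {p : ℕ} [Fact p.Prime] [Algebra (ZMod p) F]
  {ι : Type*} [Fintype ι] (b : Module.Basis ι (ZMod p) F)

/-- The linear representation of a group algebra on chains of a set with an action. -/
noncomputable def groupAlgebraAction (F X : Type*) [Field F] [AddAction F X] :
    AddMonoidAlgebra F F →ₐ[F] Module.End F (X →₀ F) :=
  AddMonoidAlgebra.lift F _ F
    { toFun := fun g => Finsupp.lmapDomain F F (g.toAdd +ᵥ ·)
      map_one' := by ext; simp
      map_mul' := fun g h => by ext; simp [add_vadd] }

lemma groupAlgebraAction_single {X : Type*} [AddAction F X] (g : F) (x : X) (a : F) :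
    groupAlgebraAction F X (AddMonoidAlgebra.single g 1) (Finsupp.single x a) =
      Finsupp.single (g +ᵥ x) a := by
  simp [groupAlgebraAction]

/-- An element of the group algebra of `F` whose powers resolve the trivial module. -/
noncomputable def augmentationElement : AddMonoidAlgebra F F :=
  ∑ i, b i • (AddMonoidAlgebra.single (b i) 1 - 1)

lemma single_pow_char (g : F) : (AddMonoidAlgebra.single g (1 : F)) ^ p = 1 := by
  have : CharP F p := charP_of_injective_algebraMap' (ZMod p) p
  rw [AddMonoidAlgebra.single_pow, one_pow, nsmul_eq_mul, CharP.cast_eq_zero, zero_mul]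
  rfl

lemma charP_groupAlgebra : CharP (AddMonoidAlgebra F F) p := by
  have : CharP F p := charP_of_injective_algebraMap' (ZMod p) p
  exact charP_of_injective_algebraMap' F p

lemma augmentationElement_pow : augmentationElement b ^ p = 0 := by
  have : CharP (AddMonoidAlgebra F F) p := charP_groupAlgebra
  rw [augmentationElement, sum_pow_char]
  refine Finset.sum_eq_zero fun i _ => ?_
  rw [smul_pow, sub_pow_char, single_pow_char, one_pow, sub_self, smul_zero]

/-- The commutator of `augmentationElement` with multiplication by a linear form. -/
noncomputable def twistElement (ψ : F →ₗ[ZMod p] ZMod p) : AddMonoidAlgebra F F :=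
  ∑ i, (b i * algebraMap (ZMod p) F (ψ (b i))) • AddMonoidAlgebra.single (b i) 1

lemma exists_mul_twistElement {ψ : F →ₗ[ZMod p] ZMod p} (hψ : ψ ≠ 0) :
    ∃ a, a * twistElement b ψ = 1 := by
  have : CharP (AddMonoidAlgebra F F) p := charP_groupAlgebra
  have : CharP F p := charP_of_injective_algebraMap' (ZMod p) p
  set c : F := ∑ i, b i * algebraMap (ZMod p) F (ψ (b i)) with hc
  have hc0 : c ≠ 0 := by
    intro h
    apply hψ
    refine b.ext fun i => ?_
    have hli := Fintype.linearIndependent_iff.1 b.linearIndependent (fun i => ψ (b i)) (by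
      rw [← h, hc]
      exact Finset.sum_congr rfl fun i _ => by rw [Algebra.smul_def, mul_comm]) i
    simpa using hli
  have hpow : twistElement b ψ ^ p = c ^ p • 1 := by
    rw [twistElement, sum_pow_char, hc, sum_pow_char, Finset.sum_smul]
    refine Finset.sum_congr rfl fun i _ => ?_
    rw [smul_pow, single_pow_char]
  refine ⟨(c ^ p)⁻¹ • twistElement b ψ ^ (p - 1), ?_⟩
  rw [smul_mul_assoc, ← pow_succ, Nat.sub_add_cancel (Fact.out : p.Prime).one_le, hpow, smul_smul,
    inv_mul_cancel₀ (pow_ne_zero _ hc0), one_smul]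

variable {X : Type*} [AddAction F X]

/-- On orbits with proper stabilizers there is an orbitwise linear form compatible with the
action. -/
lemma exists_orbit_form {S : Set X} (hS : ∀ x ∈ S, ∃ g : F, g +ᵥ x ≠ x) :
    ∃ (ψ : X → F →ₗ[ZMod p] ZMod p) (ν : X → ZMod p),
      (∀ x ∈ S, ψ x ≠ 0) ∧ (∀ (g : F) (x : X), ψ (g +ᵥ x) = ψ x) ∧
      ∀ x ∈ S, ∀ g : F, ν (g +ᵥ x) = ν x + ψ x g := by
  classical
  let out : X → X := fun x => (Quotient.mk (AddAction.orbitRel F X) x).out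
  have hout : ∀ (g : F) (x : X), out (g +ᵥ x) = out x := fun g x => by
    simp only [out]
    congr 1
    exact Quotient.sound (AddAction.orbitRel_apply.2 ⟨g, rfl⟩)
  have hrel : ∀ x, ∃ g : F, g +ᵥ out x = x := fun x => by
    have : AddAction.orbitRel F X (out x) x := Quotient.exact (Quotient.out_eq _)
    obtain ⟨g, hg⟩ := AddAction.orbitRel_apply.1 (AddAction.orbitRel F X |>.symm this)
    exact ⟨g, hg⟩
  choose τ hτ using hrel
  have hform : ∀ y : X, (∃ g : F, g +ᵥ y ≠ y) → ∃ φ : F →ₗ[ZMod p] ZMod p, φ ≠ 0 ∧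
      ∀ g : F, g +ᵥ y = y → φ g = 0 := by
    rintro y ⟨g, hg⟩
    obtain ⟨φ, hφ, hle⟩ := Submodule.exists_le_ker_of_lt_top
      (AddSubgroup.toZModSubmodule p (AddAction.stabilizer F y))
      (lt_top_iff_ne_top.2 fun h => hg (by
        have : g ∈ AddSubgroup.toZModSubmodule p (AddAction.stabilizer F y) := by simp [h]
        simpa using this))
    exact ⟨φ, hφ, fun g hg => LinearMap.mem_ker.1 (hle (by simpa using hg))⟩
  choose! φ hφ0 hφ using hform
  have hfix : ∀ x ∈ S, ∃ g : F, g +ᵥ out x ≠ out x := by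
    intro x hx
    obtain ⟨g, hg⟩ := hS x hx
    refine ⟨g, fun h => hg ?_⟩
    conv_lhs => rw [← hτ x]
    rw [vadd_vadd, add_comm, ← vadd_vadd, h, hτ]
  refine ⟨fun x => φ (out x), fun x => φ (out x) (τ x), fun x hx => hφ0 _ (hfix x hx),
    fun g x => by simp only [hout], fun x hx g => ?_⟩
  beta_reduce
  rw [hout, ← map_add, ← sub_eq_zero, ← map_sub]
  refine hφ _ (hfix x hx) _ ?_
  have h1 : τ (g +ᵥ x) +ᵥ out x = g +ᵥ x := by rw [← hout g x]; exact hτ _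
  have h2 : τ (g +ᵥ x) - (τ x + g) = -(τ x + g) + τ (g +ᵥ x) := by ring
  rw [h2, ← vadd_vadd, h1, neg_vadd_eq_iff, add_comm, ← vadd_vadd, hτ]

/-- The nilpotent operator on chains used in place of a norm or a difference. -/
noncomputable def shiftOp (X : Type*) [AddAction F X] : Module.End F (X →₀ F) :=
  groupAlgebraAction F X (augmentationElement b)

lemma shiftOp_apply (x : X →₀ F) :
    shiftOp b X x =
      ∑ i, b i • (groupAlgebraAction F X (AddMonoidAlgebra.single (b i) 1) x - x) := by
  simp [shiftOp, augmentationElement]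

lemma shiftOp_pow : shiftOp b X ^ p = 0 := by
  rw [shiftOp, ← map_pow, augmentationElement_pow, map_zero]

lemma groupAlgebraAction_mem {S : Set X} (hS : ∀ x ∈ S, ∀ g : F, g +ᵥ x ∈ S)
    (a : AddMonoidAlgebra F F) {x : X →₀ F} (hx : x ∈ Finsupp.supported F F S) :
    groupAlgebraAction F X a x ∈ Finsupp.supported F F S := by
  induction a using AddMonoidAlgebra.induction_linear with
  | zero => simp
  | add a a' h h' => simpa using Submodule.add_mem _ h h'
  | single g c =>
    rw [Finsupp.supported_eq_span_single] at hx
    have hle : Submodule.span F ((fun y => Finsupp.single y (1 : F)) '' S) ≤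
        (Finsupp.supported F F S).comap
          (groupAlgebraAction F X (AddMonoidAlgebra.single g 1)) := by
      rw [Submodule.span_le]
      rintro _ ⟨y, hy, rfl⟩
      simpa [groupAlgebraAction_single] using
        Finsupp.single_mem_supported F (1 : F) (hS y hy g)
    have hc : AddMonoidAlgebra.single g c = c • AddMonoidAlgebra.single g (1 : F) := by simp
    rw [hc, map_smul]
    exact Submodule.smul_mem _ _ (hle hx)

lemma shiftOp_mem {S : Set X} (hS : ∀ x ∈ S, ∀ g : F, g +ᵥ x ∈ S) {x : X →₀ F}
    (hx : x ∈ Finsupp.supported F F S) : shiftOp b X x ∈ Finsupp.supported F F S :=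
  groupAlgebraAction_mem hS _ hx

lemma exists_commutator_eq_one {S : Set X} (hS : ∀ x ∈ S, ∀ g : F, g +ᵥ x ∈ S)
    (hfix : ∀ x ∈ S, ∃ g : F, g +ᵥ x ≠ x) :
    ∃ s : Module.End F (X →₀ F), (∀ x ∈ Finsupp.supported F F S, s x ∈ Finsupp.supported F F S) ∧
      ∀ x ∈ Finsupp.supported F F S, s (shiftOp b X x) - shiftOp b X (s x) = x := by
  obtain ⟨ψ, ν, hψ0, hψ, hν⟩ := exists_orbit_form (p := p) hfix
  have hinv : ∀ φ : F →ₗ[ZMod p] ZMod p, ∃ a, φ ≠ 0 → a * twistElement b φ = 1 := fun φ => by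
    by_cases h : φ = 0
    · exact ⟨0, fun h' => absurd h h'⟩
    · obtain ⟨a, ha⟩ := exists_mul_twistElement b h
      exact ⟨a, fun _ => ha⟩
  choose a ha using hinv
  let L := groupAlgebraAction F X
  let s : Module.End F (X →₀ F) := Finsupp.linearCombination F fun x =>
    algebraMap (ZMod p) F (ν x) • L (a (ψ x)) (Finsupp.single x 1)
  have hs : ∀ x, s (Finsupp.single x 1) =
      algebraMap (ZMod p) F (ν x) • L (a (ψ x)) (Finsupp.single x 1) := fun x => by simp [s]
  refine ⟨s, fun x hx => ?_, fun x hx => ?_⟩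
  · rw [Finsupp.supported_eq_span_single] at hx
    have hle : Submodule.span F ((fun y => Finsupp.single y (1 : F)) '' S) ≤
        (Finsupp.supported F F S).comap s := by
      rw [Submodule.span_le]
      rintro _ ⟨y, hy, rfl⟩
      rw [SetLike.mem_coe, Submodule.mem_comap, hs]
      exact Submodule.smul_mem _ _
        (groupAlgebraAction_mem hS _ (Finsupp.single_mem_supported F 1 hy))
    exact hle hx
  · rw [Finsupp.supported_eq_span_single] at hx
    have hle : Submodule.span F ((fun y => Finsupp.single y (1 : F)) '' S) ≤
        LinearMap.ker (s * shiftOp b X - shiftOp b X * s - 1) := by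
      rw [Submodule.span_le]
      rintro _ ⟨y, hy, rfl⟩
      rw [SetLike.mem_coe, LinearMap.mem_ker]
      have hg : ∀ g : F, s (Finsupp.single (g +ᵥ y) 1) =
          (algebraMap (ZMod p) F (ν y) + algebraMap (ZMod p) F (ψ y g)) •
            L (a (ψ y) * AddMonoidAlgebra.single g 1) (Finsupp.single y 1) := fun g => by
        rw [hs, hν y hy, hψ, map_add, map_mul, Module.End.mul_apply]
        congr 2
        exact (groupAlgebraAction_single g y 1).symm
      have h1 : s (shiftOp b X (Finsupp.single y 1)) =
          L (algebraMap (ZMod p) F (ν y) • (augmentationElement b * a (ψ y)) +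
            a (ψ y) * twistElement b (ψ y)) (Finsupp.single y 1) := by
        have : algebraMap (ZMod p) F (ν y) • (augmentationElement b * a (ψ y)) +
            a (ψ y) * twistElement b (ψ y) = ∑ i, b i •
              ((algebraMap (ZMod p) F (ν y) + algebraMap (ZMod p) F (ψ y (b i))) •
                (a (ψ y) * AddMonoidAlgebra.single (b i) 1) -
                algebraMap (ZMod p) F (ν y) • a (ψ y)) := by
          rw [augmentationElement, twistElement, Finset.sum_mul, Finset.mul_sum, Finset.smul_sum,
            ← Finset.sum_add_distrib]
          refine Finset.sum_congr rfl fun i _ => ?_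
          simp only [Algebra.smul_def, map_add, map_mul]
          ring
        rw [this, shiftOp_apply, map_sum, map_sum, LinearMap.sum_apply]
        refine Finset.sum_congr rfl fun i _ => ?_
        rw [map_smul, map_sub, groupAlgebraAction_single, hg, hs, map_smul, map_sub, map_smul,
          map_smul]
        rfl
      have h2 : shiftOp b X (s (Finsupp.single y 1)) =
          L (algebraMap (ZMod p) F (ν y) • (augmentationElement b * a (ψ y)))
            (Finsupp.single y 1) := by
        rw [hs, map_smul, map_smul, map_mul]
        rfl
      rw [LinearMap.sub_apply, LinearMap.sub_apply, Module.End.mul_apply, Module.End.mul_apply, h1,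
        h2, ha _ (hψ0 y hy), map_add, map_one]
      simp
    have := hle hx
    rw [LinearMap.mem_ker] at this
    simpa [sub_eq_zero] using this

end ModularExact

/-! ### The algebraic obstruction -/

namespace ListChain

open ModularExact

variable {F : Type*} [Field F] {p : ℕ} [Fact p.Prime] [Algebra (ZMod p) F]
  {ι : Type*} [Fintype ι] (b : Module.Basis ι (ZMod p) F)
  {V Q : Type*} [AddAction F V] [AddAction F Q]

/-- The diagonal action on lists. -/
instance listAddAction : AddAction F (List V) where
  vadd g l := l.map (g +ᵥ ·)
  zero_vadd l := by
    change l.map _ = l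
    simp
  add_vadd g h l := by
    change l.map _ = (l.map _).map _
    simp [add_vadd]

lemma vadd_list_def (g : F) (l : List V) : g +ᵥ l = l.map (g +ᵥ ·) := rfl

lemma groupAlgebraAction_list (g : F) (x : List V →₀ F) :
    groupAlgebraAction F (List V) (AddMonoidAlgebra.single g 1) x = map (g +ᵥ ·) x := by
  have : groupAlgebraAction F (List V) (AddMonoidAlgebra.single g 1) = map (g +ᵥ ·) :=
    linearMap_ext fun l => by rw [groupAlgebraAction_single, map_single, vadd_list_def]
  rw [this]

/-- The operators alternating between a nilpotent operator and its highest nonzero power. -/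
noncomputable def stepOp (V : Type*) [AddAction F V] (n : ℕ) : Module.End F (List V →₀ F) :=
  if n = 0 then 1 else if Even n then shiftOp b (List V) ^ (p - 1) else shiftOp b (List V)

lemma shiftOp_comm {φ : (List V →₀ F) →ₗ[F] (List Q →₀ F)}
    (hφ : ∀ (g : F) x, φ (map (g +ᵥ ·) x) = map (g +ᵥ ·) (φ x)) (x : List V →₀ F) :
    φ (shiftOp b (List V) x) = shiftOp b (List Q) (φ x) := by
  simp only [shiftOp_apply, map_sum, map_smul, map_sub, groupAlgebraAction_list, hφ]

lemma shiftOp_pow_comm {φ : (List V →₀ F) →ₗ[F] (List Q →₀ F)}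
    (hφ : ∀ (g : F) x, φ (map (g +ᵥ ·) x) = map (g +ᵥ ·) (φ x)) (j : ℕ) (x : List V →₀ F) :
    φ ((shiftOp b (List V) ^ j) x) = (shiftOp b (List Q) ^ j) (φ x) := by
  induction j generalizing x with
  | zero => simp
  | succ j ih => simp [pow_succ, ih, shiftOp_comm b hφ]

lemma stepOp_comm {φ : (List V →₀ F) →ₗ[F] (List Q →₀ F)}
    (hφ : ∀ (g : F) x, φ (map (g +ᵥ ·) x) = map (g +ᵥ ·) (φ x)) (n : ℕ) (x : List V →₀ F) :
    φ (stepOp b V n x) = stepOp b Q n (φ x) := by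
  rw [stepOp, stepOp]
  split_ifs
  · simp
  · exact shiftOp_pow_comm b hφ _ x
  · exact shiftOp_comm b hφ x

lemma boundary_stepOp (n : ℕ) (x : List V →₀ F) :
    boundary (stepOp b V n x) = stepOp b V n (boundary x) :=
  stepOp_comm b (fun _ x => boundary_map _ x) n x

lemma stepOp_add_two {n : ℕ} (hn : n ≠ 0) : stepOp b V (n + 2) = stepOp b V n := by
  simp [stepOp, hn, Nat.even_add]

lemma stepOp_succ_stepOp {n : ℕ} (hn : n ≠ 0) (x : List V →₀ F) :
    stepOp b V (n + 1) (stepOp b V n x) = 0 := by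
  have hp : p - 1 + 1 = p := Nat.sub_add_cancel (Fact.out : p.Prime).one_le
  rw [← Module.End.mul_apply]
  by_cases h : Even n
  · have h' : ¬ Even (n + 1) := by simpa [Nat.even_add_one] using h
    rw [stepOp, stepOp, if_neg n.succ_ne_zero, if_neg hn, if_neg h', if_pos h, ← pow_succ', hp,
      shiftOp_pow, LinearMap.zero_apply]
  · have h' : Even (n + 1) := by simpa [Nat.even_add_one] using h
    rw [stepOp, stepOp, if_neg n.succ_ne_zero, if_neg hn, if_pos h', if_neg h, ← pow_succ, hp,
      shiftOp_pow, LinearMap.zero_apply]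

lemma stepOp_nil {n : ℕ} (hn : n ≠ 0) : stepOp b V n (Finsupp.single [] 1) = 0 := by
  have hT : shiftOp b (List V) (Finsupp.single [] 1) = 0 := by
    simp [shiftOp_apply, groupAlgebraAction_list]
  have hp : p - 1 ≠ 0 := by have := (Fact.out : p.Prime).two_le; omega
  rw [stepOp, if_neg hn]
  split_ifs
  · obtain ⟨m, hm⟩ := Nat.exists_eq_succ_of_ne_zero hp
    rw [hm, pow_succ, Module.End.mul_apply, hT, map_zero]
  · exact hT

lemma stepOp_mem {S : Set (List V)} (hS : ∀ l ∈ S, ∀ g : F, g +ᵥ l ∈ S) (n : ℕ)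
    {x : List V →₀ F} (hx : x ∈ Finsupp.supported F F S) :
    stepOp b V n x ∈ Finsupp.supported F F S := by
  have hpow : ∀ j, (shiftOp b (List V) ^ j) x ∈ Finsupp.supported F F S := fun j => by
    induction j with
    | zero => simpa using hx
    | succ j ih => rw [pow_succ', Module.End.mul_apply]; exact shiftOp_mem b hS ih
  rw [stepOp]
  split_ifs
  exacts [hx, hpow _, shiftOp_mem b hS hx]

lemma exists_stepOp_eq {S : Set (List V)} (hS : ∀ l ∈ S, ∀ g : F, g +ᵥ l ∈ S)
    (hfix : ∀ l ∈ S, ∃ g : F, g +ᵥ l ≠ l) {n : ℕ} (hn : n ≠ 0) {x : List V →₀ F}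
    (hx : x ∈ Finsupp.supported F F S) (h0 : stepOp b V n x = 0) :
    ∃ y ∈ Finsupp.supported F F S, x = stepOp b V (n + 1) y := by
  have : CharP F p := charP_of_injective_algebraMap' (ZMod p) p
  have hp := (Fact.out : p.Prime).two_le
  obtain ⟨s, hsP, hs⟩ := exists_commutator_eq_one b hS hfix
  have hTP : ∀ x ∈ Finsupp.supported F F S, shiftOp b (List V) x ∈ Finsupp.supported F F S :=
    fun x hx => shiftOp_mem b hS hx
  rw [stepOp, if_neg hn] at h0
  rw [stepOp, if_neg n.succ_ne_zero]
  by_cases h : Even n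
  · rw [if_pos h] at h0
    rw [if_neg (by simpa [Nat.even_add_one] using h)]
    exact exists_eq_of_pow_eq_zero hTP hsP hs (p - 1) (by omega) x hx h0
  · rw [if_neg h] at h0
    rw [if_pos (by simpa [Nat.even_add_one] using h)]
    exact exists_eq_pow_of_eq_zero hTP hsP hs (p - 1) (by omega) x hx h0

/-- Highly acyclic complexes carry a chain of chains linked by the step operators. -/
lemma exists_step_chains {R : V → V → Prop} (hR : ∀ (g : F) x y, R x y → R (g +ᵥ x) (g +ᵥ y))
    {m : ℕ} (hac : Acyclic F R Set.univ m) :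
    ∃ C : ℕ → List V →₀ F, C 0 = Finsupp.single [] 1 ∧
      (∀ n ≤ m, C n ∈ Finsupp.supported F F (cliqueLists R Set.univ n)) ∧
      ∀ n < m, boundary (C (n + 1)) = stepOp b V n (C n) := by
  have hinv : ∀ n, ∀ l ∈ cliqueLists R Set.univ n, ∀ g : F,
      g +ᵥ l ∈ cliqueLists R Set.univ n := by
    rintro n l ⟨h1, -, h3⟩ g
    refine ⟨by simpa [vadd_list_def] using h1, fun _ _ => trivial, ?_⟩
    simp only [vadd_list_def, List.mem_map]
    rintro _ ⟨x, hx, rfl⟩ _ ⟨y, hy, rfl⟩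
    exact hR g x y (h3 x hx y hy)
  suffices ∀ j ≤ m, ∃ C : ℕ → List V →₀ F, C 0 = Finsupp.single [] 1 ∧
      (∀ n ≤ j, C n ∈ Finsupp.supported F F (cliqueLists R Set.univ n)) ∧
      ∀ n < j, boundary (C (n + 1)) = stepOp b V n (C n) from this m le_rfl
  intro j hj
  induction j with
  | zero =>
    refine ⟨fun _ => Finsupp.single [] 1, rfl, fun n hn => ?_, by simp⟩
    obtain rfl : n = 0 := by omega
    exact single_mem_supported ⟨rfl, by simp, by simp⟩
  | succ j ih =>
    obtain ⟨C, h0, hC, hd⟩ := ih (by omega)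
    obtain ⟨w, hw, hdw⟩ := hac j (by omega) (stepOp b V j (C j))
      (stepOp_mem b (hinv j) j (hC j le_rfl)) (by
        rw [boundary_stepOp]
        rcases j with _ | j
        · simp [h0]
        · rw [hd j (by omega)]
          rcases j with _ | j
          · have h1 : stepOp b V 0 = 1 := by simp [stepOp]
            rw [h0, h1, Module.End.one_apply, stepOp_nil b (Nat.succ_ne_zero 0)]
          · exact stepOp_succ_stepOp b j.succ_ne_zero _)
    refine ⟨Function.update C (j + 1) w, by simpa using h0, fun n hn => ?_, fun n hn => ?_⟩
    · rcases eq_or_lt_of_le hn with rfl | hn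
      · simpa using hw
      · rw [Function.update_of_ne (by omega)]
        exact hC n (by omega)
    · rw [Function.update_of_ne (by omega : n ≠ j + 1)]
      rcases eq_or_lt_of_le (Nat.lt_succ_iff.1 hn) with rfl | hn
      · simpa using hdw
      · rw [Function.update_of_ne (by omega)]
        exact hd n hn

/-- Linked chains cannot exist in a complex of small dimension without fixed simplices. -/
lemma no_step_chains {S : ℕ → Set (List Q)} (hS : ∀ n, ∀ l ∈ S n, ∀ g : F, g +ᵥ l ∈ S n)
    (hfix : ∀ n, n ≠ 0 → ∀ l ∈ S n, ∃ g : F, g +ᵥ l ≠ l) (hS0 : S 0 ⊆ {[]})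
    (hbd : ∀ n, ∀ l ∈ S (n + 1), ∀ l' : List Q, l'.Sublist l → l'.length + 1 = l.length →
      l' ∈ S n)
    {m : ℕ} (hSm : S (m + 1) = ∅) {C : ℕ → List Q →₀ F} (hC0 : C 0 = Finsupp.single [] 1)
    (hC : ∀ n ≤ m + 1, C n ∈ Finsupp.supported F F (S n))
    (hd : ∀ n ≤ m, boundary (C (n + 1)) = stepOp b Q n (C n)) : False := by
  have key : ∀ j ≤ m, ∃ x ∈ Finsupp.supported F F (S (m + 1 - j)), ∃ y,
      C (m + 1 - j) = stepOp b Q (m + 1 - j + 1) x + boundary y := by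
    intro j
    induction j with
    | zero =>
      intro _
      refine ⟨0, Submodule.zero_mem _, 0, ?_⟩
      have := hC (m + 1) le_rfl
      rw [hSm, Finsupp.supported_empty, Submodule.mem_bot] at this
      simp [this]
    | succ j ih =>
      intro hj
      obtain ⟨n, hn⟩ : ∃ n, m + 1 - (j + 1) = n + 1 := ⟨m - j - 1, by omega⟩
      have hn' : m + 1 - j = n + 2 := by omega
      obtain ⟨x, hx, y, hxy⟩ := ih (by omega)
      rw [hn'] at hx hxy
      rw [hn]
      have hbx : boundary x ∈ Finsupp.supported F F (S (n + 1)) :=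
        boundary_mem_supported (fun l hl l' => hbd (n + 1) l hl l') hx
      have h1 := hd (n + 1) (by omega)
      rw [hxy, map_add, boundary_boundary, add_zero, boundary_stepOp,
        stepOp_add_two b n.succ_ne_zero] at h1
      obtain ⟨z, hz, hCz⟩ := exists_stepOp_eq b (hS (n + 1)) (hfix (n + 1) n.succ_ne_zero)
        n.succ_ne_zero (Submodule.sub_mem _ (hC (n + 1) (by omega)) hbx)
        (by rw [map_sub, h1, sub_self])
      exact ⟨z, hz, x, by rw [← hCz]; abel⟩
  obtain ⟨x, hx, y, hxy⟩ := key m le_rfl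
  have hm : m + 1 - m = 0 + 1 := by omega
  rw [hm] at hx hxy
  have hbx : boundary x ∈ Finsupp.supported F F (S 0) :=
    boundary_mem_supported (fun l hl l' => hbd 0 l hl l') hx
  have h1 := hd 0 (by omega)
  rw [hxy, map_add, boundary_boundary, add_zero, boundary_stepOp, hC0] at h1
  have h2 : stepOp b Q (0 + 1 + 1) (boundary x) =
      (0 : (List Q →₀ F) →ₗ[F] (List Q →₀ F)) (boundary x) := by
    refine eq_of_supported (fun l hl => ?_) hbx
    rw [hS0 hl, stepOp_nil b (by omega)]
    simp
  rw [h2, stepOp, if_pos rfl, LinearMap.zero_apply, Module.End.one_apply] at h1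
  exact one_ne_zero (Finsupp.single_eq_zero.1 h1.symm)

/-- There is no equivariant chain map from a highly acyclic clique complex to a complex of small
dimension without fixed simplices. -/
theorem no_equivariant_chain_map (b : Module.Basis ι (ZMod p) F) {R : V → V → Prop}
    (hR : ∀ (g : F) x y, R x y → R (g +ᵥ x) (g +ᵥ y)) {m : ℕ}
    (hac : Acyclic F R Set.univ (m + 1)) {S : ℕ → Set (List Q)}
    (hS : ∀ n, ∀ l ∈ S n, ∀ g : F, g +ᵥ l ∈ S n)
    (hfix : ∀ n, n ≠ 0 → ∀ l ∈ S n, ∃ g : F, g +ᵥ l ≠ l) (hS0 : S 0 ⊆ {[]})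
    (hbd : ∀ n, ∀ l ∈ S (n + 1), ∀ l' : List Q, l'.Sublist l → l'.length + 1 = l.length →
      l' ∈ S n)
    (hSm : S (m + 1) = ∅) (φ : ℕ → (List V →₀ F) →ₗ[F] (List Q →₀ F))
    (hφ0 : φ 0 (Finsupp.single [] 1) = Finsupp.single [] 1)
    (hφg : ∀ n (g : F) x, φ n (map (g +ᵥ ·) x) = map (g +ᵥ ·) (φ n x))
    (hφS : ∀ n ≤ m + 1, ∀ l ∈ cliqueLists R Set.univ n,
      φ n (Finsupp.single l 1) ∈ Finsupp.supported F F (S n))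
    (hφd : ∀ n ≤ m, ∀ l ∈ cliqueLists R Set.univ (n + 1),
      boundary (φ (n + 1) (Finsupp.single l 1)) = φ n (listBoundary F l)) : False := by
  obtain ⟨C, hC0, hC, hd⟩ := exists_step_chains b hR hac
  refine no_step_chains b hS hfix hS0 hbd hSm (C := fun n => φ n (C n)) (by simp [hC0, hφ0])
    (fun n hn => mem_of_supported (hφS n hn) (hC n hn)) fun n hn => ?_
  have h : (boundary.comp (φ (n + 1))) (C (n + 1)) = ((φ n).comp boundary) (C (n + 1)) :=
    eq_of_supported (fun l hl => by simpa using hφd n hn l hl) (hC (n + 1) (by omega))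
  simp only [LinearMap.comp_apply] at h
  rw [h, hd n (by omega), stepOp_comm b (hφg n)]

end ListChain

namespace ListChain

variable {F : Type*} [Field F] {p : ℕ} [Fact p.Prime] [Algebra (ZMod p) F]
  {ι : Type*} [Fintype ι] {V Q : Type*} [AddAction F V] [AddAction F Q]

lemma map_map {k V₁ V₂ V₃ : Type*} [Field k] (f : V₂ → V₃) (g : V₁ → V₂) (x : List V₁ →₀ k) :
    map f (map g x) = map (fun v => f (g v)) x := by
  have : (map f).comp (map g) = map (k := k) (fun v => f (g v)) :=
    linearMap_ext fun l => by simp [Function.comp_def]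
  exact LinearMap.congr_fun this x

/-- The action on real functions induced by an action on the domain. -/
def translate (g : F) : (V → ℝ) →ₗ[ℝ] (V → ℝ) := LinearMap.funLeft ℝ ℝ (-g +ᵥ ·)

@[simp] lemma translate_apply (g : F) (w : V → ℝ) (v : V) : translate g w v = w (-g +ᵥ v) := rfl

lemma translate_single [DecidableEq V] (g : F) (v : V) :
    translate g (Pi.single v 1) = Pi.single (g +ᵥ v) (1 : ℝ) := by
  ext u
  simp only [translate_apply, Pi.single_apply, neg_vadd_eq_iff]

variable [Fintype V]

/-- The geometric realization of the clique complex of `R`. -/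
def cliqueSpace (R : V → V → Prop) : Set (V → ℝ) :=
  {w | w ∈ stdSimplex ℝ V ∧ ∀ u v, w u ≠ 0 → w v ≠ 0 → R u v}

lemma convex_face (l : List V) :
    Convex ℝ {w : V → ℝ | w ∈ stdSimplex ℝ V ∧ ∀ v, w v ≠ 0 → v ∈ l} := by
  intro x hx y hy a c ha hc hac
  refine ⟨convex_stdSimplex ℝ V hx.1 hy.1 ha hc hac, fun v hv => ?_⟩
  by_contra hvl
  have h1 : x v = 0 := by_contra fun h => hvl (hx.2 v h)
  have h2 : y v = 0 := by_contra fun h => hvl (hy.2 v h)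
  simp [h1, h2] at hv

lemma vertices_mem_smallLists [DecidableEq V] (l : List V) :
    l.map (fun v => Pi.single v (1 : ℝ)) ∈
      smallLists {w : V → ℝ | w ∈ stdSimplex ℝ V ∧ ∀ v, w v ≠ 0 → v ∈ l} l.length 2 := by
  refine ⟨by simp, ?_, ?_⟩
  · simp only [List.mem_map]
    rintro _ ⟨v, hv, rfl⟩
    refine ⟨single_mem_stdSimplex ℝ v, fun u hu => ?_⟩
    rw [Pi.single_apply] at hu
    split_ifs at hu with h
    · rwa [h]
    · exact absurd rfl hu
  · simp only [List.mem_map]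
    rintro _ ⟨u, -, rfl⟩ _ ⟨v, -, rfl⟩
    refine (dist_le_norm_add_norm _ _).trans ?_
    rw [Pi.norm_single, Pi.norm_single]
    norm_num

/-- An equivariant labelling of a highly acyclic clique complex, by labels of few ranks and
without fixed points, cannot be locally determined by the rank. -/
theorem no_equivariant_labelling (b : Module.Basis ι (ZMod p) F) {R : V → V → Prop}
    (hR : ∀ (g : F) x y, R x y → R (g +ᵥ x) (g +ᵥ y)) {m : ℕ}
    (hac : Acyclic F R Set.univ (m + 1)) {rank : Q → ℕ}
    (hrank : ∀ (g : F) x, rank (g +ᵥ x) = rank x)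
    {A : Set Q} (hA : ∀ x ∈ A, ∀ g : F, g +ᵥ x ∈ A) (hfix : ∀ x ∈ A, ∃ g : F, g +ᵥ x ≠ x)
    (hA1 : ∀ x ∈ A, 1 ≤ rank x) (hAm : ∀ x ∈ A, rank x ≤ m)
    {ε : ℝ} (hε : 0 < ε) {lab : (V → ℝ) → Q} (hlab : ∀ w ∈ cliqueSpace R, lab w ∈ A)
    (hlabg : ∀ (g : F) w, lab (translate g w) = g +ᵥ lab w)
    (hloc : ∀ w ∈ cliqueSpace R, ∀ w' ∈ cliqueSpace R, dist w w' < ε →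
      rank (lab w) = rank (lab w') → lab w = lab w') : False := by
  classical
  obtain ⟨κ, hκ⟩ : ∃ κ : ℝ, κ = m / (m + 1) := ⟨_, rfl⟩
  have hκ0 : 0 ≤ κ := by rw [hκ]; positivity
  have hκ1 : κ < 1 := by rw [hκ, div_lt_one (by positivity)]; linarith
  obtain ⟨j, hj⟩ := exists_pow_lt_of_lt_one (half_pos hε) hκ1
  let S (n : ℕ) : Set (List Q) :=
    {l | (l.Pairwise fun x y => rank x < rank y) ∧ l.length = n ∧ ∀ x ∈ l, x ∈ A}
  let φ (n : ℕ) : (List V →₀ F) →ₗ[F] (List Q →₀ F) :=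
    (chainSort rank).comp ((map lab).comp
      ((subdivision F n ^ j).comp (map fun v => Pi.single v (1 : ℝ))))
  have hsmall : ∀ n ≤ m + 1, ∀ l ∈ cliqueLists R Set.univ n,
      map lab ((subdivision F n ^ j) (map (fun v => Pi.single v (1 : ℝ)) (Finsupp.single l 1))) ∈
        Finsupp.supported F F {l : List Q | l.length = n ∧ (∀ x ∈ l, x ∈ A) ∧
          ∀ x ∈ l, ∀ y ∈ l, rank x = rank y → x = y} := by
    rintro n hn l ⟨hl1, -, hl2⟩
    have hface : ∀ w : V → ℝ, (w ∈ stdSimplex ℝ V ∧ ∀ v, w v ≠ 0 → v ∈ l) → w ∈ cliqueSpace R :=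
      fun w hw => ⟨hw.1, fun u v hu hv => hl2 u (hw.2 u hu) v (hw.2 v hv)⟩
    have h := vertices_mem_smallLists l
    rw [hl1] at h
    rw [map_single]
    refine map_mem_supported ?_
      (subdivision_pow_mem (convex_face l) hκ hn j (single_mem_supported h))
    rintro l' ⟨h1, h2, h3⟩
    simp only [Set.mem_ofPred_eq, List.length_map, List.mem_map]
    refine ⟨h1, ?_, ?_⟩
    · rintro _ ⟨w, hw, rfl⟩
      exact hlab w (hface w (h2 w hw))
    · rintro _ ⟨w, hw, rfl⟩ _ ⟨w', hw', rfl⟩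
      exact hloc w (hface w (h2 w hw)) w' (hface w' (h2 w' hw'))
        ((h3 w hw w' hw').trans_lt (by linarith))
  refine no_equivariant_chain_map b hR hac (S := S) ?_ ?_ ?_ ?_ ?_ φ ?_ ?_ ?_ ?_
  · rintro n l ⟨h1, h2, h3⟩ g
    refine ⟨?_, by simpa [vadd_list_def] using h2, ?_⟩
    · rw [vadd_list_def, List.pairwise_map]
      simpa only [hrank] using h1
    · simp only [vadd_list_def, List.mem_map]
      rintro _ ⟨x, hx, rfl⟩
      exact hA x (h3 x hx) g
  · rintro n hn l ⟨-, h2, h3⟩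
    rcases l with _ | ⟨x, l⟩
    · exact absurd h2.symm hn
    · obtain ⟨g, hg⟩ := hfix x (h3 x (by simp))
      exact ⟨g, fun h => hg (List.cons.inj h).1⟩
  · rintro l ⟨-, h2, -⟩
    exact List.length_eq_zero_iff.1 h2
  · rintro n l ⟨h1, h2, h3⟩ l' hs hlen
    exact ⟨h1.sublist hs, by omega, fun x hx => h3 x (hs.subset hx)⟩
  · rw [Set.eq_empty_iff_forall_notMem]
    rintro l ⟨h1, h2, h3⟩
    have hnd : (l.map rank).Nodup := by
      rw [List.Nodup, List.pairwise_map]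
      exact h1.imp fun h => h.ne
    have hsub : (l.map rank).toFinset ⊆ Finset.Icc 1 m := by
      intro r hr
      simp only [List.mem_toFinset, List.mem_map] at hr
      obtain ⟨x, hx, rfl⟩ := hr
      exact Finset.mem_Icc.2 ⟨hA1 x (h3 x hx), hAm x (h3 x hx)⟩
    have := Finset.card_le_card hsub
    rw [List.toFinset_card_of_nodup hnd, List.length_map, h2, Nat.card_Icc] at this
    omega
  · have h0 : subdivision F 0 = (1 : Module.End F (List (V → ℝ) →₀ F)) := rfl
    simp [φ, h0, listSort]
  · intro n g x
    simp only [φ, LinearMap.comp_apply]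
    rw [map_chainSort _ (hrank g)]
    congr 1
    have h1 : ∀ y : List V →₀ F, map (fun v => Pi.single v (1 : ℝ)) (map (g +ᵥ ·) y) =
        map (translate g) (map (fun v => Pi.single v (1 : ℝ)) y) := fun y => by
      simp only [map_map, translate_single]
    rw [h1, ← map_subdivision_pow, map_map, map_map]
    simp only [hlabg]
  · intro n hn l hl
    refine mem_of_supported (φ := chainSort rank) (fun l' hl' => ?_) (hsmall n hn l hl)
    rw [chainSort_single]
    refine Finsupp.supported_mono ?_ (listSort_mem l')
    rintro l'' ⟨h1, h2, h3⟩
    exact ⟨h1, h2.trans hl'.1, fun x hx => hl'.2.1 x (h3 x hx)⟩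
  · intro n hn l hl
    simp only [φ, LinearMap.comp_apply]
    rw [boundary_chainSort (Finsupp.supported_mono (fun l' hl' => hl'.2.2)
      (hsmall (n + 1) (by omega) l hl)), boundary_map, boundary_subdivision_pow, boundary_map,
      boundary_single]

end ListChain

namespace ListChain

open scoped Pointwise

/-- Over a free action, a relation compatible with the action contains an equivariant map. -/
lemma exists_equivariant_map {G Y Q : Type*} [AddGroup G] [AddAction G Y] [AddAction G Q]
    (hfree : ∀ (g : G) (y : Y), g +ᵥ y = y → g = 0) {P : Y → Q → Prop}
    (hP : ∀ (g : G) y v, P y v → P (g +ᵥ y) (g +ᵥ v)) (hex : ∀ y, ∃ v, P y v) :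
    ∃ lab : Y → Q, (∀ (g : G) y, lab (g +ᵥ y) = g +ᵥ lab y) ∧ ∀ y, P y (lab y) := by
  let out : Y → Y := fun y => (Quotient.mk (AddAction.orbitRel G Y) y).out
  have hout : ∀ (g : G) (y : Y), out (g +ᵥ y) = out y := fun g y => by
    simp only [out]
    congr 1
    exact Quotient.sound (AddAction.orbitRel_apply.2 ⟨g, rfl⟩)
  have hrel : ∀ y, ∃ g : G, g +ᵥ out y = y := fun y => by
    have : AddAction.orbitRel G Y (out y) y := Quotient.exact (Quotient.out_eq _)
    obtain ⟨g, hg⟩ := AddAction.orbitRel_apply.1 (AddAction.orbitRel G Y |>.symm this)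
    exact ⟨g, hg⟩
  choose τ hτ using hrel
  choose v hv using hex
  refine ⟨fun y => τ y +ᵥ v (out y), fun g y => ?_, fun y => ?_⟩
  · have h1 : τ (g +ᵥ y) +ᵥ out y = g +ᵥ y := by rw [← hout g y]; exact hτ _
    have h2 : (-(g + τ y) + τ (g +ᵥ y)) +ᵥ out y = out y := by
      rw [← vadd_vadd, h1, neg_vadd_eq_iff, ← vadd_vadd, hτ]
    have h3 := hfree _ _ h2
    rw [neg_add_eq_zero] at h3
    simp only [hout, ← h3, vadd_vadd]
  · have := hP (τ y) _ _ (hv (out y))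
    rwa [hτ] at this

/-- The action on coloured vertices by translating the colours. -/
instance colourAction {ι F : Type*} [AddGroup F] : AddAction F (ι × F) where
  vadd g x := (x.1, g + x.2)
  zero_vadd x := by
    change (x.1, 0 + x.2) = x
    simp
  add_vadd g h x := by
    change (x.1, g + h + x.2) = (x.1, g + (h + x.2))
    rw [add_assoc]

lemma vadd_colour_def {ι F : Type*} [AddGroup F] (g : F) (x : ι × F) :
    g +ᵥ x = (x.1, g + x.2) := rfl

section Label

variable {F J : Type*}

/-- The amount by which an entry of a matrix exceeds the minimum of its row. -/
noncomputable def excess [Field F] [Fintype F] (M : J × F → ℝ) (e : J × F) : ℝ :=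
  M e - Finset.univ.inf' Finset.univ_nonempty fun a => M (e.1, a)

/-- The labels: nonempty sets of entries that contain no complete row. -/
def properLabels (J F : Type*) : Set (Finset (J × F)) :=
  {v | v.Nonempty ∧ ∀ j, ∃ a, (j, a) ∉ v}

/-- The entries in `v` have larger excess than the other entries. -/
def Dominates [Field F] [Fintype F] (v : Finset (J × F)) (M : J × F → ℝ) : Prop :=
  ∀ e ∈ v, ∀ e' ∉ v, excess M e' < excess M e

lemma card_le_of_mem_properLabels [Fintype F] [Fintype J] {v : Finset (J × F)}
    (hv : v ∈ properLabels J F) :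
    v.card ≤ Fintype.card J * (Fintype.card F - 1) := by
  classical
  choose a ha using hv.2
  have hinj : Function.Injective fun j => (j, a j) := fun j j' h => (Prod.mk.inj h).1
  have hsub : Finset.univ.map ⟨_, hinj⟩ ⊆ vᶜ := by
    intro e he
    obtain ⟨j, -, rfl⟩ := Finset.mem_map.1 he
    simpa using ha j
  have h1 := Finset.card_le_card hsub
  rw [Finset.card_map, Finset.card_univ, Finset.card_compl, Fintype.card_prod] at h1
  have h2 := Finset.card_le_univ v
  rw [Fintype.card_prod] at h2
  rw [Nat.mul_sub, mul_one]
  omega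

variable [Field F]

lemma vadd_mem_properLabels [DecidableEq F] [DecidableEq J] {v : Finset (J × F)}
    (hv : v ∈ properLabels J F) (g : F) :
    g +ᵥ v ∈ properLabels J F := by
  refine ⟨hv.1.vadd_finset, fun j => ?_⟩
  obtain ⟨a, ha⟩ := hv.2 j
  refine ⟨g + a, fun h => ha ?_⟩
  have : g +ᵥ (j, a) ∈ g +ᵥ v := h
  rwa [Finset.vadd_mem_vadd_finset_iff] at this

lemma exists_vadd_ne_of_mem_properLabels [DecidableEq F] [DecidableEq J] {v : Finset (J × F)}
    (hv : v ∈ properLabels J F) :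
    ∃ g : F, g +ᵥ v ≠ v := by
  obtain ⟨⟨j, a⟩, hja⟩ := hv.1
  obtain ⟨a', ha'⟩ := hv.2 j
  refine ⟨a' - a, fun h => ha' ?_⟩
  have : (a' - a) +ᵥ (j, a) ∈ (a' - a) +ᵥ v := Finset.vadd_mem_vadd_finset hja
  rwa [h, vadd_colour_def, sub_add_cancel] at this

variable [Fintype F]

lemma exists_dominates [Fintype J] {M : J × F → ℝ} (hM : ∃ j a a', M (j, a) ≠ M (j, a')) :
    ∃ v ∈ properLabels J F, Dominates v M := by
  classical
  have hmin : ∀ e, Finset.univ.inf' Finset.univ_nonempty (fun a => M (e.1, a)) ≤ M e :=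
    fun e => Finset.inf'_le (fun a => M (e.1, a)) (Finset.mem_univ e.2)
  refine ⟨Finset.univ.filter fun e => 0 < excess M e, ⟨?_, fun j => ?_⟩, ?_⟩
  · obtain ⟨j, a, a', h⟩ := hM
    by_contra hne
    rw [Finset.not_nonempty_iff_eq_empty, Finset.filter_eq_empty_iff] at hne
    have hz : ∀ a, M (j, a) = Finset.univ.inf' Finset.univ_nonempty fun a => M (j, a) := fun a =>
      le_antisymm (by simpa [excess] using hne (Finset.mem_univ (j, a))) (hmin (j, a))
    exact h ((hz a).trans (hz a').symm)
  · obtain ⟨a, -, ha⟩ := Finset.exists_mem_eq_inf' Finset.univ_nonempty fun a => M (j, a)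
    exact ⟨a, by rw [Finset.mem_filter, excess, ha]; simp⟩
  · intro e he e' he'
    simp only [Finset.mem_filter, Finset.mem_univ, true_and, not_lt] at he he'
    exact he'.trans_lt he

lemma Dominates.eq_of_card_eq {v v' : Finset (J × F)} {M : J × F → ℝ} (h : Dominates v M)
    (h' : Dominates v' M) (hcard : v.card = v'.card) : v = v' := by
  by_contra hne
  have h1 : ¬ v ⊆ v' := fun hs => hne (Finset.eq_of_subset_of_card_le hs hcard.ge)
  have h2 : ¬ v' ⊆ v := fun hs => hne (Finset.eq_of_subset_of_card_le hs hcard.le).symm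
  obtain ⟨e, he, he'⟩ := Finset.not_subset.1 h1
  obtain ⟨e₁, he₁, he₁'⟩ := Finset.not_subset.1 h2
  exact lt_asymm (h e he e₁ he₁') (h' e₁ he₁ e he')

lemma Dominates.vadd [DecidableEq F] [DecidableEq J] {v : Finset (J × F)} {M M' : J × F → ℝ}
    (h : Dominates v M) (g : F)
    (hM : ∀ e, M' (g +ᵥ e) = M e) : Dominates (g +ᵥ v) M' := by
  have hex : ∀ e, excess M' (g +ᵥ e) = excess M e := by
    intro e
    have : (Finset.univ.inf' Finset.univ_nonempty fun a => M' (e.1, a)) =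
        Finset.univ.inf' Finset.univ_nonempty fun a => M (e.1, a) := by
      refine le_antisymm ?_ ?_
      · refine Finset.le_inf' _ _ fun a _ => ?_
        rw [← hM (e.1, a)]
        exact Finset.inf'_le (fun a => M' (e.1, a)) (Finset.mem_univ (g + a))
      · refine Finset.le_inf' _ _ fun a _ => ?_
        have : M' (e.1, a) = M (e.1, -g + a) := by
          rw [← hM, vadd_colour_def, add_neg_cancel_left]
        rw [this]
        exact Finset.inf'_le (fun a => M (e.1, a)) (Finset.mem_univ (-g + a))
    rw [excess, excess, hM]
    exact congrArg _ this
  intro e he e' he'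
  rw [← Finset.neg_vadd_mem_iff] at he he'
  have := h _ he _ he'
  rwa [← hex, ← hex, vadd_neg_vadd, vadd_neg_vadd] at this

lemma continuous_excess {Y : Type*} [TopologicalSpace Y] {M : Y → J × F → ℝ} (hM : Continuous M)
    (e : J × F) : Continuous fun y => excess (M y) e := by
  have h : ∀ e, Continuous fun y => M y e := fun e => (continuous_apply e).comp hM
  exact (h e).sub (Continuous.finset_inf'_apply _ fun a _ => h (e.1, a))

end Label
end ListChain

namespace ListChain

open scoped Pointwise

section Realization

variable {F : Type*} [Field F] {V : Type*}

lemma translate_zero [AddAction F V] (w : V → ℝ) : translate (0 : F) w = w := by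
  ext v
  simp

lemma translate_add (g h : F) [AddAction F V] (w : V → ℝ) :
    translate (g + h) w = translate g (translate h w) := by
  ext v
  simp [vadd_vadd, add_comm]

variable [Fintype V] {R : V → V → Prop}

lemma isCompact_cliqueSpace (R : V → V → Prop) : IsCompact (cliqueSpace R) := by
  have h : cliqueSpace R =
      stdSimplex ℝ V ∩ ⋂ (u : V) (v : V) (_ : ¬ R u v), {w | w u * w v = 0} := by
    ext w
    simp only [cliqueSpace, Set.mem_inter_iff, Set.mem_iInter, Set.mem_ofPred_eq, mul_eq_zero]
    refine and_congr_right fun _ => forall₂_congr fun u v => ?_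
    tauto
  rw [h]
  refine (isCompact_stdSimplex ℝ V).inter_right ?_
  exact isClosed_iInter fun u => isClosed_iInter fun v => isClosed_iInter fun _ =>
    isClosed_eq ((continuous_apply u).mul (continuous_apply v)) continuous_const

variable [AddAction F V]

lemma translate_mem_cliqueSpace (hR : ∀ (g : F) x y, R x y → R (g +ᵥ x) (g +ᵥ y)) (g : F)
    {w : V → ℝ} (hw : w ∈ cliqueSpace R) : translate g w ∈ cliqueSpace R := by
  refine ⟨⟨fun v => hw.1.1 _, ?_⟩, fun u v hu hv => ?_⟩
  · rw [← hw.1.2]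
    exact Fintype.sum_equiv (AddAction.toPerm (-g)) _ _ fun v => rfl
  · simpa using hR g _ _ (hw.2 _ _ hu hv)

lemma dist_translate_le (g : F) (w w' : V → ℝ) :
    dist (translate g w) (translate g w') ≤ dist w w' :=
  (dist_pi_le_iff dist_nonneg).2 fun v => dist_le_pi_dist w w' (-g +ᵥ v)

/-- The action on the realization of the clique complex of an invariant relation. -/
abbrev cliqueSpaceAction (hR : ∀ (g : F) x y, R x y → R (g +ᵥ x) (g +ᵥ y)) :
    AddAction F (cliqueSpace R) where
  vadd g w := ⟨translate g w.1, translate_mem_cliqueSpace hR g w.2⟩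
  zero_vadd w := Subtype.ext (translate_zero w.1)
  add_vadd g h w := Subtype.ext (translate_add g h w.1)

end Realization

variable {F : Type*} [Field F] [Fintype F] {p : ℕ} [Fact p.Prime] [Algebra (ZMod p) F]
  {κ : Type*} [Fintype κ] {ι J : Type*} [Fintype ι] [Fintype J]

/-- A matrix depending continuously and equivariantly on the points of a sufficiently acyclic
complex of coloured vertices has constant rows at some point. -/
theorem exists_constant_rows (b : Module.Basis κ (ZMod p) F) {R : ι × F → ι × F → Prop}
    (hR : ∀ (g : F) x y, R x y → R (g +ᵥ x) (g +ᵥ y))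
    (hcol : ∀ i a a', R (i, a) (i, a') → a = a')
    (hac : Acyclic F R Set.univ (Fintype.card J * (Fintype.card F - 1) + 1))
    {M : (ι × F → ℝ) → J × F → ℝ} (hM : ContinuousOn M (cliqueSpace R))
    (hMg : ∀ (g : F) w e, M (translate g w) (g +ᵥ e) = M w e) :
    ∃ w ∈ cliqueSpace R, ∀ j a a', M w (j, a) = M w (j, a') := by
  classical
  by_contra! hne
  let _ := cliqueSpaceAction hR
  have hfree : ∀ (g : F) (y : cliqueSpace R), g +ᵥ y = y → g = 0 := by
    intro g y hy
    obtain ⟨⟨i, a⟩, -, hi⟩ : ∃ v ∈ Finset.univ, y.1 v ≠ 0 := by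
      refine Finset.exists_ne_zero_of_sum_ne_zero ?_
      rw [y.2.1.2]
      exact one_ne_zero
    have h1 : y.1 (i, -g + a) = y.1 (i, a) := congrFun (congrArg Subtype.val hy) (i, a)
    have h2 := hcol _ _ _ (y.2.2 _ _ hi (h1.symm ▸ hi))
    simpa using h2
  have hopen : ∀ v : Finset (J × F), IsOpen {y : cliqueSpace R | Dominates v (M y.1)} := by
    intro v
    have : {y : cliqueSpace R | Dominates v (M y.1)} =
        ⋂ e ∈ v, ⋂ e' ∈ vᶜ, {y | excess (M y.1) e' < excess (M y.1) e} := by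
      ext y
      simp [Dominates]
    rw [this]
    have hc : Continuous fun y : cliqueSpace R => M y.1 := hM.domRestrict
    exact isOpen_biInter_finset fun e _ => isOpen_biInter_finset fun e' _ =>
      isOpen_lt (continuous_excess hc e') (continuous_excess hc e)
  have : CompactSpace (cliqueSpace R) :=
    isCompact_iff_compactSpace.1 (isCompact_cliqueSpace R)
  obtain ⟨ε, hε, hball⟩ := lebesgue_number_lemma_of_metric
    (c := fun v : properLabels J F => {y : cliqueSpace R | Dominates v.1 (M y.1)})
    isCompact_univ (fun v => hopen v.1) fun y _ => by
      obtain ⟨v, hv, hd⟩ := exists_dominates (hne y.1 y.2)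
      exact Set.mem_iUnion.2 ⟨⟨v, hv⟩, hd⟩
  obtain ⟨lab, hlabg, hlab⟩ := exists_equivariant_map (Q := Finset (J × F)) hfree
    (P := fun y v => v ∈ properLabels J F ∧ ∀ y', dist y' y < ε → Dominates v (M y'.1))
    (fun g y v h => ⟨vadd_mem_properLabels h.1 g, fun y' hy' => by
      have hd : dist (-g +ᵥ y') y < ε := by
        have := dist_translate_le (-g) y'.1 (g +ᵥ y).1
        have h0 : translate (-g) (g +ᵥ y).1 = y.1 := congrArg Subtype.val (neg_vadd_vadd g y)
        rw [h0] at this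
        exact this.trans_lt hy'
      refine (h.2 _ hd).vadd g fun e => ?_
      have h0 : translate g (-g +ᵥ y').1 = y'.1 := congrArg Subtype.val (vadd_neg_vadd g y')
      rw [← hMg g (-g +ᵥ y').1, h0]⟩)
    (fun y => by
      obtain ⟨v, hv⟩ := hball y (Set.mem_univ y)
      exact ⟨v.1, v.2, fun y' hy' => hv hy'⟩)
  have hoff : ∀ (g : F) w, w ∉ cliqueSpace R → translate g w ∉ cliqueSpace R := by
    intro g w hw h
    have := translate_mem_cliqueSpace hR (-g) h
    rw [← translate_add, neg_add_cancel, translate_zero] at this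
    exact hw this
  refine no_equivariant_labelling b hR hac (rank := Finset.card) (A := properLabels J F)
    (fun g x => Finset.card_vadd_finset g x) (fun v hv g => vadd_mem_properLabels hv g)
    (fun v hv => exists_vadd_ne_of_mem_properLabels hv) (fun v hv => hv.1.card_pos)
    (fun v hv => card_le_of_mem_properLabels hv) hε
    (lab := fun w => if h : w ∈ cliqueSpace R then lab ⟨w, h⟩ else ∅) ?_ ?_ ?_
  · intro w hw
    rw [dif_pos hw]
    exact (hlab _).1
  · intro g w
    by_cases hw : w ∈ cliqueSpace R
    · rw [dif_pos hw, dif_pos (translate_mem_cliqueSpace hR g hw)]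
      exact hlabg g ⟨w, hw⟩
    · rw [dif_neg hw, dif_neg (hoff g w hw), Finset.vadd_finset_empty]
  · intro w hw w' hw' hd hcard
    rw [dif_pos hw, dif_pos hw'] at *
    refine ((hlab ⟨w, hw⟩).2 ⟨w', hw'⟩ ?_).eq_of_card_eq ((hlab ⟨w', hw'⟩).2 ⟨w', hw'⟩ ?_) hcard
    · rw [dist_comm]
      exact hd
    · rwa [dist_self]

end ListChain

namespace ListChain

section Cone

variable {ι E : Type*} [Fintype ι] [NormedAddCommGroup E] [NormedSpace ℝ E]

lemma normalize_mem_stdSimplex {x : ι → ℝ} (hx : ∀ i, 0 ≤ x i) (h : ∑ i, x i ≠ 0) :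
    (∑ i, x i)⁻¹ • x ∈ stdSimplex ℝ ι := by
  refine ⟨fun i => mul_nonneg (inv_nonneg.2 (Finset.sum_nonneg fun i _ => hx i)) (hx i), ?_⟩
  simp only [Pi.smul_apply, smul_eq_mul, ← Finset.mul_sum]
  exact inv_mul_cancel₀ h

open Classical in
/-- The extension of a map on the standard simplex to the nonnegative orthant which is linear on
rays. -/
noncomputable def coneMap (f : stdSimplex ℝ ι → E) (x : ι → ℝ) : E :=
  if h : (∑ i, x i)⁻¹ • x ∈ stdSimplex ℝ ι then (∑ i, x i) • f ⟨_, h⟩ else 0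

lemma continuousOn_coneMap (f : C(stdSimplex ℝ ι, E)) :
    ContinuousOn (coneMap f) {x | ∀ i, 0 ≤ x i} := by
  have hsum : Continuous fun x : ι → ℝ => ∑ i, x i := by fun_prop
  intro x hx
  by_cases h0 : ∑ i, x i = 0
  · have hx0 : coneMap f x = 0 := by simp [coneMap, h0]
    have hle : ∀ y, ‖coneMap f y‖ ≤ |∑ i, y i| * ‖f‖ := by
      intro y
      rw [coneMap]
      split_ifs
      · rw [norm_smul, Real.norm_eq_abs]
        exact mul_le_mul_of_nonneg_left (f.norm_coe_le_norm _) (abs_nonneg _)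
      · rw [norm_zero]
        positivity
    rw [ContinuousWithinAt, hx0]
    refine squeeze_zero_norm hle ?_
    have : Filter.Tendsto (fun y : ι → ℝ => |∑ i, y i| * ‖f‖) (nhds x) (nhds 0) := by
      have := (hsum.abs.mul continuous_const).tendsto (x := x) (f := fun y => |∑ i, y i| * ‖f‖)
      simpa [h0] using this
    exact this.mono_left nhdsWithin_le_nhds
  · have hS : ContinuousOn (coneMap f) {x | (∀ i, 0 ≤ x i) ∧ ∑ i, x i ≠ 0} := by
      rw [continuousOn_iff_continuous_domRestrict]
      have heq : Set.domRestrict {x | (∀ i, 0 ≤ x i) ∧ ∑ i, x i ≠ 0} (coneMap f) =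
          fun y => (∑ i, y.1 i) • f ⟨_, normalize_mem_stdSimplex y.2.1 y.2.2⟩ := by
        ext1 y
        exact dif_pos (normalize_mem_stdSimplex y.2.1 y.2.2)
      rw [heq]
      have hs := hsum.comp (continuous_subtype_val (p := fun x : ι → ℝ =>
        x ∈ {x : ι → ℝ | (∀ i, 0 ≤ x i) ∧ ∑ i, x i ≠ 0}))
      exact hs.smul (f.continuous.comp
        (((hs.inv₀ fun y => y.2.2).smul continuous_subtype_val).subtype_mk _))
    refine (hS x ⟨hx, h0⟩).mono_of_mem_nhdsWithin ?_
    exact Filter.inter_mem self_mem_nhdsWithin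
      (mem_nhdsWithin_of_mem_nhds ((isOpen_ne_fun hsum continuous_const).mem_nhds h0))

end Cone

lemma starRel_vadd {ι F : Type*} [AddGroup F] (c : ι) (L : Finset ι) (g : F) (x y : ι × F)
    (h : starRel c L x y) : starRel c L (g +ᵥ x) (g +ᵥ y) := by
  simpa [starRel, vadd_colour_def] using h

/-- The Tverberg theorem with a star as constraint graph, for parts indexed by a finite field. -/
theorem exists_tverberg_partition {F : Type*} [Field F] [Fintype F] {p : ℕ} [Fact p.Prime]
    [Algebra (ZMod p) F] {ι : Type*} [Fintype ι] {d : ℕ}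
    (hι : Fintype.card ι = (d + 1) * (Fintype.card F - 1) + 1) {c : ι} {L : Finset ι}
    (hc : c ∉ L) (hL : L.card + 2 ≤ Fintype.card F)
    (f : C(stdSimplex ℝ ι, EuclideanSpace ℝ (Fin d))) :
    ∃ T : F → Finset ι, (Pairwise fun a a' => Disjoint (T a) (T a')) ∧
      (⋂ a, f '' faceRealization (T a)).Nonempty ∧ ∀ a, c ∈ T a → Disjoint (T a) L := by
  classical
  let M : (ι × F → ℝ) → Option (Fin d) × F → ℝ := fun w e =>
    e.1.elim (∑ i, w (i, e.2)) fun k => coneMap f (fun i => w (i, e.2)) k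
  have hM : ContinuousOn M (cliqueSpace (starRel c L)) := by
    refine continuousOn_pi.2 fun e => ?_
    rcases e with ⟨_ | k, a⟩
    · exact Continuous.continuousOn (by simp only [M, Option.elim]; fun_prop)
    · have h1 : ContinuousOn (fun w : ι × F → ℝ => coneMap f fun i => w (i, a))
          (cliqueSpace (starRel c L)) :=
        (continuousOn_coneMap f).comp (Continuous.continuousOn (by fun_prop))
          fun w hw i => hw.1.1 (i, a)
      exact (EuclideanSpace.proj (𝕜 := ℝ) k).continuous.comp_continuousOn h1
  have hac : Acyclic F (starRel c L) (Set.univ : Set (ι × F))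
      (Fintype.card (Option (Fin d)) * (Fintype.card F - 1) + 1) := by
    have := acyclic_starRel (k := F) (F := F) hc (by rwa [Nat.card_eq_fintype_card])
    rw [hι] at this
    simpa using this
  obtain ⟨w, hw, hrow⟩ := exists_constant_rows (Module.finBasis (ZMod p) F)
    (starRel_vadd c L) (fun i a a' h => h.1 rfl) hac hM fun g w e => by
      simp only [M, translate_apply, vadd_colour_def, neg_add_cancel_left]
  have hmass : ∀ a a', ∑ i, w (i, a) = ∑ i, w (i, a') := hrow none
  have hne : ∀ a, ∑ i, w (i, a) ≠ 0 := by
    intro a ha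
    have h1 := hw.1.2
    rw [Fintype.sum_prod_type_right] at h1
    simp [hmass _ a, ha] at h1
  have hmem : ∀ a, (∑ i, w (i, a))⁻¹ • (fun i => w (i, a)) ∈ stdSimplex ℝ ι := fun a =>
    normalize_mem_stdSimplex (fun i => hw.1.1 (i, a)) (hne a)
  have hval : ∀ a a', f ⟨_, hmem a⟩ = f ⟨_, hmem a'⟩ := by
    intro a a'
    have h1 : coneMap f (fun i => w (i, a)) = coneMap f fun i => w (i, a') := by
      ext k
      exact hrow (some k) a a'
    rw [coneMap, coneMap, dif_pos (hmem a), dif_pos (hmem a')] at h1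
    exact smul_right_injective _ (hne a') ((congrArg (· • _) (hmass a' a)).trans h1)
  refine ⟨fun a => Finset.univ.filter fun i => w (i, a) ≠ 0, ?_, ⟨f ⟨_, hmem 0⟩, ?_⟩, ?_⟩
  · intro a a' haa'
    refine Finset.disjoint_left.2 fun i hi hi' => haa' ?_
    exact (hw.2 _ _ (Finset.mem_filter.1 hi).2 (Finset.mem_filter.1 hi').2).1 rfl
  · refine Set.mem_iInter.2 fun a => ⟨⟨_, hmem a⟩, fun i hi => ?_, hval a 0⟩
    exact Finset.mem_filter.2 ⟨Finset.mem_univ i, (mul_ne_zero_iff.1 hi).2⟩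
  · intro a hca
    refine Finset.disjoint_left.2 fun i hi hiL => ?_
    exact (hw.2 _ _ (Finset.mem_filter.1 hca).2 (Finset.mem_filter.1 hi).2).2.1 rfl hiL rfl

end ListChain

/-- Stars K_{1,l} with l < q − 1 are constraint graphs: for a prime power
q > 2 and N = (d+1)(q−1), given a center vertex c and a set L of l leaf
vertices, every continuous map f : ‖σ^N‖ → ℝ^d has a Tverberg partition into
q pairwise disjoint faces such that the face containing c contains no leaf. -/
theorem star_graph_constraint (p r q d N l : ℕ)
    (hp : p.Prime) (hr : 1 ≤ r) (hq : q = p ^ r) (hq2 : 2 < q) (hd : 1 ≤ d)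
    (hN : N = (d + 1) * (q - 1)) (hl : l < q - 1)
    (c : Fin (N + 1)) (L : Finset (Fin (N + 1))) (hcL : c ∉ L) (hL : L.card = l)
    (f : C(stdSimplex ℝ (Fin (N + 1)), EuclideanSpace ℝ (Fin d))) :
    ∃ F : Fin q → Finset (Fin (N + 1)),
      (Pairwise fun i j => Disjoint (F i) (F j)) ∧
      (⋂ i : Fin q, f '' faceRealization (F i)).Nonempty ∧
      (∀ i : Fin q, c ∈ F i → Disjoint (F i) L) := by
  have : Fact p.Prime := ⟨hp⟩
  let _ : Fintype (GaloisField p r) := Fintype.ofFinite _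
  have hcard : Fintype.card (GaloisField p r) = q := by
    rw [← Nat.card_eq_fintype_card, GaloisField.card p r (by omega), hq]
  obtain ⟨T, hdisj, hne, hstar⟩ := ListChain.exists_tverberg_partition (p := p)
    (F := GaloisField p r) (by rw [Fintype.card_fin, hcard, hN]) hcL (by omega) f
  let e := (Fintype.equivFinOfCardEq hcard).symm
  refine ⟨T ∘ e, fun i j hij => hdisj (e.injective.ne hij), ?_, fun i => hstar (e i)⟩
  rwa [← e.surjective.iInter_comp] at hne
end

section
/- Sierksma's conjecture holds for q = 3, d = 2: every set of 7 points in general position in the plane has at least ((3−1)!)² = 4 Tverberg partitions into 3 parts. -/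
/-- A Tverberg partition of a finite point set `X ⊆ ℝ^d` into `q` parts:
a partition of `X` into `q` subsets whose convex hulls have a common point. -/
def IsTverbergPartition (d q : ℕ) (X : Finset (EuclideanSpace ℝ (Fin d)))
    (P : Finset (Finset (EuclideanSpace ℝ (Fin d)))) : Prop :=
  P.card = q ∧ (∀ S ∈ P, S ⊆ X) ∧ (∀ x ∈ X, ∃! S, S ∈ P ∧ x ∈ S) ∧
  (⋂ S ∈ P, convexHull ℝ (S : Set (EuclideanSpace ℝ (Fin d)))).Nonempty

open Finset Module

section Relations

variable {ι κ E : Type*} [Fintype ι] [AddCommGroup E] [Module ℝ E]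

/-- Moving a nonnegative vector in a direction with a negative entry, one reaches the boundary of
the orthant. -/
lemma exists_add_smul_boundary {l c : ι → ℝ} (hl : 0 ≤ l) {k : ι} (hk : c k < 0) :
    ∃ t : ℝ, 0 ≤ l + t • c ∧ ∃ i, c i < 0 ∧ (l + t • c) i = 0 := by
  classical
  obtain ⟨i, hi, hmin⟩ := Finset.exists_min_image (univ.filter fun i => c i < 0)
    (fun i => l i / -c i) ⟨k, by simpa using hk⟩
  simp only [mem_filter, mem_univ, true_and] at hi hmin
  refine ⟨l i / -c i, fun j => ?_, i, hi, ?_⟩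
  · have hli : 0 ≤ l i / -c i := div_nonneg (hl i) (by linarith)
    have hlj : 0 ≤ l j := hl j
    simp only [Pi.zero_apply, Pi.add_apply, Pi.smul_apply, smul_eq_mul]
    rcases lt_or_ge (c j) 0 with hj | hj
    · have := hmin j hj
      rw [le_div_iff₀ (by linarith)] at this
      linarith
    · positivity
  · simp only [Pi.add_apply, Pi.smul_apply, smul_eq_mul]
    field_simp [hi.ne]
    ring

/-- `l` is a nontrivial nonnegative linear relation between the vectors `w i`. -/
def IsNonnegRelation (w : ι → E) (l : ι → ℝ) : Prop :=
  0 ≤ l ∧ l ≠ 0 ∧ ∑ i, l i • w i = 0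

/-- `u` lies in the cone spanned by the vectors `w k`, `k ≠ i`. -/
def MemFacetCone (w : ι → E) (u : E) (i : ι) : Prop :=
  ∃ l : ι → ℝ, 0 ≤ l ∧ l i = 0 ∧ ∑ k, l k • w k = u

/-- `u` avoids every proper subspace spanned by a subfamily of `w`. -/
def AvoidsProperSpans {α : Type*} (w : α → E) (u : E) : Prop :=
  ∀ S : Finset α, u ∈ Submodule.span ℝ (w '' S) → Submodule.span ℝ (w '' S) = ⊤

lemma exists_avoidsProperSpans {α : Type*} [Fintype α] (w : α → E) :
    ∃ u, AvoidsProperSpans w u := by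
  classical
  obtain ⟨u, hu⟩ := Submodule.exists_forall_notMem_of_forall_ne_top
    (fun S : {S : Finset α // Submodule.span ℝ (w '' S) ≠ ⊤} =>
      Submodule.span ℝ (w '' (S : Finset α))) (fun S => S.2)
  exact ⟨u, fun S hS => by_contra fun h => hu ⟨S, h⟩ hS⟩

lemma AvoidsProperSpans.comp {α β : Type*} {w : α → E} {u : E}
    (h : AvoidsProperSpans w u) (f : β → α) : AvoidsProperSpans (w ∘ f) u := by
  classical
  intro S
  have := h (S.image f)
  rwa [coe_image, ← Set.image_comp] at this

variable {w : ι → E} {u : E}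

lemma AvoidsProperSpans.span_eq_top (hu : AvoidsProperSpans w u) {l : ι → ℝ}
    (hl : ∑ k, l k • w k = u) {S : Finset ι} (hS : ∀ k, k ∉ S → l k = 0) :
    Submodule.span ℝ (w '' S) = ⊤ := by
  refine hu S (hl ▸ Submodule.sum_mem _ fun k _ => ?_)
  by_cases hk : k ∈ S
  · exact Submodule.smul_mem _ _ (Submodule.subset_span ⟨k, hk, rfl⟩)
  · simp [hS k hk]

lemma AvoidsProperSpans.eq_of_apply_eq_zero (hu : AvoidsProperSpans w u)
    (hdim : finrank ℝ E + 1 = Fintype.card ι) {l : ι → ℝ} (hl : ∑ k, l k • w k = u) {i j : ι}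
    (hi : l i = 0) (hj : l j = 0) : i = j := by
  classical
  by_contra hij
  have htop := hu.span_eq_top hl (S := {i, j}ᶜ) (fun k hk => by
    simp only [mem_compl, mem_insert, mem_singleton, not_not] at hk
    rcases hk with rfl | rfl <;> assumption)
  have h1 := finrank_span_finset_le_card (R := ℝ) (({i, j}ᶜ : Finset ι).image w)
  rw [Set.finrank, coe_image, htop, finrank_top] at h1
  have h2 : (({i, j}ᶜ : Finset ι).image w).card ≤ ({i, j}ᶜ : Finset ι).card := card_image_le
  rw [card_compl, card_pair hij] at h2
  have : ({i, j} : Finset ι).card ≤ Fintype.card ι := card_le_univ _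
  rw [card_pair hij] at this
  omega

lemma AvoidsProperSpans.relation_apply_ne_zero (hu : AvoidsProperSpans w u)
    (hdim : finrank ℝ E + 1 = Fintype.card ι) {l c : ι → ℝ} (hl : ∑ k, l k • w k = u) {i : ι}
    (hi : l i = 0) (hc : ∑ k, c k • w k = 0) (hc0 : c ≠ 0) : c i ≠ 0 := by
  classical
  intro hci
  have htop := hu.span_eq_top hl (S := {i}ᶜ) (fun k hk => by
    simp only [mem_compl, mem_singleton, not_not] at hk
    rwa [hk])
  have hind : LinearIndependent ℝ (fun k : {k // k ≠ i} => w k) := by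
    refine linearIndependent_of_top_le_span_of_card_eq_finrank ?_ ?_
    · rw [← htop]
      refine Submodule.span_mono ?_
      rintro _ ⟨k, hk, rfl⟩
      exact ⟨⟨k, by simpa using hk⟩, rfl⟩
    · rw [Fintype.card_subtype_compl, Fintype.card_subtype_eq]
      omega
  rw [Fintype.linearIndependent_iff] at hind
  apply hc0
  funext k
  by_cases hk : k = i
  · rw [hk, hci]; rfl
  · refine hind (fun k => c k) ?_ ⟨k, hk⟩
    rw [← hc, ← Fintype.sum_subtype_add_sum_subtype (fun k => k ≠ i) (fun k => c k • w k)]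
    refine (add_eq_left.2 ?_).symm
    refine Finset.sum_eq_zero fun k _ => ?_
    rw [not_not.1 k.2, hci, zero_smul]

lemma sum_add_smul_smul (l c : ι → ℝ) (t : ℝ) (w : ι → E) :
    ∑ k, (l + t • c) k • w k = ∑ k, l k • w k + t • ∑ k, c k • w k := by
  simp only [Pi.add_apply, Pi.smul_apply, smul_eq_mul, add_smul, sum_add_distrib, mul_smul,
    smul_sum]

open Classical in
/-- If all relations between the `w k` are multiples of `c`, then at most one facet cone indexed by
a positive entry of `c` contains a generic vector `u`. -/
lemma card_pos_facets (hu : AvoidsProperSpans w u) (hdim : finrank ℝ E + 1 = Fintype.card ι)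
    {c : ι → ℝ} (hc : ∑ k, c k • w k = 0)
    (hker : ∀ d : ι → ℝ, ∑ k, d k • w k = 0 → ∃ t : ℝ, d = t • c) :
    (univ.filter fun i => 0 < c i ∧ MemFacetCone w u i).card =
      if (∃ l : ι → ℝ, 0 ≤ l ∧ ∑ k, l k • w k = u) ∧ ∃ i, 0 < c i then 1 else 0 := by
  split_ifs with h
  · obtain ⟨⟨l, hl, hlu⟩, i, hi⟩ := h
    obtain ⟨t, ht, j, hj, hj0⟩ := exists_add_smul_boundary hl (c := -c) (k := i) (by simpa using hi)
    rw [card_eq_one]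
    refine ⟨j, ?_⟩
    have hjmem : MemFacetCone w u j := ⟨_, ht, hj0, by
      rw [sum_add_smul_smul, hlu]; simp [hc]⟩
    ext i'
    simp only [mem_filter, mem_univ, true_and, mem_singleton]
    constructor
    · rintro ⟨hi', l', hl', hl'0, hl'u⟩
      obtain ⟨l, hl, hl0, hlu⟩ := hjmem
      obtain ⟨s, hs⟩ := hker (l' - l) (by simp [sub_smul, hl'u, hlu])
      have e1 : l' i' - l i' = s * c i' := congrFun hs i'
      have e2 : l' j - l j = s * c j := congrFun hs j
      have p1 : 0 ≤ l i' := hl i'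
      have p2 : 0 ≤ l' j := hl' j
      have hcj : 0 < c j := by simpa using hj
      have hs0 : s = 0 := by
        apply le_antisymm
        · by_contra hcon
          have : 0 < s * c i' := mul_pos (not_le.1 hcon) hi'
          linarith
        · by_contra hcon
          have : s * c j < 0 := mul_neg_of_neg_of_pos (not_le.1 hcon) hcj
          linarith
      refine hu.eq_of_apply_eq_zero hdim hl'u hl'0 ?_
      rw [hs0] at e2
      linarith
    · rintro rfl
      exact ⟨by simpa using hj, hjmem⟩
  · rw [card_eq_zero, filter_eq_empty_iff]
    rintro i - ⟨hi, l, hl, -, hlu⟩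
    exact h ⟨⟨l, hl, hlu⟩, i, hi⟩

/-- A nonnegative relation without zero entries spans all relations, once no nonnegative relation
has a zero entry. -/
lemma IsNonnegRelation.eq_smul {l : ι → ℝ}
    (hw : ∀ l, IsNonnegRelation w l → ∀ i, l i ≠ 0) (hl : IsNonnegRelation w l) {d : ι → ℝ}
    (hd : ∑ k, d k • w k = 0) : ∃ t : ℝ, d = t • l := by
  obtain ⟨i, hi⟩ : ∃ i, l i ≠ 0 := Function.ne_iff.1 hl.2.1
  by_contra! hcon
  have key : ∀ c : ι → ℝ, ∑ k, c k • w k = 0 → c i = 0 → ∀ k, ¬ c k < 0 := by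
    intro c hc hci k hk
    obtain ⟨t, ht, j, -, hj⟩ := exists_add_smul_boundary hl.1 hk
    refine hw (l + t • c) ⟨ht, fun h0 => hi ?_, ?_⟩ j hj
    · simpa [hci] using congrFun h0 i
    · rw [sum_add_smul_smul, hl.2.2, hc]; simp
  have hc : ∑ k, (d + (-(d i / l i)) • l) k • w k = 0 := by
    rw [sum_add_smul_smul, hd, hl.2.2]; simp
  have hci : (d + (-(d i / l i)) • l) i = 0 := by
    simp [hi]
  refine hcon (d i / l i) (funext fun k => ?_)
  have h1 := key _ hc hci k
  have h2 := key (-(d + (-(d i / l i)) • l)) (by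
    rw [← neg_zero, ← hc, ← sum_neg_distrib]
    exact sum_congr rfl fun k _ => neg_smul _ _) (by rw [Pi.neg_apply, hci, neg_zero]) k
  simp only [Pi.add_apply, Pi.smul_apply, Pi.neg_apply, smul_eq_mul] at h1 h2 ⊢
  linarith

open Classical in
/-- A generic ray from the origin leaves a simplex through an odd number of facets exactly if the
simplex contains the origin. -/
lemma card_facets [FiniteDimensional ℝ E] (hu : AvoidsProperSpans w u)
    (hdim : finrank ℝ E + 1 = Fintype.card ι)
    (hw : ∀ l, IsNonnegRelation w l → ∀ i, l i ≠ 0) :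
    ((univ.filter fun i => MemFacetCone w u i).card : ZMod 2) =
      if ∃ l, IsNonnegRelation w l then 1 else 0 := by
  set φ := Fintype.linearCombination ℝ w
  have hφ : ∀ l, φ l = ∑ k, l k • w k := fun l => Fintype.linearCombination_apply ℝ w l
  have hrn := φ.finrank_range_add_finrank_ker
  rw [finrank_fintype_fun_eq_card] at hrn
  split_ifs with hrel
  · obtain ⟨l, hl⟩ := hrel
    have hpos : ∀ i, 0 < l i := fun i => lt_of_le_of_ne (hl.1 i) (hw l hl i).symm
    have hker1 : finrank ℝ (LinearMap.ker φ) ≤ 1 := by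
      refine finrank_le_one ⟨l, by rw [LinearMap.mem_ker, hφ, hl.2.2]⟩ fun ⟨d, hd⟩ => ?_
      rw [LinearMap.mem_ker, hφ] at hd
      obtain ⟨t, rfl⟩ := hl.eq_smul hw hd
      exact ⟨t, rfl⟩
    have hrange : LinearMap.range φ = ⊤ := by
      by_contra hne
      have := Submodule.finrank_lt hne
      omega
    obtain ⟨m, hm⟩ := LinearMap.range_eq_top.1 hrange u
    rw [hφ] at hm
    obtain ⟨i, -⟩ := Function.ne_iff.1 hl.2.1
    have hcard := card_pos_facets hu hdim hl.2.2 (fun d hd => hl.eq_smul hw hd)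
    rw [if_pos] at hcard
    · simp only [hpos, true_and] at hcard
      rw [hcard, Nat.cast_one]
    · refine ⟨⟨m + (∑ k, |m k| / l k) • l, fun j => ?_, ?_⟩, i, hpos i⟩
      · have h1 : |m j| / l j ≤ ∑ k, |m k| / l k :=
          single_le_sum (f := fun k => |m k| / l k)
            (fun k _ => div_nonneg (abs_nonneg _) (hpos k).le) (mem_univ j)
        rw [div_le_iff₀ (hpos j)] at h1
        have := neg_abs_le (m j)
        simp only [Pi.zero_apply, Pi.add_apply, Pi.smul_apply, smul_eq_mul]
        linarith
      · rw [sum_add_smul_smul, hm, hl.2.2]; simp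
  by_cases hsurj : LinearMap.range φ = ⊤
  swap
  · rw [filter_eq_empty_iff.2, card_empty, Nat.cast_zero]
    rintro i - ⟨l, -, -, hl⟩
    apply hsurj
    rw [Fintype.range_linearCombination, ← hu.span_eq_top hl (S := univ) (by simp)]
    simp
  rw [hsurj, finrank_top] at hrn
  obtain ⟨⟨c, hcker⟩, hc0, hspan⟩ :=
    finrank_eq_one_iff'.1 (show finrank ℝ (LinearMap.ker φ) = 1 by omega)
  have hc : ∑ k, c k • w k = 0 := by rw [← hφ]; exact hcker
  have hcne : c ≠ 0 := fun h => hc0 (by simpa using h)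
  have hker : ∀ d : ι → ℝ, ∑ k, d k • w k = 0 → ∃ t : ℝ, d = t • c := by
    intro d hd
    obtain ⟨t, ht⟩ := hspan ⟨d, by rw [LinearMap.mem_ker, hφ, hd]⟩
    exact ⟨t, by simpa using (congrArg Subtype.val ht).symm⟩
  have hneg : ∑ k, (-c) k • w k = 0 := by
    rw [← neg_zero, ← hc, ← sum_neg_distrib]
    exact sum_congr rfl fun k _ => neg_smul _ _
  have hexpos : ∃ i, 0 < c i := by
    by_contra! h
    exact hrel ⟨-c, fun i => by simpa using h i, by simpa using hcne, hneg⟩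
  have hexneg : ∃ i, 0 < (-c) i := by
    by_contra! h
    exact hrel ⟨c, fun i => by simpa using h i, hcne, hc⟩
  have h1 := card_pos_facets hu hdim hc hker
  have h2 := card_pos_facets hu hdim hneg (fun d hd => by
    obtain ⟨t, ht⟩ := hker d hd
    exact ⟨-t, by simpa using ht⟩)
  simp only [hexpos, hexneg, and_true] at h1 h2
  have hsplit : (univ.filter fun i => MemFacetCone w u i) =
      (univ.filter fun i => 0 < c i ∧ MemFacetCone w u i) ∪
        (univ.filter fun i => 0 < (-c) i ∧ MemFacetCone w u i) := by
    ext i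
    simp only [mem_filter, mem_univ, true_and, mem_union, ← or_and_right, Pi.neg_apply,
      neg_pos, iff_and_self]
    rintro ⟨l, -, hli, hl⟩
    exact (hu.relation_apply_ne_zero hdim hl hli hc hcne).lt_or_gt.symm
  rw [hsplit, card_union_of_disjoint, h1, h2, Nat.cast_add]
  · exact CharTwo.add_self_eq_zero _
  · refine disjoint_filter.2 fun i _ hi hi' => ?_
    have h3 : 0 < -c i := hi'.1
    linarith [hi.1]

end Relations

section Colorful

variable {ι κ E : Type*} [Fintype ι]

/-- The vectors of the color classes `v i` selected by `a` contain the origin in their convex hull,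
i.e. they satisfy a nontrivial nonnegative relation. -/
def IsBalanced [AddCommGroup E] [Module ℝ E] (v : ι → κ → E) (a : ι → κ) : Prop :=
  ∃ l, IsNonnegRelation (fun i => v i (a i)) l

section Parity

variable [AddCommGroup E] [Module ℝ E]

lemma memFacetCone_update [DecidableEq ι] (v : ι → κ → E) (a : ι → κ) (u : E) (i : ι) (x : κ) :
    MemFacetCone (fun k => v k (Function.update a i x k)) u i ↔
      MemFacetCone (fun k => v k (a k)) u i := by
  refine exists_congr fun l => and_congr_right fun _ => and_congr_right fun hi => ?_
  rw [sum_congr rfl fun k _ => ?_]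
  by_cases hk : k = i
  · rw [hk, hi, zero_smul, zero_smul]
  · simp only [Function.update_of_ne hk]

open Classical in
/-- The octahedral lemma: for generic color classes of size three, an even number of the colorful
simplices that avoid one prescribed vertex of each color contain the origin. -/
theorem card_balanced_avoiding [FiniteDimensional ℝ E] {v : ι → Fin 3 → E}
    (hdim : finrank ℝ E + 1 = Fintype.card ι)
    (hv : ∀ (a : ι → Fin 3) l, IsNonnegRelation (fun i => v i (a i)) l → ∀ i, l i ≠ 0)
    (m : ι → Fin 3) :
    ((univ.filter fun a : ι → Fin 3 => IsBalanced v a ∧ ∀ i, a i ≠ m i).card : ZMod 2) = 0 := by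
  obtain ⟨u, hu⟩ := exists_avoidsProperSpans (fun p : ι × Fin 3 => v p.1 p.2)
  have hcount : ∀ a : ι → Fin 3, (if IsBalanced v a then (1 : ZMod 2) else 0) =
      ∑ i, if MemFacetCone (fun k => v k (a k)) u i then 1 else 0 := fun a => by
    rw [sum_boole]
    exact (card_facets (hu.comp fun i => (i, a i)) hdim (hv a)).symm
  have hthird : ∀ x y : Fin 3, x ≠ y → -(x + y) ≠ y ∧ -(x + y) ≠ x ∧ -(-(x + y) + y) = x := by
    decide
  calc ((univ.filter fun a : ι → Fin 3 => IsBalanced v a ∧ ∀ i, a i ≠ m i).card : ZMod 2)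
      = ∑ a ∈ univ.filter fun a : ι → Fin 3 => ∀ i, a i ≠ m i,
          if IsBalanced v a then (1 : ZMod 2) else 0 := by
        rw [sum_boole, filter_filter]
        simp only [and_comm]
    _ = ∑ i, ∑ a ∈ univ.filter fun a : ι → Fin 3 => ∀ i, a i ≠ m i,
          if MemFacetCone (fun k => v k (a k)) u i then (1 : ZMod 2) else 0 := by
        rw [sum_comm]
        exact sum_congr rfl fun a _ => hcount a
    _ = 0 := by
        refine sum_eq_zero fun i _ => ?_
        refine sum_involution (fun a _ => Function.update a i (-(a i + m i))) ?_ ?_ ?_ ?_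
        · intro a _
          simp only [memFacetCone_update]
          exact CharTwo.add_self_eq_zero _
        · intro a ha _ heq
          simp only [mem_filter, mem_univ, true_and] at ha
          have := congrFun heq i
          rw [Function.update_self] at this
          exact (hthird _ _ (ha i)).2.1 this
        · intro a ha
          simp only [mem_filter, mem_univ, true_and] at ha ⊢
          intro k
          by_cases hk : k = i
          · subst hk
            rw [Function.update_self]
            exact (hthird _ _ (ha k)).1
          · rw [Function.update_of_ne hk]
            exact ha k
        · intro a ha
          simp only [mem_filter, mem_univ, true_and] at ha
          simp only [Function.update_self, Function.update_idem, (hthird _ _ (ha i)).2.2,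
            Function.update_eq_self]

/-- If every color class sums to zero and no proper colorful face contains the origin, then the
colorful simplices containing the origin do not comprise all simplices over a given facet. -/
theorem not_forall_isBalanced_update [DecidableEq ι] [Fintype κ] [Nonempty κ] [Nontrivial ι]
    {v : ι → κ → E}
    (hv : ∀ (a : ι → κ) l, IsNonnegRelation (fun i => v i (a i)) l → ∀ i, l i ≠ 0)
    (hsum : ∀ i, ∑ j, v i j = 0) (a : ι → κ) (i : ι) :
    ¬ ∀ j, IsBalanced v (Function.update a i j) := by
  intro h
  choose l hl using h
  have hpos : ∀ j k, 0 < l j k := fun j k =>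
    lt_of_le_of_ne ((hl j).1 k) (hv _ _ (hl j) k).symm
  set L : ι → ℝ := Function.update (fun k => ∑ j, (l j i)⁻¹ * l j k) i 0 with hL
  have hLpos : ∀ k, k ≠ i → 0 < L k := fun k hk => by
    rw [hL, Function.update_of_ne hk]
    exact sum_pos (fun j _ => mul_pos (inv_pos.2 (hpos j i)) (hpos j k)) univ_nonempty
  obtain ⟨k, hk⟩ := exists_ne i
  refine hv a L ⟨fun k => ?_, fun h0 => (hLpos k hk).ne' (congrFun h0 k), ?_⟩ i (by simp [hL])
  · by_cases hki : k = i
    · simp [hki, hL]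
    · exact (hLpos k hki).le
  · have key : ∀ j, v i j + ∑ k ∈ univ.erase i, ((l j i)⁻¹ * l j k) • v k (a k) = 0 := by
      intro j
      have h1 := (hl j).2.2
      rw [← add_sum_erase _ _ (mem_univ i)] at h1
      have h2 := congrArg (fun x => (l j i)⁻¹ • x) h1
      simp only [smul_add, smul_smul, smul_sum, smul_zero, Function.update_self,
        inv_mul_cancel₀ (hpos j i).ne', one_smul] at h2
      rw [← h2]
      congr 1
      refine sum_congr rfl fun k hk => ?_
      rw [Function.update_of_ne (ne_of_mem_erase hk)]
    have := Finset.sum_eq_zero fun j (_ : j ∈ (univ : Finset κ)) => key j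
    rw [sum_add_distrib, hsum, zero_add, sum_comm] at this
    rw [← add_sum_erase _ _ (mem_univ i), ← this]
    simp only [hL, Function.update_self, zero_smul, zero_add]
    refine sum_congr rfl fun k hk => ?_
    rw [Function.update_of_ne (ne_of_mem_erase hk), sum_smul]

end Parity

open scoped RealInnerProductSpace in
/-- A point of minimal norm of a convex set spans a supporting hyperplane. -/
lemma norm_sq_le_inner_of_norm_le {E : Type*} [NormedAddCommGroup E] [InnerProductSpace ℝ E]
    {K : Set E} (hK : Convex ℝ K) {p : E} (hp : p ∈ K) (hmin : ∀ y ∈ K, ‖p‖ ≤ ‖y‖) {y : E}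
    (hy : y ∈ K) : ‖p‖ ^ 2 ≤ ⟪p, y⟫ := by
  have : ‖(0 : E) - p‖ = ⨅ w : K, ‖(0 : E) - w‖ := by
    have : Nonempty K := ⟨⟨p, hp⟩⟩
    refine le_antisymm (le_ciInf fun w => by simpa using hmin w w.2) ?_
    exact ciInf_le (f := fun w : K => ‖(0 : E) - w‖)
      ⟨0, by rintro _ ⟨w, rfl⟩; exact norm_nonneg _⟩ ⟨p, hp⟩
  have h := (norm_eq_iInf_iff_real_inner_le_zero hK hp).1 this y hy
  rw [zero_sub, inner_neg_left, inner_sub_right, real_inner_self_eq_norm_sq] at h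
  linarith

open scoped RealInnerProductSpace in
/-- Bárány's colorful Carathéodory theorem for color classes with sum zero. -/
theorem exists_isBalanced [NormedAddCommGroup E] [InnerProductSpace ℝ E] [FiniteDimensional ℝ E]
    [Fintype κ] [Nonempty κ] (v : ι → κ → E) (hcard : finrank ℝ E < Fintype.card ι)
    (hsum : ∀ i, ∑ j, v i j = 0) : ∃ a, IsBalanced v a := by
  classical
  have hι : Nonempty ι := Fintype.card_pos_iff.1 (by omega)
  let f : (ι → κ) → (ι → ℝ) → E := fun a l => ∑ i, l i • v i (a i)
  have hf : ∀ a, Continuous (f a) := fun a => by fun_prop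
  have hconv : ∀ a, Convex ℝ (f a '' stdSimplex ℝ ι) := fun a =>
    (convex_stdSimplex ℝ ι).is_linear_image (f := f a)
      ⟨fun x y => by simp [f, add_smul, sum_add_distrib],
        fun c x => by simp [f, mul_smul, smul_sum]⟩
  have hne : (stdSimplex ℝ ι).Nonempty := ⟨_, single_mem_stdSimplex ℝ hι.some⟩
  have hex : ∀ a, ∃ l ∈ stdSimplex ℝ ι, ∀ l' ∈ stdSimplex ℝ ι, ‖f a l‖ ≤ ‖f a l'‖ := fun a =>
    (isCompact_stdSimplex ℝ ι).exists_isMinOn hne (hf a).norm.continuousOn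
  choose l hl hlmin using hex
  obtain ⟨a, ha⟩ := Finite.exists_min fun a => ‖f a (l a)‖
  refine ⟨a, l a, (hl a).1, fun h0 => ?_, ?_⟩
  · have := (hl a).2
    simp [h0] at this
  by_contra hp0
  set p := f a (l a) with hp
  have hp0 : p ≠ 0 := hp0
  have hge : ∀ b, ∀ l' ∈ stdSimplex ℝ ι, ‖p‖ ≤ ‖f b l'‖ := fun b l' hl' =>
    (ha b).trans (hlmin b l' hl')
  have hinner : ∀ b, p ∈ f b '' stdSimplex ℝ ι → ∀ i, ‖p‖ ^ 2 ≤ ⟪p, v i (b i)⟫ := by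
    intro b hb i
    refine norm_sq_le_inner_of_norm_le (hconv b) hb ?_
      ⟨Pi.single i 1, single_mem_stdSimplex ℝ i, ?_⟩
    · rintro _ ⟨l', hl', rfl⟩
      exact hge b l' hl'
    · simp [f]
  have hface : ∃ l' ∈ stdSimplex ℝ ι, f a l' = p ∧ ∃ i, l' i = 0 := by
    by_contra! hcon
    have hpos : ∀ i, 0 < l a i := fun i =>
      lt_of_le_of_ne ((hl a).1 i) (hcon _ (hl a) rfl i).symm
    have heq : ∀ i, ⟪p, v i (a i)⟫ = ‖p‖ ^ 2 := by
      have h1 : ∑ i, l a i * (⟪p, v i (a i)⟫ - ‖p‖ ^ 2) = 0 := by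
        have h2 : ⟪p, p⟫ = ∑ i, l a i * ⟪p, v i (a i)⟫ := by
          nth_rewrite 2 [hp]
          simp only [f, inner_sum, inner_smul_right]
        simp only [mul_sub, sum_sub_distrib, ← sum_mul, (hl a).2, one_mul]
        rw [← h2, real_inner_self_eq_norm_sq, sub_self]
      rw [sum_eq_zero_iff_of_nonneg fun i _ => mul_nonneg (hpos i).le
        (sub_nonneg.2 (hinner a ⟨_, hl a, rfl⟩ i))] at h1
      intro i
      have := (mul_eq_zero.1 (h1 i (mem_univ i))).resolve_left (hpos i).ne'
      linarith
    obtain ⟨c, hc, hc0⟩ : ∃ c : ι → ℝ, f a c = 0 ∧ c ≠ 0 := by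
      have hker := LinearMap.ker_ne_bot_of_finrank_lt
        (f := Fintype.linearCombination ℝ fun i => v i (a i))
        (by rwa [finrank_fintype_fun_eq_card])
      obtain ⟨c, hc, hc0⟩ := Submodule.exists_mem_ne_zero_of_ne_bot hker
      exact ⟨c, by simpa [Fintype.linearCombination_apply] using hc, hc0⟩
    have hcsum : ∑ i, c i = 0 := by
      have h1 : ⟪p, f a c⟫ = 0 := by rw [hc, inner_zero_right]
      simp only [f, inner_sum, inner_smul_right, heq, ← sum_mul] at h1
      exact (mul_eq_zero.1 h1).resolve_right (by simpa using hp0)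
    obtain ⟨k, hk⟩ : ∃ k, c k < 0 := by
      by_contra! h
      rw [sum_eq_zero_iff_of_nonneg fun i _ => h i] at hcsum
      exact hc0 (funext fun i => hcsum i (mem_univ i))
    obtain ⟨t, ht, i, -, hi⟩ := exists_add_smul_boundary (hl a).1 hk
    refine hcon (l a + t • c) ⟨ht, ?_⟩ ?_ i hi
    · simp [sum_add_distrib, ← mul_sum, hcsum, (hl a).2]
    · have := sum_add_smul_smul (l a) c t fun i => v i (a i)
      simp only [f] at hc hp ⊢
      rw [this, hc, smul_zero, add_zero]
  obtain ⟨l', hl', hfl', i, hi⟩ := hface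
  obtain ⟨j, hj⟩ : ∃ j, ⟪p, v i j⟫ ≤ 0 := by
    by_contra! h
    have : 0 < ∑ j, ⟪p, v i j⟫ := sum_pos (fun j _ => h j) univ_nonempty
    rw [← inner_sum, hsum, inner_zero_right] at this
    exact this.false
  have hmem : p ∈ f (Function.update a i j) '' stdSimplex ℝ ι := by
    refine ⟨l', hl', ?_⟩
    rw [← hfl']
    refine sum_congr rfl fun k _ => ?_
    by_cases hk : k = i
    · simp [hk, hi]
    · rw [Function.update_of_ne hk]
  have := hinner _ hmem i
  rw [Function.update_self] at this
  have : 0 < ‖p‖ ^ 2 := by positivity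
  linarith

end Colorful

section Words

/-- All words of length `n` over `Fin 3`. -/
def words : ℕ → List (List (Fin 3))
  | 0 => [[]]
  | n + 1 => (words n).flatMap fun w => [0 :: w, 1 :: w, 2 :: w]

lemma ofFn_mem_words : ∀ (n : ℕ) (a : Fin n → Fin 3), List.ofFn a ∈ words n
  | 0, a => by simp [words]
  | n + 1, a => by
    rw [words, List.ofFn_succ, List.mem_flatMap]
    refine ⟨_, ofFn_mem_words n fun i => a i.succ, ?_⟩
    generalize a 0 = x
    fin_cases x <;> simp

/-- The letters `0`, `1`, `2` appear in `w` for the first time in this order. -/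
def startsInOrder : List (Fin 3) → Bool
  | 0 :: w => w.find? (· != 0) == some 1
  | _ => false

/-- Words of length seven encoding the partitions of seven points into three parts with at most
three points each. -/
def partitionWords : List (List (Fin 3)) :=
  (words 7).filter fun w =>
    startsInOrder w && (w.count 0 ≤ 3 && (w.count 1 ≤ 3 && w.count 2 ≤ 3))

/-- The places of the letter `k` in `w`, as the binary digits of a number. -/
def places (k : Fin 3) (w : List (Fin 3)) : ℕ :=
  w.foldr (fun x n => Nat.bit (x == k) n) 0

/-- No place carries the letter `k` in `w` and the letter `l` in `m`. -/
def placesDisjoint (w m : List (Fin 3)) (k l : Fin 3) : Bool :=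
  Nat.beq (Nat.land (places k w) (places l m)) 0

/-- The parity of the number of permutations of the letters of `w` for which the result differs
from `m` in every place. -/
def avoidParity (w m : List (Fin 3)) : Bool :=
  (placesDisjoint w m 0 0 && (placesDisjoint w m 1 1 && placesDisjoint w m 2 2)) ^^
  ((placesDisjoint w m 0 1 && (placesDisjoint w m 1 2 && placesDisjoint w m 2 0)) ^^
  ((placesDisjoint w m 0 2 && (placesDisjoint w m 1 0 && placesDisjoint w m 2 1)) ^^
  ((placesDisjoint w m 0 0 && (placesDisjoint w m 1 2 && placesDisjoint w m 2 1)) ^^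
  ((placesDisjoint w m 0 1 && (placesDisjoint w m 1 0 && placesDisjoint w m 2 2)) ^^
   (placesDisjoint w m 0 2 && (placesDisjoint w m 1 1 && placesDisjoint w m 2 0))))))

/-- The parities `avoidParity w m` for `m` in a list, as the binary digits of a number. -/
def parityCode (ms : List (List (Fin 3))) (w : List (Fin 3)) : ℕ :=
  ms.foldr (fun m n => Nat.bit (avoidParity w m) n) 0

lemma placesDisjoint_ofFn : ∀ {n : ℕ} (a m : Fin n → Fin 3) (k l : Fin 3),
    placesDisjoint (List.ofFn a) (List.ofFn m) k l = true ↔ ∀ i, a i = k → m i ≠ l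
  | 0, a, m, k, l => by simp [placesDisjoint, places]
  | n + 1, a, m, k, l => by
    have ih := placesDisjoint_ofFn (fun i => a i.succ) (fun i => m i.succ) k l
    have hland : ∀ x y : ℕ, Nat.land x y = x &&& y := fun _ _ => rfl
    simp only [placesDisjoint, places, List.ofFn_succ, List.foldr_cons, Nat.beq_eq,
      hland, Nat.land_bit, Nat.bit_eq_zero_iff] at ih ⊢
    rw [ih, Fin.forall_fin_succ, and_comm]
    simp

lemma avoidParity_ofFn {n : ℕ} (a m : Fin n → Fin 3) :
    (∑ σ : Equiv.Perm (Fin 3), if ∀ i, σ (a i) ≠ m i then (1 : ZMod 2) else 0) =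
      if avoidParity (List.ofFn a) (List.ofFn m) then 1 else 0 := by
  have key : ∀ d : Fin 3 → Fin 3 → Bool,
      (∑ σ : Equiv.Perm (Fin 3), if ∀ k, d k (σ k) = true then (1 : ZMod 2) else 0) =
      if ((d 0 0 && (d 1 1 && d 2 2)) ^^ ((d 0 1 && (d 1 2 && d 2 0)) ^^
        ((d 0 2 && (d 1 0 && d 2 1)) ^^ ((d 0 0 && (d 1 2 && d 2 1)) ^^
        ((d 0 1 && (d 1 0 && d 2 2)) ^^ (d 0 2 && (d 1 1 && d 2 0))))))) then 1 else 0 := by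
    decide +kernel
  rw [avoidParity, ← key]
  refine sum_congr rfl fun σ _ => ?_
  simp only [placesDisjoint_ofFn]
  congr 1
  refine propext ⟨fun h k i hi => hi ▸ (h i).symm, fun h i => (h _ i rfl).symm⟩

lemma parityCode_eq_of_forall {ms : List (List (Fin 3))} {w w' : List (Fin 3)}
    (h : ∀ m ∈ ms, avoidParity w m = avoidParity w' m) : parityCode ms w = parityCode ms w' := by
  induction ms with
  | nil => rfl
  | cons m ms ih =>
    simp only [parityCode, List.foldr_cons] at ih ⊢
    rw [h m (by simp), ih fun m hm => h m (by simp [hm])]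

lemma xor_parityCode {ms : List (List (Fin 3))} {w w' w'' : List (Fin 3)}
    (h : ∀ m ∈ ms, (avoidParity w m != avoidParity w' m) = avoidParity w'' m) :
    parityCode ms w ^^^ parityCode ms w' = parityCode ms w'' := by
  induction ms with
  | nil => simp [parityCode]
  | cons m ms ih =>
    simp only [parityCode, List.foldr_cons] at ih ⊢
    rw [Nat.xor_bit, h m (by simp), ih fun m hm => h m (by simp [hm])]

lemma exists_startsInOrder_map {w : List (Fin 3)} (hw : ∀ k, k ∈ w) :
    ∃ σ : Equiv.Perm (Fin 3), startsInOrder (w.map σ) = true := by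
  obtain _ | ⟨x, t⟩ := w
  · simpa using hw 0
  obtain ⟨y, hy⟩ : ∃ y, t.find? (· != x) = some y := by
    rw [← Option.isSome_iff_exists, List.find?_isSome]
    obtain ⟨z, hz⟩ := exists_ne x
    exact ⟨z, (List.mem_cons.1 (hw z)).resolve_left hz, by simpa using hz⟩
  have hyx : y ≠ x := by simpa using List.find?_some hy
  obtain ⟨σ, hx, hσ⟩ : ∃ σ : Equiv.Perm (Fin 3), σ x = 0 ∧ σ y = 1 := by
    clear hy hw
    revert x y
    decide
  refine ⟨σ, ?_⟩
  have hp : (fun z : Fin 3 => z != 0) ∘ σ = (· != x) := by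
    funext z
    rw [Function.comp_apply, ← hx, Bool.eq_iff_iff]
    simp
  rw [List.map_cons, hx, startsInOrder, List.find?_map, hp, hy, Option.map_some, hσ]
  rfl

lemma eq_one_of_startsInOrder_map {w : List (Fin 3)} {τ : Equiv.Perm (Fin 3)}
    (hw : startsInOrder w = true) (hτ : startsInOrder (w.map τ) = true) : τ = 1 := by
  have hhead : ∀ {x t}, startsInOrder (x :: t) = true → x = 0 ∧ t.find? (· != 0) = some 1 := by
    intro x t h
    fin_cases x
    · exact ⟨rfl, by simpa [startsInOrder] using h⟩
    all_goals simp [startsInOrder] at h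
  obtain _ | ⟨x, t⟩ := w
  · simp [startsInOrder] at hw
  rw [List.map_cons] at hτ
  obtain ⟨rfl, ht⟩ := hhead hw
  obtain ⟨h0, ht'⟩ := hhead hτ
  have hp : (fun z : Fin 3 => z != 0) ∘ τ = (· != 0) := by
    funext z
    rw [Function.comp_apply, Bool.eq_iff_iff, bne_iff_ne, bne_iff_ne, Ne, Ne, ← h0,
      τ.injective.eq_iff, h0]
  rw [List.find?_map, hp, ht, Option.map_some, Option.some_inj] at ht'
  clear hτ hp hw ht
  revert τ
  decide

lemma count_ofFn {n : ℕ} (a : Fin n → Fin 3) (k : Fin 3) :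
    (List.ofFn a).count k = (univ.filter fun i => a i = k).card := by
  rw [← Multiset.coe_count, List.ofFn_eq_map, ← Multiset.map_coe, Multiset.count_map,
    card_def, filter_val]
  simp only [eq_comm]
  rfl

lemma ofFn_mem_partitionWords {a : Fin 7 → Fin 3} (ha : startsInOrder (List.ofFn a) = true)
    (hcard : ∀ k, (univ.filter fun i => a i = k).card ≤ 3) : List.ofFn a ∈ partitionWords := by
  rw [partitionWords, List.mem_filter]
  refine ⟨ofFn_mem_words 7 a, ?_⟩
  simp only [count_ofFn, ha, hcard]
  rfl

/-- Summing over a family of surjective words closed under permutations of the letters. -/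
lemma sum_eq_sum_startsInOrder {n : ℕ} {M : Type*} [AddCommMonoid M] (S : Finset (Fin n → Fin 3))
    (hS : ∀ (σ : Equiv.Perm (Fin 3)), ∀ a ∈ S, σ ∘ a ∈ S)
    (hsurj : ∀ a ∈ S, Function.Surjective a) (f : (Fin n → Fin 3) → M) :
    ∑ a ∈ S, f a = ∑ r ∈ S.filter fun a => startsInOrder (List.ofFn a) = true,
      ∑ σ : Equiv.Perm (Fin 3), f (σ ∘ r) := by
  rw [← sum_product']
  symm
  refine sum_bij (fun p _ => p.2 ∘ p.1) ?_ ?_ ?_ fun _ _ => rfl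
  · rintro ⟨r, σ⟩ h
    exact hS σ r (mem_filter.1 (mem_product.1 h).1).1
  · rintro ⟨r, σ⟩ h ⟨r', σ'⟩ h' heq
    have hr := (mem_filter.1 (mem_product.1 h).1).2
    have hr' := (mem_filter.1 (mem_product.1 h').1).2
    have hrr : r' = (σ'⁻¹ * σ : Equiv.Perm (Fin 3)) ∘ r := by
      funext i
      have := congrFun heq i
      simp only [Function.comp_apply] at this
      simp [this]
    have hone : σ'⁻¹ * σ = 1 := by
      refine eq_one_of_startsInOrder_map hr ?_
      rwa [List.map_ofFn, ← hrr]
    rw [hone] at hrr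
    rw [inv_mul_eq_one] at hone
    simp [hrr, hone]
  · intro a ha
    obtain ⟨σ, hσ⟩ := exists_startsInOrder_map (w := List.ofFn a) fun k => by
      rw [List.mem_ofFn]
      exact hsurj a ha k
    rw [List.map_ofFn] at hσ
    refine ⟨(σ ∘ a, σ⁻¹), ?_, ?_⟩
    · simp [hS σ a ha, hσ]
    · funext i
      simp

lemma four_le_card_of_parity {Q : Finset (Fin 7 → Fin 3)} {p : Fin 7 → Fin 3} (hp : p ∈ Q)
    (hQ : ∀ a ∈ Q, List.ofFn a ∈ partitionWords)
    (hpar : ∀ m : Fin 7 → Fin 3,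
      ∑ a ∈ Q, (if avoidParity (List.ofFn a) (List.ofFn m) then (1 : ZMod 2) else 0) = 0)
    {m₁ w : List (Fin 3)} {ms : List (List (Fin 3))} {exc : List (List (Fin 3) × List (Fin 3))}
    (hw : List.ofFn p = w) (hlen : ∀ m ∈ ms, m.length = 7) (hm₁ : m₁ ∈ ms)
    (hbase : avoidParity w m₁ = true)
    (hone : (partitionWords.all fun r => !Nat.beq (parityCode ms w) (parityCode ms r) || r == w) =
      true)
    (htwo : (partitionWords.all fun r => !avoidParity r m₁ || partitionWords.all fun r' =>
      !Nat.beq (Nat.xor (parityCode ms w) (parityCode ms r)) (parityCode ms r') ||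
        (r == w || (r' == w || exc.contains (r, r')))) = true)
    (hexc : ∀ r ∈ Q, ∀ r' ∈ Q, (List.ofFn r, List.ofFn r') ∉ exc) : 4 ≤ Q.card := by
  replace hpar : ∀ m ∈ ms,
      ∑ a ∈ Q, (if avoidParity (List.ofFn a) m then (1 : ZMod 2) else 0) = 0 := by
    intro m hm
    obtain ⟨f, rfl⟩ : ∃ f : Fin 7 → Fin 3, List.ofFn f = m := by
      rw [← hlen m hm]
      exact ⟨m.get, List.ofFn_get m⟩
    exact hpar f
  have hnew : ∀ r ∈ Q.erase p, List.ofFn r ≠ w := fun r hr h =>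
    ne_of_mem_erase hr (List.ofFn_injective (h.trans hw.symm))
  have hsplit : ∀ m ∈ ms, (if avoidParity w m then (1 : ZMod 2) else 0) +
      ∑ a ∈ Q.erase p, (if avoidParity (List.ofFn a) m then (1 : ZMod 2) else 0) = 0 := by
    intro m hm
    have := hpar m hm
    rwa [← add_sum_erase _ _ hp, hw] at this
  by_contra! hlt
  have hle : (Q.erase p).card ≤ 2 := by
    rw [card_erase_of_mem hp]
    omega
  rcases Nat.lt_or_ge (Q.erase p).card 2 with h2 | h2
  · rcases Nat.lt_or_ge (Q.erase p).card 1 with h1 | h1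
    · have := hsplit m₁ hm₁
      rw [card_eq_zero.1 (Nat.lt_one_iff.1 h1)] at this
      simp [hbase] at this
    · obtain ⟨r, hr⟩ := card_eq_one.1 (le_antisymm (Nat.lt_succ_iff.1 h2) h1)
      have hrm : r ∈ Q.erase p := by simp [hr]
      have hcode : parityCode ms w = parityCode ms (List.ofFn r) :=
        parityCode_eq_of_forall fun m hm => by
          have := hsplit m hm
          rw [hr, sum_singleton] at this
          revert this
          cases avoidParity w m <;> cases avoidParity (List.ofFn r) m <;> decide
      have := List.all_eq_true.1 hone _ (hQ r (mem_of_mem_erase hrm))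
      rw [hcode] at this
      exact hnew r hrm (by simpa using this)
  · obtain ⟨r, r', hne, hr⟩ := card_eq_two.1 (le_antisymm hle h2)
    have key : ∀ r r', r ≠ r' → Q.erase p = {r, r'} →
        avoidParity (List.ofFn r) m₁ = true → False := by
      intro r r' hne hr htrue
      have hrm : r ∈ Q.erase p := by simp [hr]
      have hrm' : r' ∈ Q.erase p := by simp [hr]
      have hcode : Nat.xor (parityCode ms w) (parityCode ms (List.ofFn r)) =
          parityCode ms (List.ofFn r') :=
        xor_parityCode fun m hm => by
          have := hsplit m hm
          rw [hr, sum_pair hne] at this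
          revert this
          cases avoidParity w m <;> cases avoidParity (List.ofFn r) m <;>
            cases avoidParity (List.ofFn r') m <;> decide
      have h3 := List.all_eq_true.1 htwo _ (hQ r (mem_of_mem_erase hrm))
      rw [htrue, Bool.not_true, Bool.false_or] at h3
      have h4 := List.all_eq_true.1 h3 _ (hQ r' (mem_of_mem_erase hrm'))
      rw [hcode] at h4
      simp only [Nat.beq_refl, Bool.not_true, Bool.false_or, Bool.or_eq_true, beq_iff_eq,
        hnew r hrm, hnew r' hrm', false_or, List.contains_iff_mem] at h4
      exact hexc r (mem_of_mem_erase hrm) r' (mem_of_mem_erase hrm') h4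
    have := hsplit m₁ hm₁
    rw [hr, sum_pair hne, hbase] at this
    by_cases htrue : avoidParity (List.ofFn r) m₁ = true
    · exact key r r' hne hr htrue
    · refine key r' r hne.symm (by rw [hr, pair_comm]) ?_
      revert this htrue
      cases avoidParity (List.ofFn r) m₁ <;> cases avoidParity (List.ofFn r') m₁ <;> decide

/-- Closure properties of the family of Tverberg partitions of seven points in general position in
the plane, the parts of each partition being labeled by `Fin 3`. -/
structure IsTverbergFamily (S : Finset (Fin 7 → Fin 3)) : Prop where
  comp_mem : ∀ (σ : Equiv.Perm (Fin 3)), ∀ a ∈ S, σ ∘ a ∈ S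
  card_fiber_le : ∀ a ∈ S, ∀ k, (univ.filter fun i => a i = k).card ≤ 3
  card_avoiding : ∀ m : Fin 7 → Fin 3,
    ((S.filter fun a => ∀ i, a i ≠ m i).card : ZMod 2) = 0
  exists_update_notMem : ∀ a i, ∃ k, Function.update a i k ∉ S

namespace IsTverbergFamily

variable {S : Finset (Fin 7 → Fin 3)}

lemma surjective (hS : IsTverbergFamily S) {a : Fin 7 → Fin 3} (ha : a ∈ S) :
    Function.Surjective a := by
  intro k
  by_contra! h
  have h7 : ∑ j, (univ.filter fun i => a i = j).card = 7 := by
    rw [← card_eq_sum_card_fiberwise fun i _ => mem_univ (a i)]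
    simp
  rw [← add_sum_erase _ _ (mem_univ k), filter_false_of_mem fun i _ => h i, card_empty] at h7
  have := sum_le_card_nsmul (univ.erase k) _ 3 fun j _ => hS.card_fiber_le a ha j
  rw [card_erase_of_mem (mem_univ k), card_univ, Fintype.card_fin, smul_eq_mul] at this
  omega

lemma card_eq (hS : IsTverbergFamily S) :
    S.card = 6 * (S.filter fun a => startsInOrder (List.ofFn a) = true).card := by
  rw [card_eq_sum_ones, sum_eq_sum_startsInOrder S hS.comp_mem fun a => hS.surjective]
  simp [Fintype.card_perm, Nat.factorial, mul_comm]

lemma sum_avoidParity (hS : IsTverbergFamily S) (m : Fin 7 → Fin 3) :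
    ∑ a ∈ S.filter fun a => startsInOrder (List.ofFn a) = true,
      (if avoidParity (List.ofFn a) (List.ofFn m) then (1 : ZMod 2) else 0) = 0 := by
  have := hS.card_avoiding m
  rw [← sum_boole, sum_eq_sum_startsInOrder S hS.comp_mem fun a => hS.surjective] at this
  exact (sum_congr rfl fun a _ => (avoidParity_ofFn a m).symm).trans this

set_option maxRecDepth 100000 in
lemma four_le_of_three_two_two_mem (hS : IsTverbergFamily S) (hp : ![0, 0, 0, 1, 1, 2, 2] ∈ S) :
    4 ≤ (S.filter fun a => startsInOrder (List.ofFn a) = true).card := by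
  refine four_le_card_of_parity (p := ![0, 0, 0, 1, 1, 2, 2]) (w := [0, 0, 0, 1, 1, 2, 2])
    (m₁ := [0, 0, 0, 1, 1, 1, 0])
    (ms := [[0, 0, 0, 1, 1, 1, 0], [0, 0, 1, 0, 0, 2, 2], [0, 0, 1, 1, 1, 0, 0],
      [0, 0, 0, 1, 0, 2, 2], [0, 0, 0, 1, 1, 0, 1], [0, 1, 2, 0, 0, 2, 2],
      [0, 0, 1, 2, 1, 2, 2], [0, 1, 1, 1, 2, 2, 2], [0, 0, 1, 2, 0, 1, 1]])
    (exc := [([0, 0, 1, 2, 2, 1, 1], [0, 0, 1, 1, 1, 2, 2]),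
      ([0, 1, 0, 2, 2, 1, 1], [0, 1, 0, 1, 1, 2, 2]),
      ([0, 1, 1, 2, 2, 0, 0], [0, 1, 1, 0, 0, 2, 2])])
    (mem_filter.2 ⟨hp, by decide⟩)
    (fun a ha => ofFn_mem_partitionWords (mem_filter.1 ha).2
      (hS.card_fiber_le a (mem_filter.1 ha).1))
    hS.sum_avoidParity (by decide) (by decide) (by decide) (by decide +kernel)
    (by decide +kernel) (by decide +kernel) ?_
  have hline : ∀ (i : Fin 7) (r r' : Fin 7 → Fin 3) (σ σ' : Equiv.Perm (Fin 3)),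
      Function.update ![0, 0, 0, 1, 1, 2, 2] i 0 = (![0, 0, 0, 1, 1, 2, 2] : Fin 7 → Fin 3) →
      σ ∘ r = Function.update ![0, 0, 0, 1, 1, 2, 2] i 2 →
      σ' ∘ r' = Function.update ![0, 0, 0, 1, 1, 2, 2] i 1 → r ∈ S → r' ∈ S → False := by
    intro i r r' σ σ' h0 hr hr' hrS hrS'
    obtain ⟨k, hk⟩ := hS.exists_update_notMem ![0, 0, 0, 1, 1, 2, 2] i
    apply hk
    fin_cases k
    · exact h0.symm ▸ hp
    · exact hr' ▸ hS.comp_mem σ' _ hrS'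
    · exact hr ▸ hS.comp_mem σ _ hrS
  have hofFn : ∀ {r : Fin 7 → Fin 3} (w : Fin 7 → Fin 3), List.ofFn r = List.ofFn w → r = w :=
    fun w h => List.ofFn_injective h
  intro r hr r' hr' hmem
  replace hr := (mem_filter.1 hr).1
  replace hr' := (mem_filter.1 hr').1
  simp only [List.mem_cons, Prod.mk.injEq, List.not_mem_nil, or_false] at hmem
  obtain ⟨h, h'⟩ | ⟨h, h'⟩ | ⟨h, h'⟩ := hmem
  · refine hline 2 r r' (Equiv.swap 1 2) 1 (by decide) ?_ ?_ hr hr'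
    · rw [hofFn ![0, 0, 1, 2, 2, 1, 1] h]
      decide
    · rw [hofFn ![0, 0, 1, 1, 1, 2, 2] h']
      decide
  · refine hline 1 r r' (Equiv.swap 1 2) 1 (by decide) ?_ ?_ hr hr'
    · rw [hofFn ![0, 1, 0, 2, 2, 1, 1] h]
      decide
    · rw [hofFn ![0, 1, 0, 1, 1, 2, 2] h']
      decide
  · refine hline 0 r r' (finRotate 3).symm (Equiv.swap 0 1) (by decide) ?_ ?_ hr hr'
    · rw [hofFn ![0, 1, 1, 2, 2, 0, 0] h]
      decide
    · rw [hofFn ![0, 1, 1, 0, 0, 2, 2] h']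
      decide

set_option maxRecDepth 100000 in
lemma four_le_of_three_three_one_mem (hS : IsTverbergFamily S) (hp : ![0, 0, 0, 1, 1, 1, 2] ∈ S) :
    4 ≤ (S.filter fun a => startsInOrder (List.ofFn a) = true).card :=
  four_le_card_of_parity (p := ![0, 0, 0, 1, 1, 1, 2]) (w := [0, 0, 0, 1, 1, 1, 2])
    (m₁ := [0, 0, 0, 0, 1, 0, 2])
    (ms := [[0, 0, 0, 0, 1, 0, 2], [0, 1, 1, 0, 0, 0, 1], [0, 1, 1, 2, 1, 1, 2],
      [0, 0, 0, 0, 1, 1, 1], [0, 0, 0, 1, 0, 1, 1], [0, 1, 1, 1, 0, 2, 0],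
      [0, 0, 0, 1, 1, 2, 0]])
    (exc := [])
    (mem_filter.2 ⟨hp, by decide⟩)
    (fun a ha => ofFn_mem_partitionWords (mem_filter.1 ha).2
      (hS.card_fiber_le a (mem_filter.1 ha).1))
    hS.sum_avoidParity (by decide) (by decide) (by decide) (by decide +kernel)
    (by decide +kernel) (by decide +kernel) (by simp)

lemma permute (hS : IsTverbergFamily S) (e : Equiv.Perm (Fin 7)) :
    IsTverbergFamily (univ.filter fun a => a ∘ e ∈ S) where
  comp_mem σ a ha := by
    simp only [mem_filter, mem_univ, true_and] at ha ⊢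
    exact hS.comp_mem σ _ ha
  card_fiber_le a ha k := by
    simp only [mem_filter, mem_univ, true_and] at ha
    rw [← card_equiv (s := univ.filter fun i => (a ∘ e) i = k) e (by simp)]
    exact hS.card_fiber_le _ ha k
  card_avoiding m := by
    rw [← hS.card_avoiding (m ∘ e), card_equiv (e.arrowCongr (Equiv.refl (Fin 3))).symm]
    intro a
    simp only [mem_filter, mem_univ, true_and]
    refine and_congr Iff.rfl (e.forall_congr_right (q := fun i => a i ≠ m i)).symm
  exists_update_notMem a i := by
    obtain ⟨k, hk⟩ := hS.exists_update_notMem (a ∘ e) (e.symm i)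
    refine ⟨k, ?_⟩
    simpa [Function.update_comp_equiv] using hk

lemma card_permute (e : Equiv.Perm (Fin 7)) :
    (univ.filter fun a => a ∘ e ∈ S).card = S.card := by
  refine card_equiv (e.arrowCongr (Equiv.refl (Fin 3))).symm fun a => ?_
  simp only [mem_filter, mem_univ, true_and]
  rfl

lemma exists_perm_of_sum_eq_seven {c : Fin 3 → ℕ} (hc : ∀ k, c k ≤ 3) (hsum : ∑ k, c k = 7) :
    ∃ σ : Equiv.Perm (Fin 3), c ∘ σ = ![3, 2, 2] ∨ c ∘ σ = ![3, 3, 1] := by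
  have key : ∀ c : Fin 3 → Fin 4, ∑ k, (c k : ℕ) = 7 → ∃ σ : Equiv.Perm (Fin 3),
      (∀ k, (c (σ k) : ℕ) = ![3, 2, 2] k) ∨ ∀ k, (c (σ k) : ℕ) = ![3, 3, 1] k := by
    decide +kernel
  obtain ⟨σ, h | h⟩ := key (fun k => ⟨c k, Nat.lt_succ_of_le (hc k)⟩) hsum
  exacts [⟨σ, .inl (funext h)⟩, ⟨σ, .inr (funext h)⟩]

lemma exists_comp_eq_of_card_fiber_eq {α β : Type*} [Fintype α] [DecidableEq β] {a p : α → β}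
    (h : ∀ k, (univ.filter fun i => a i = k).card = (univ.filter fun i => p i = k).card) :
    ∃ e : Equiv.Perm α, p ∘ e = a := by
  refine ⟨Equiv.ofFiberEquiv (f := a) (g := p) fun k => Fintype.equivOfCardEq ?_,
    funext fun i => Equiv.ofFiberEquiv_map _ i⟩
  rw [Fintype.card_subtype, Fintype.card_subtype, h]

theorem card_ge (hS : IsTverbergFamily S) (hne : S.Nonempty) : 24 ≤ S.card := by
  obtain ⟨a, ha⟩ := hne
  have hsum : ∑ j, (univ.filter fun i => a i = j).card = 7 := by
    rw [← card_eq_sum_card_fiberwise fun i _ => mem_univ (a i)]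
    simp
  obtain ⟨σ, hσ⟩ := exists_perm_of_sum_eq_seven (hS.card_fiber_le a ha) hsum
  have hfib : ∀ k, (univ.filter fun i => (σ.symm ∘ a) i = k).card =
      ((fun j => (univ.filter fun i => a i = j).card) ∘ σ) k := fun k => by
    simp only [Function.comp_apply, Equiv.symm_apply_eq]
  have hmem : ∀ p : Fin 7 → Fin 3, (∀ k, (univ.filter fun i => (σ.symm ∘ a) i = k).card =
      (univ.filter fun i => p i = k).card) →
      ∃ e : Equiv.Perm (Fin 7), p ∈ univ.filter fun a => a ∘ e ∈ S := by
    intro p hp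
    obtain ⟨e, he⟩ := exists_comp_eq_of_card_fiber_eq hp
    refine ⟨e, ?_⟩
    rw [mem_filter, he]
    exact ⟨mem_univ _, hS.comp_mem _ _ ha⟩
  rcases hσ with hσ | hσ
  · obtain ⟨e, he⟩ := hmem ![0, 0, 0, 1, 1, 2, 2] fun k => by
      rw [hfib, hσ]
      revert k
      decide
    have := (hS.permute e).card_eq
    have := (hS.permute e).four_le_of_three_two_two_mem he
    have := card_permute (S := S) e
    omega
  · obtain ⟨e, he⟩ := hmem ![0, 0, 0, 1, 1, 1, 2] fun k => by
      rw [hfib, hσ]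
      revert k
      decide
    have := (hS.permute e).card_eq
    have := (hS.permute e).four_le_of_three_three_one_mem he
    have := card_permute (S := S) e
    omega

end IsTverbergFamily

end Words

section Plane

open Matrix

/-- Homogeneous coordinates of a point of the plane. -/
def homog {R : Type*} [One R] (p : Fin 2 → R) : Fin 3 → R := ![p 0, p 1, 1]

section Generic

variable {ι : Type*} {x : ι → EuclideanSpace ℝ (Fin 2)}

lemma aeval_ne_zero_of_eval_ne_zero {σ : Type*} {y : σ → ℝ} (h : AlgebraicIndependent ℚ y)
    {p : MvPolynomial σ ℚ} {t : σ → ℚ} (ht : MvPolynomial.eval t p ≠ 0) :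
    MvPolynomial.aeval y p ≠ 0 := by
  intro h0
  rw [h.eq_zero_of_aeval_eq_zero p h0, map_zero] at ht
  exact ht rfl

lemma det_homog_ne_zero
    (hx : AlgebraicIndependent ℚ fun p : ι × Fin 2 => x p.1 p.2) {s : Fin 3 → ι}
    (hs : Function.Injective s) : (Matrix.of fun c => homog (x (s c))).det ≠ 0 := by
  let u : Fin 3 → Fin 2 → ℚ := ![![0, 0], ![1, 0], ![0, 1]]
  have h := aeval_ne_zero_of_eval_ne_zero hx
    (p := (Matrix.of fun c => homog fun k => MvPolynomial.X (s c, k)).det)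
    (t := fun q => Function.extend s u 0 q.1 q.2)
    (by simp [Matrix.det_fin_three, homog, hs.extend_apply, u])
  simpa [Matrix.det_fin_three, homog] using h

lemma det_cross_homog_ne_zero
    (hx : AlgebraicIndependent ℚ fun p : ι × Fin 2 => x p.1 p.2) {s : Fin 3 × Fin 2 → ι}
    (hs : Function.Injective s) :
    (Matrix.of fun j => homog (x (s (j, 0))) ⨯₃ homog (x (s (j, 1)))).det ≠ 0 := by
  let u : Fin 3 × Fin 2 → Fin 2 → ℚ := fun q =>
    (![![![0, 0], ![1, 0]], ![![0, 0], ![0, 1]], ![![1, 0], ![0, 1]]] :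
      Fin 3 → Fin 2 → Fin 2 → ℚ) q.1 q.2
  have h := aeval_ne_zero_of_eval_ne_zero hx
    (p := (Matrix.of fun j => (homog fun k => MvPolynomial.X (s (j, 0), k)) ⨯₃
      (homog fun k => MvPolynomial.X (s (j, 1), k))).det)
    (t := fun q => Function.extend s u 0 q.1 q.2)
    (by simp [Matrix.det_fin_three, homog, cross_apply, hs.extend_apply, u])
  simpa [Matrix.det_fin_three, homog, cross_apply] using h

lemma eq_zero_of_card_support_le [Fintype ι]
    (hx : AlgebraicIndependent ℚ fun p : ι × Fin 2 => x p.1 p.2) (hι : 3 ≤ Fintype.card ι)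
    {μ : ι → ℝ} (hμ : ∑ i, μ i • homog (x i) = 0)
    (hcard : (univ.filter fun i => μ i ≠ 0).card ≤ 3) : μ = 0 := by
  obtain ⟨t, hst, ht⟩ := exists_superset_card_eq hcard hι
  have hzero : ∀ i, i ∉ t → μ i = 0 := fun i hi => by
    by_contra h
    exact hi (hst (by simpa using h))
  let e := (t.equivFinOfCardEq ht).symm
  have hsum : ∑ c, μ (e c) • homog (x (e c)) = 0 := by
    rw [e.sum_comp (fun i : t => μ i • homog (x i)),
      sum_coe_sort t fun i => μ i • homog (x i), ← hμ]
    refine sum_subset (subset_univ t) fun i _ hi => ?_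
    rw [hzero i hi, zero_smul]
  have he : (fun c => μ (e c)) = 0 := by
    by_contra hne
    refine det_homog_ne_zero hx (s := fun c => (e c : ι))
      (Subtype.val_injective.comp e.injective) (Matrix.exists_vecMul_eq_zero_iff.1 ⟨_, hne, ?_⟩)
    rw [Matrix.vecMul_eq_sum]
    exact hsum
  funext i
  by_cases hi : i ∈ t
  · simpa using congrFun he (e.symm ⟨i, hi⟩)
  · exact hzero i hi

end Generic

/-- The vectors of Sarkaria's construction: a relation between the vectors `sarkaria p j`, each
for one point `p` with label `j`, is a relation by which the sums of the points with the same label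
agree. -/
noncomputable def sarkaria (p : EuclideanSpace ℝ (Fin 2)) (j : Fin 3) :
    EuclideanSpace ℝ (Fin 2 × Fin 3) :=
  WithLp.toLp 2 fun q =>
    ((if j = q.1.castSucc then 1 else 0) - (if j = 2 then 1 else 0)) * homog p q.2

lemma sum_sarkaria (p : EuclideanSpace ℝ (Fin 2)) : ∑ j, sarkaria p j = 0 := by
  ext ⟨k, c⟩
  simp only [sarkaria, WithLp.ofLp_sum, Finset.sum_apply, ← sum_mul, sum_sub_distrib,
    sum_ite_eq', mem_univ, if_true, sub_self, zero_mul]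
  rfl

variable {ι : Type*} [Fintype ι] {x : ι → EuclideanSpace ℝ (Fin 2)} {a : ι → Fin 3} {l : ι → ℝ}

/-- The weighted sum of the points with label `j`, in homogeneous coordinates. -/
def labelSum (x : ι → EuclideanSpace ℝ (Fin 2)) (a : ι → Fin 3) (l : ι → ℝ) (j : Fin 3) :
    Fin 3 → ℝ :=
  ∑ i with a i = j, l i • homog (x i)

lemma labelSum_two (j : Fin 3) : labelSum x a l j 2 = ∑ i with a i = j, l i := by
  simp [labelSum, homog, Finset.sum_apply]

lemma sum_smul_sarkaria_eq_zero_iff :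
    ∑ i, l i • sarkaria (x i) (a i) = 0 ↔ ∀ j j', labelSum x a l j = labelSum x a l j' := by
  have hcoord : ∀ (k : Fin 2) (c : Fin 3), (∑ i, l i • sarkaria (x i) (a i)) (k, c) =
      labelSum x a l k.castSucc c - labelSum x a l 2 c := by
    intro k c
    simp only [labelSum, sarkaria, WithLp.ofLp_sum, Finset.sum_apply, sum_filter,
      ← sum_sub_distrib]
    refine sum_congr rfl fun i _ => ?_
    simp only [PiLp.smul_apply, smul_eq_mul]
    split_ifs <;> simp
  constructor
  · intro h
    have h2 : ∀ j, labelSum x a l j = labelSum x a l 2 := by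
      refine Fin.lastCases rfl fun k => ?_
      funext c
      have := hcoord k c
      rw [h] at this
      simpa [sub_eq_zero] using this.symm
    exact fun j j' => (h2 j).trans (h2 j').symm
  · intro h
    ext ⟨k, c⟩
    rw [hcoord, h _ 2, sub_self]
    rfl

lemma eq_zero_of_labelSum_eq_zero (hl : 0 ≤ l) {j : Fin 3} (h : labelSum x a l j = 0) {i : ι}
    (hi : a i = j) : l i = 0 := by
  have h2 := labelSum_two (x := x) (a := a) (l := l) j
  rw [h, Pi.zero_apply, eq_comm, sum_eq_zero_iff_of_nonneg fun i _ => hl i] at h2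
  exact h2 i (by simpa using hi)

lemma IsBalanced.comp_perm (h : IsBalanced (fun i => sarkaria (x i)) a) (σ : Equiv.Perm (Fin 3)) :
    IsBalanced (fun i => sarkaria (x i)) (σ ∘ a) := by
  obtain ⟨l, hl, hl0, hrel⟩ := h
  refine ⟨l, hl, hl0, sum_smul_sarkaria_eq_zero_iff.2 fun j j' => ?_⟩
  have hσ : ∀ j, labelSum x (σ ∘ a) l j = labelSum x a l (σ.symm j) := fun j => by
    simp only [labelSum, Function.comp_apply, ← Equiv.eq_symm_apply]
  rw [hσ, hσ]
  exact sum_smul_sarkaria_eq_zero_iff.1 hrel _ _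

lemma four_le_card_label_ne
    (hx : AlgebraicIndependent ℚ fun p : ι × Fin 2 => x p.1 p.2) (hι : 3 ≤ Fintype.card ι)
    (h : IsNonnegRelation (fun i => sarkaria (x i) (a i)) l) (j : Fin 3) :
    4 ≤ (univ.filter fun i => a i ≠ j ∧ l i ≠ 0).card := by
  obtain ⟨hl, hl0, hrel⟩ := h
  rw [sum_smul_sarkaria_eq_zero_iff] at hrel
  by_contra! hlt
  obtain ⟨j₁, j₂, hj₁, hj₂, hne, hall⟩ :
      ∃ j₁ j₂ : Fin 3, j₁ ≠ j ∧ j₂ ≠ j ∧ j₁ ≠ j₂ ∧ ∀ k, k ≠ j → k = j₁ ∨ k = j₂ := by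
    clear hlt
    revert j
    decide
  let μ : ι → ℝ := fun i => (if a i = j₁ then l i else 0) - if a i = j₂ then l i else 0
  have hμ : μ = 0 := by
    refine eq_zero_of_card_support_le hx hι ?_ ?_
    · have := sub_eq_zero.2 (hrel j₁ j₂)
      rw [← this]
      simp only [labelSum, sum_filter, ← sum_sub_distrib, μ, sub_smul, ite_smul, zero_smul]
    · refine (card_le_card fun i => ?_).trans (Nat.lt_succ_iff.1 hlt)
      simp only [mem_filter, mem_univ, true_and, μ]
      intro hi
      constructor
      · rintro rfl
        simp [hj₁.symm, hj₂.symm] at hi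
      · intro h0
        simp [h0] at hi
  have hzero : ∀ i, a i ≠ j → l i = 0 := fun i hi => by
    have hi0 : μ i = 0 := congrFun hμ i
    rcases hall _ hi with h | h
    · simpa [μ, h, hne] using hi0
    · simpa [μ, h, hne.symm] using hi0
  have hj : labelSum x a l j = 0 := by
    rw [hrel j j₁]
    refine sum_eq_zero fun i hi => ?_
    rw [hzero i ((mem_filter.1 hi).2 ▸ hj₁), zero_smul]
  exact hl0 (funext fun i => (em (a i = j)).elim (eq_zero_of_labelSum_eq_zero hl hj) (hzero i))

lemma relation_apply_ne_zero
    (hx : AlgebraicIndependent ℚ fun p : ι × Fin 2 => x p.1 p.2) (hι : Fintype.card ι = 7)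
    (h : IsNonnegRelation (fun i => sarkaria (x i) (a i)) l) (i : ι) : l i ≠ 0 := by
  intro hi
  have hN : (univ.filter fun i => l i ≠ 0).card ≤ 6 := by
    have : (univ.filter fun i => l i ≠ 0).card < (univ : Finset ι).card :=
      card_lt_card (filter_ssubset.2 ⟨i, mem_univ i, by simpa using hi⟩)
    rw [card_univ, hι] at this
    omega
  have hsplit : ∀ j, (univ.filter fun i => l i ≠ 0 ∧ a i = j).card +
      (univ.filter fun i => a i ≠ j ∧ l i ≠ 0).card = (univ.filter fun i => l i ≠ 0).card := by
    intro j
    rw [← card_filter_add_card_filter_not (s := univ.filter fun i => l i ≠ 0) fun i => a i = j,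
      filter_filter, filter_filter]
    simp only [and_comm, ne_eq]
  have hsum : (univ.filter fun i => l i ≠ 0).card =
      ∑ j, (univ.filter fun i => l i ≠ 0 ∧ a i = j).card := by
    rw [card_eq_sum_card_fiberwise fun i _ => mem_univ (a i)]
    simp only [filter_filter]
  have htwo : ∀ j, (univ.filter fun i => l i ≠ 0 ∧ a i = j).card = 2 := by
    have h4 := four_le_card_label_ne hx (by omega) h
    rw [Fin.sum_univ_three] at hsum
    have := hsplit 0
    have := hsplit 1
    have := hsplit 2
    have := h4 0
    have := h4 1
    have := h4 2
    refine Fin.forall_fin_succ.2 ⟨by omega, Fin.forall_fin_two.2 ⟨?_, ?_⟩⟩ <;>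
      simp only [Fin.succ_zero_eq_one, Fin.succ_one_eq_two] <;> omega
  let e := fun j => ((univ.filter fun i => l i ≠ 0 ∧ a i = j).equivFinOfCardEq (htwo j)).symm
  have he : ∀ j b, l (e j b) ≠ 0 ∧ a (e j b) = j := fun j b =>
    (mem_filter.1 (e j b).2).2
  obtain ⟨hl, hl0, hrel⟩ := h
  rw [sum_smul_sarkaria_eq_zero_iff] at hrel
  have hlabel : ∀ j, labelSum x a l j =
      l (e j 0) • homog (x (e j 0)) + l (e j 1) • homog (x (e j 1)) := fun j => by
    rw [← Fin.sum_univ_two fun b => l (e j b) • homog (x (e j b)),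
      (e j).sum_comp (fun i => l i • homog (x i)),
      sum_coe_sort (univ.filter fun i => l i ≠ 0 ∧ a i = j) fun i => l i • homog (x i), labelSum]
    symm
    refine sum_subset (fun i => by simp +contextual) fun i hi hi' => ?_
    simp only [mem_filter, mem_univ, true_and] at hi hi'
    rw [not_not.1 fun h0 => hi' ⟨h0, hi⟩, zero_smul]
  refine det_cross_homog_ne_zero hx (s := fun q => (e q.1 q.2 : ι)) ?_
    (Matrix.exists_mulVec_eq_zero_iff.1 ⟨labelSum x a l 0, fun h0 => ?_, ?_⟩)
  · rintro ⟨j, b⟩ ⟨j', b'⟩ h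
    obtain rfl : j = j' := by
      rw [← (he j b).2, ← (he j' b').2]
      exact congrArg a h
    exact congrArg _ ((e j).injective (Subtype.ext h))
  · exact (he 0 0).1 (eq_zero_of_labelSum_eq_zero hl h0 (he 0 0).2)
  · funext j
    rw [hrel 0 j, hlabel j]
    simp only [Matrix.mulVec, Matrix.of_apply, dotProduct_add, dotProduct_smul, Pi.zero_apply]
    rw [dotProduct_comm, dot_self_cross, dotProduct_comm, dot_cross_self]
    simp

lemma IsBalanced.exists_pos
    (hx : AlgebraicIndependent ℚ fun p : ι × Fin 2 => x p.1 p.2) (hι : Fintype.card ι = 7)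
    (h : IsBalanced (fun i => sarkaria (x i)) a) :
    ∃ l : ι → ℝ, (∀ i, 0 < l i) ∧ IsNonnegRelation (fun i => sarkaria (x i) (a i)) l := by
  obtain ⟨l, hl⟩ := h
  exact ⟨l, fun i => lt_of_le_of_ne (hl.1 i) (relation_apply_ne_zero hx hι hl i).symm, hl⟩

lemma IsBalanced.card_label_le
    (hx : AlgebraicIndependent ℚ fun p : ι × Fin 2 => x p.1 p.2) (hι : Fintype.card ι = 7)
    (h : IsBalanced (fun i => sarkaria (x i)) a) (j : Fin 3) :
    (univ.filter fun i => a i = j).card ≤ 3 := by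
  obtain ⟨l, hpos, hl⟩ := h.exists_pos hx hι
  have h4 := four_le_card_label_ne hx (by omega) hl j
  simp only [(hpos _).ne', ne_eq, not_false_eq_true, and_true] at h4
  have := card_filter_add_card_filter_not (s := (univ : Finset ι)) fun i => a i = j
  rw [card_univ, hι] at this
  omega

open Classical in
lemma isTverbergFamily_filter_isBalanced {x : Fin 7 → EuclideanSpace ℝ (Fin 2)}
    (hx : AlgebraicIndependent ℚ fun p : Fin 7 × Fin 2 => x p.1 p.2) :
    IsTverbergFamily (univ.filter fun a => IsBalanced (fun i => sarkaria (x i)) a) where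
  comp_mem σ a ha := by
    simp only [mem_filter, mem_univ, true_and] at ha ⊢
    exact ha.comp_perm σ
  card_fiber_le a ha k := (mem_filter.1 ha).2.card_label_le hx (Fintype.card_fin 7) k
  card_avoiding m := by
    rw [filter_filter]
    convert card_balanced_avoiding (by simp)
      (fun a l hl => relation_apply_ne_zero hx (Fintype.card_fin 7) hl) m
  exists_update_notMem a i := by
    have := not_forall_isBalanced_update
      (fun a l hl => relation_apply_ne_zero hx (Fintype.card_fin 7) (a := a) (l := l) hl)
      (fun i => sum_sarkaria (x i)) a i
    simpa using this

end Plane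

section Partition

variable {ι : Type*} [Fintype ι] {x : ι → EuclideanSpace ℝ (Fin 2)} {a : ι → Fin 3}

open Classical in
/-- The points with label `j`. -/
noncomputable def labelPart (x : ι → EuclideanSpace ℝ (Fin 2)) (a : ι → Fin 3) (j : Fin 3) :
    Finset (EuclideanSpace ℝ (Fin 2)) :=
  (univ.filter fun i => a i = j).image x

lemma apply_mem_labelPart (hx : Function.Injective x) {i : ι} {j : Fin 3} :
    x i ∈ labelPart x a j ↔ a i = j := by
  simp [labelPart, hx.eq_iff]

lemma labelPart_injective (hx : Function.Injective x) (ha : Function.Surjective a) :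
    Function.Injective (labelPart x a) := by
  intro j j' h
  obtain ⟨i, rfl⟩ := ha j
  rw [← apply_mem_labelPart hx, ← h, apply_mem_labelPart hx]

open Classical in
lemma isTverbergPartition_image_labelPart
    (hx : AlgebraicIndependent ℚ fun p : ι × Fin 2 => x p.1 p.2) (hι : Fintype.card ι = 7)
    (hinj : Function.Injective x) (ha : Function.Surjective a)
    (h : IsBalanced (fun i => sarkaria (x i)) a) :
    IsTverbergPartition 2 3 (univ.image x) (univ.image (labelPart x a)) := by
  refine ⟨?_, ?_, ?_, ?_⟩
  · rw [card_image_of_injective _ (labelPart_injective hinj ha), card_univ, Fintype.card_fin]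
  · simp only [mem_image, mem_univ, true_and, forall_exists_index, forall_apply_eq_imp_iff]
    exact fun j => image_subset_image (subset_univ _)
  · simp only [mem_image, mem_univ, true_and, forall_exists_index, forall_apply_eq_imp_iff]
    refine fun i => ⟨labelPart x a (a i), ⟨⟨a i, rfl⟩, (apply_mem_labelPart hinj).2 rfl⟩, ?_⟩
    rintro _ ⟨⟨j, rfl⟩, hj⟩
    rw [(apply_mem_labelPart hinj).1 hj]
  · obtain ⟨l, hpos, -, -, hrel⟩ := h.exists_pos hx hι
    rw [sum_smul_sarkaria_eq_zero_iff] at hrel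
    have hcenter : ∀ j, (univ.filter fun i => a i = j).centerMass l x =
        WithLp.toLp 2 fun k => (labelSum x a l j 2)⁻¹ * labelSum x a l j k.castSucc := by
      intro j
      ext k
      rw [labelSum_two, centerMass]
      simp only [PiLp.smul_apply, smul_eq_mul, labelSum, WithLp.ofLp_sum, Finset.sum_apply,
        Pi.smul_apply]
      congr 1
      refine sum_congr rfl fun i _ => ?_
      fin_cases k <;> rfl
    refine ⟨(univ.filter fun i => a i = 0).centerMass l x, ?_⟩
    simp only [mem_image, mem_univ, true_and, Set.mem_iInter, forall_exists_index,
      forall_apply_eq_imp_iff]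
    intro j
    rw [hcenter, hrel 0 j, ← hcenter]
    obtain ⟨i, hi⟩ := ha j
    refine centerMass_mem_convexHull _ (fun i _ => (hpos i).le)
      (sum_pos (fun i _ => hpos i) ⟨i, by simpa using hi⟩) fun i hi => ?_
    exact (apply_mem_labelPart hinj).2 (mem_filter.1 hi).2

open Classical in
lemma exists_perm_of_image_labelPart_eq (hx : Function.Injective x) {b : ι → Fin 3}
    (hb : Function.Surjective b)
    (h : univ.image (labelPart x b) = univ.image (labelPart x a)) :
    ∃ σ : Equiv.Perm (Fin 3), σ ∘ a = b := by
  have hex : ∀ j, ∃ k, labelPart x b k = labelPart x a j := fun j => by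
    have : labelPart x a j ∈ univ.image (labelPart x b) := h ▸ mem_image_of_mem _ (mem_univ j)
    simpa using this
  choose τ hτ using hex
  have hcomp : τ ∘ a = b := funext fun i => by
    rw [Function.comp_apply, eq_comm, ← apply_mem_labelPart (a := b) hx, hτ,
      apply_mem_labelPart hx]
  have hsurj : Function.Surjective τ := Function.Surjective.of_comp (hcomp.symm ▸ hb)
  exact ⟨Equiv.ofBijective τ (Finite.surjective_iff_bijective.1 hsurj), hcomp⟩

end Partition

/-- Sierksma's conjecture for q = 3, d = 2: every set of 7 points in general
position in the plane has at least ((3−1)!)² = 4 Tverberg partitions into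
3 parts. -/
theorem sierksma_q3_d2
    (X : Finset (EuclideanSpace ℝ (Fin 2))) (hcard : X.card = 7)
    (hgen : AlgebraicIndependent ℚ
      (fun p : {x // x ∈ X} × Fin 2 => (p.1 : EuclideanSpace ℝ (Fin 2)) p.2)) :
    4 ≤ {P : Finset (Finset (EuclideanSpace ℝ (Fin 2))) |
      IsTverbergPartition 2 3 X P}.ncard := by
  classical
  let e := (X.equivFinOfCardEq hcard).symm
  let x : Fin 7 → EuclideanSpace ℝ (Fin 2) := fun i => e i
  have hinj : Function.Injective x := Subtype.val_injective.comp e.injective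
  have hx : AlgebraicIndependent ℚ fun p : Fin 7 × Fin 2 => x p.1 p.2 :=
    hgen.comp (fun p : Fin 7 × Fin 2 => (e p.1, p.2)) (e.injective.prodMap Function.injective_id)
  have hX : univ.image x = X := by
    ext y
    simp only [mem_image, mem_univ, true_and]
    constructor
    · rintro ⟨i, rfl⟩
      exact (e i).2
    · intro hy
      exact ⟨e.symm ⟨y, hy⟩, by simp [x]⟩
  set S := univ.filter fun a => IsBalanced (fun i => sarkaria (x i)) a with hS
  have hfam : IsTverbergFamily S := isTverbergFamily_filter_isBalanced hx
  have hne : S.Nonempty := by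
    obtain ⟨a, ha⟩ := exists_isBalanced (fun i => sarkaria (x i)) (by simp)
      fun i => sum_sarkaria (x i)
    exact ⟨a, by simpa [hS] using ha⟩
  have hle : S.card ≤ 6 * (S.image fun a => univ.image (labelPart x a)).card := by
    refine card_le_mul_card_image S 6 fun P hP => ?_
    obtain ⟨a, -, rfl⟩ := mem_image.1 hP
    calc _ ≤ (univ.image fun σ : Equiv.Perm (Fin 3) => σ ∘ a).card := by
          refine card_le_card fun b hb => ?_
          rw [mem_filter] at hb
          obtain ⟨σ, hσ⟩ := exists_perm_of_image_labelPart_eq hinj (hfam.surjective hb.1) hb.2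
          exact mem_image.2 ⟨σ, mem_univ σ, hσ⟩
      _ ≤ 6 := card_image_le.trans (by simp [Fintype.card_perm, Nat.factorial])
  have hsub : ((S.image fun a => univ.image (labelPart x a) : Finset _) : Set _) ⊆
      {P | IsTverbergPartition 2 3 X P} := by
    intro P hP
    obtain ⟨a, ha, rfl⟩ := mem_image.1 (mem_coe.1 hP)
    rw [Set.mem_ofPred_eq, ← hX]
    exact isTverbergPartition_image_labelPart hx (Fintype.card_fin 7) hinj (hfam.surjective ha)
      (mem_filter.1 ha).2
  have hfin : {P | IsTverbergPartition 2 3 X P}.Finite :=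
    (X.powerset.powerset.finite_toSet).subset fun P hP => by
      rw [mem_coe, mem_powerset]
      exact fun A hA => mem_powerset.2 (hP.2.1 A hA)
  have h24 := hfam.card_ge hne
  have := Set.ncard_le_ncard hsub hfin
  rw [Set.ncard_coe_finset] at this
  omega
end
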